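/- For every ε ∈ (0,1/10) there exist a₀ ∈ (0,1), h₀ ∈ (0,1) and a constant C, depending only on ε and the cutoffs, such that for all 0 < h ≤ h₀, all a with h^{2/3−ε} ≤ a ≤ a₀ (λ := a^{3/2}/h), all X ≥ 0, Y ∈ ℝ, and all T with λ² ≤ |T| ≤ 2a^{−1/2}: |G^♯(T,X,Y)| ≤ C h^{1/3} h^{−2} λ^{−4/3}. -/

import Mathlib

open Real Complex Filter MeasureTheory

/-- `A₊(z) = e^{-iπ/3} Ai(e^{-iπ/3} z)`. -/
noncomputable def Aplus (Ai : ℂ → ℂ) (z : ℂ) : ℂ :=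
  Complex.exp (-(Real.pi / 3 : ℂ) * Complex.I) * Ai (Complex.exp (-(Real.pi / 3 : ℂ) * Complex.I) * z)

/-- `A₋(z) = e^{iπ/3} Ai(e^{iπ/3} z)`. -/
noncomputable def Aminus (Ai : ℂ → ℂ) (z : ℂ) : ℂ :=
  Complex.exp ((Real.pi / 3 : ℂ) * Complex.I) * Ai (Complex.exp ((Real.pi / 3 : ℂ) * Complex.I) * z)

/-- `B(u) = (4/3)u + π/2 − L(u^{2/3})`. -/
noncomputable def Bfun (L : ℝ → ℝ) (u : ℝ) : ℝ :=
  (4/3) * u + Real.pi / 2 - L (u ^ ((2 : ℝ)/3))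

/-- The phase `Ψ_{N,a}(T,X,Y,Υ,S,A,η)` of the tangential reflected waves, with `λ = a^{3/2}/h`. -/
noncomputable def PsiTan (L : ℝ → ℝ) (h a : ℝ) (N : ℤ) (T X Y Υ S A η : ℝ) : ℝ :=
  η * (Y + Υ ^ 3 / 3 + Υ * (X - A) + S ^ 3 / 3 + S * (1 - A)
      + T * Real.sqrt (1 + a) * (A - 1) / (Real.sqrt (1 + a * A) + Real.sqrt (1 + a))
      - (4/3) * (N : ℝ) * A ^ ((3:ℝ)/2))
    + ((N : ℝ) / (a ^ ((3:ℝ)/2) / h)) * Bfun L (η * (a ^ ((3:ℝ)/2) / h) * A ^ ((3:ℝ)/2))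

/-- The `N`-th tangential reflected wave `W_{N,a}(T,X,Y)`; the integration variables are
`S = v.1`, `Υ = v.2.1`, `A = v.2.2.1`, `η = v.2.2.2`. -/
noncomputable def Wtan (L : ℝ → ℝ) (ψ : ℝ → ℝ) (χ₂ : ℝ × ℝ → ℝ) (ψ₃ : ℝ → ℝ)
    (h a : ℝ) (N : ℤ) (T X Y : ℝ) : ℂ :=
  ((a ^ 2 / (2 * Real.pi * h) ^ 3 : ℝ) : ℂ) * ∫ v : ℝ × ℝ × ℝ × ℝ,
    Complex.exp (Complex.I *
      (((a ^ ((3:ℝ)/2) / h) * PsiTan L h a N T X Y v.2.1 v.1 v.2.2.1 v.2.2.2 : ℝ) : ℂ)) *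
    ((v.2.2.2 ^ 2 * ψ v.2.2.2 * χ₂ (v.1, v.2.1) * ψ₃ v.2.2.1 : ℝ) : ℂ)

/-- `G^♯(T,X,Y) = Σ_{|N| ≤ 2a^{−1/2}} W_{N,a}(T,X,Y)`. -/
noncomputable def Gsharp (L : ℝ → ℝ) (ψ : ℝ → ℝ) (χ₂ : ℝ × ℝ → ℝ) (ψ₃ : ℝ → ℝ)
    (h a : ℝ) (T X Y : ℝ) : ℂ :=
  ∑' N : ℤ, Set.indicator {N : ℤ | |(N : ℝ)| ≤ 2 / Real.sqrt a}
    (fun N => Wtan L ψ χ₂ ψ₃ h a N T X Y) N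

/-- The moments `∫ x^(2 * j) exp(-p x² - v x⁶) dx` of a Gaussian-sextic weight. -/
noncomputable def sexticMoment (j : ℕ) (p v : ℝ) : ℝ :=
  ∫ x : ℝ, x ^ (2 * j) * Real.exp (-(p * x ^ 2) - v * x ^ 6)

theorem integrable_even_pow_mul_exp_neg_sq (j : ℕ) {p : ℝ} (hp : 0 < p) :
    Integrable fun x : ℝ => x ^ (2 * j) * Real.exp (-(p * x ^ 2)) := by
  have h := integrable_rpow_mul_exp_neg_mul_sq hp (s := ((2 * j : ℕ) : ℝ)) (by
    have : (0 : ℝ) ≤ ((2 * j : ℕ) : ℝ) := Nat.cast_nonneg _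
    linarith)
  refine h.congr (ae_of_all _ fun x => ?_)
  simp only [Real.rpow_natCast, neg_mul]

theorem integrable_sexticMoment_of_pos_left (j : ℕ) {p v : ℝ} (hp : 0 < p) (hv : 0 ≤ v) :
    Integrable fun x : ℝ => x ^ (2 * j) * Real.exp (-(p * x ^ 2) - v * x ^ 6) := by
  refine (integrable_even_pow_mul_exp_neg_sq j hp).mono' (by fun_prop) (ae_of_all _ fun x => ?_)
  have h0 : 0 ≤ x ^ (2 * j) := by rw [pow_mul]; positivity
  rw [norm_of_nonneg (by positivity)]
  gcongr
  have : 0 ≤ v * x ^ 6 := by positivity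
  linarith

theorem integrable_sexticMoment_of_pos_right (j : ℕ) (p : ℝ) {v : ℝ} (hv : 0 < v) :
    Integrable fun x : ℝ => x ^ (2 * j) * Real.exp (-(p * x ^ 2) - v * x ^ 6) := by
  set K : ℝ := 1 + |p| with hK
  refine ((integrable_even_pow_mul_exp_neg_sq j one_pos).const_mul
    (Real.exp (K ^ 2 / v + K))).mono' (by fun_prop) (ae_of_all _ fun x => ?_)
  have h0 : 0 ≤ x ^ (2 * j) := by rw [pow_mul]; positivity
  rw [norm_of_nonneg (by positivity), mul_left_comm, ← Real.exp_add]
  gcongr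
  have hKp : 1 - p ≤ K := by have := neg_abs_le p; linarith
  have hK0 : 0 < K := by positivity
  have hy : K * x ^ 2 ≤ v * x ^ 6 + K ^ 2 / v + K := by
    have hy0 : 0 ≤ x ^ 2 := sq_nonneg x
    have e6 : x ^ 6 = (x ^ 2) ^ 3 := by ring
    rw [e6]
    generalize x ^ 2 = y at hy0 ⊢
    rcases le_or_gt y 1 with h | h
    · have h1 : 0 ≤ v * y ^ 3 := by positivity
      have h2 : 0 ≤ K ^ 2 / v := by positivity
      nlinarith
    · have h3 : y ^ 2 ≤ y ^ 3 := by nlinarith [sq_nonneg y]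
      have h4 : K * y ≤ v * y ^ 2 + K ^ 2 / v := by
        have : v * y ^ 2 + K ^ 2 / v - K * y = ((v * y - K / 2) ^ 2 + 3 / 4 * K ^ 2) / v := by
          field_simp; ring
        have : 0 ≤ ((v * y - K / 2) ^ 2 + 3 / 4 * K ^ 2) / v := by positivity
        linarith
      nlinarith
  nlinarith [sq_nonneg x]

theorem hasDerivAt_sexticMoment_left (j : ℕ) (p : ℝ) {v : ℝ} (hv : 0 < v) :
    HasDerivAt (fun p => sexticMoment j p v) (-sexticMoment (j + 1) p v) p := by
  have key := hasDerivAt_integral_of_dominated_loc_of_deriv_le (μ := volume)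
    (F := fun (p x : ℝ) => x ^ (2 * j) * Real.exp (-(p * x ^ 2) - v * x ^ 6))
    (F' := fun (p x : ℝ) => -(x ^ (2 * (j + 1)) * Real.exp (-(p * x ^ 2) - v * x ^ 6)))
    (x₀ := p) (s := Set.Ioi (p - 1)) (Ioi_mem_nhds (by linarith))
    (bound := fun x => x ^ (2 * (j + 1)) * Real.exp (-((p - 1) * x ^ 2) - v * x ^ 6))
    (Eventually.of_forall fun p => (by fun_prop))
    (integrable_sexticMoment_of_pos_right j p hv) (by fun_prop)
    (ae_of_all _ fun x q hq => ?_)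
    (integrable_sexticMoment_of_pos_right (j + 1) (p - 1) hv)
    (ae_of_all _ fun x q hq => ?_)
  · have := key.2
    rw [integral_neg] at this
    exact this
  · have h0 : 0 ≤ x ^ (2 * (j + 1)) := by rw [pow_mul]; positivity
    rw [norm_neg, norm_of_nonneg (by positivity)]
    have hq' : p - 1 ≤ q := (Set.mem_Ioi.1 hq).le
    gcongr
  · have h : HasDerivAt (fun q : ℝ => -(q * x ^ 2) - v * x ^ 6) (-(x ^ 2)) q := by
      simpa using (((hasDerivAt_id q).mul_const (x ^ 2)).neg).sub_const (v * x ^ 6)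
    exact (h.exp.const_mul (x ^ (2 * j))).congr_deriv (by ring)

theorem hasDerivAt_sexticMoment_right (j : ℕ) {p : ℝ} (hp : 0 < p) {v : ℝ} (hv : 0 < v) :
    HasDerivAt (fun v => sexticMoment j p v) (-sexticMoment (j + 3) p v) v := by
  have key := hasDerivAt_integral_of_dominated_loc_of_deriv_le (μ := volume)
    (F := fun (v x : ℝ) => x ^ (2 * j) * Real.exp (-(p * x ^ 2) - v * x ^ 6))
    (F' := fun (v x : ℝ) => -(x ^ (2 * (j + 3)) * Real.exp (-(p * x ^ 2) - v * x ^ 6)))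
    (x₀ := v) (s := Set.Ioi 0) (Ioi_mem_nhds hv)
    (bound := fun x => x ^ (2 * (j + 3)) * Real.exp (-(p * x ^ 2)))
    (Eventually.of_forall fun p => (by fun_prop))
    (integrable_sexticMoment_of_pos_left j hp hv.le) (by fun_prop)
    (ae_of_all _ fun x q hq => ?_)
    (integrable_even_pow_mul_exp_neg_sq (j + 3) hp)
    (ae_of_all _ fun x q hq => ?_)
  · have := key.2
    rw [integral_neg] at this
    exact this
  · have h0 : 0 ≤ x ^ (2 * (j + 3)) := by rw [pow_mul]; positivity
    rw [norm_neg, norm_of_nonneg (by positivity)]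
    gcongr
    have : 0 ≤ q * x ^ 6 := mul_nonneg (le_of_lt hq) (by positivity)
    linarith
  · have h : HasDerivAt (fun q : ℝ => -(p * x ^ 2) - q * x ^ 6) (-(x ^ 6)) q := by
      simpa using ((hasDerivAt_id q).mul_const (x ^ 6)).const_sub (-(p * x ^ 2))
    exact (h.exp.const_mul (x ^ (2 * j))).congr_deriv (by ring)

theorem sexticMoment_pos (j : ℕ) {p v : ℝ} (hp : 0 < p) (hv : 0 ≤ v) :
    0 < sexticMoment j p v := by
  unfold sexticMoment
  rw [integral_pos_iff_support_of_nonneg]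
  · have hs : Set.Ioi (0 : ℝ) ⊆ Function.support
        fun x : ℝ => x ^ (2 * j) * Real.exp (-(p * x ^ 2) - v * x ^ 6) := by
      intro x hx
      have hx' : (0 : ℝ) < x := hx
      exact (by positivity : (0:ℝ) < x ^ (2 * j) * Real.exp (-(p * x ^ 2) - v * x ^ 6)).ne'
    exact lt_of_lt_of_le (by simp) (measure_mono hs)
  · intro x
    have h0 : 0 ≤ x ^ (2 * j) := by rw [pow_mul]; positivity
    exact mul_nonneg h0 (Real.exp_nonneg _)
  · exact integrable_sexticMoment_of_pos_left j hp hv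

theorem sexticMoment_antitone_right (j : ℕ) {p : ℝ} (hp : 0 < p) {v w : ℝ} (hv : 0 ≤ v)
    (hvw : v ≤ w) : sexticMoment j p w ≤ sexticMoment j p v := by
  refine integral_mono (integrable_sexticMoment_of_pos_left j hp (hv.trans hvw))
    (integrable_sexticMoment_of_pos_left j hp hv) fun x => ?_
  have h0 : 0 ≤ x ^ (2 * j) := by rw [pow_mul]; positivity
  dsimp only
  gcongr

theorem sexticMoment_zero_sub_le {p : ℝ} (hp : 0 < p) {v : ℝ} (hv : 0 ≤ v) :
    sexticMoment 0 p 0 - sexticMoment 0 p v ≤ v * sexticMoment 3 p 0 := by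
  unfold sexticMoment
  rw [← integral_sub (integrable_sexticMoment_of_pos_left 0 hp le_rfl)
    (integrable_sexticMoment_of_pos_left 0 hp hv), ← integral_const_mul]
  refine integral_mono ((integrable_sexticMoment_of_pos_left 0 hp le_rfl).sub
    (integrable_sexticMoment_of_pos_left 0 hp hv))
    ((integrable_sexticMoment_of_pos_left 3 hp le_rfl).const_mul v) fun x => ?_
  have h1 : 1 - v * x ^ 6 ≤ Real.exp (-(v * x ^ 6)) := by
    have := Real.add_one_le_exp (-(v * x ^ 6)); linarith
  have h2 : Real.exp (-(p * x ^ 2) - v * x ^ 6)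
      = Real.exp (-(p * x ^ 2)) * Real.exp (-(v * x ^ 6)) := by
    rw [← Real.exp_add]; congr 1
  have h3 := Real.exp_pos (-(p * x ^ 2))
  simp only [mul_zero, pow_zero, one_mul, zero_mul, sub_zero]
  rw [h2]
  have e : 2 * 3 = 6 := rfl
  rw [e]
  nlinarith

theorem sexticMoment_ode (ω : ℝ) {v : ℝ} (hv : 0 < v) :
    2 * sexticMoment 0 ω v - 4 * ω * sexticMoment 1 ω v - 12 * v * sexticMoment 3 ω v = 0 := by
  have i0 := integrable_sexticMoment_of_pos_right 0 ω hv
  have i1 := integrable_sexticMoment_of_pos_right 1 ω hv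
  have i3 := integrable_sexticMoment_of_pos_right 3 ω hv
  have hcint : Integrable (fun x : ℝ => 2 * (x ^ (2 * 0) * Real.exp (-(ω * x ^ 2) - v * x ^ 6))
      - 4 * ω * (x ^ (2 * 1) * Real.exp (-(ω * x ^ 2) - v * x ^ 6))
      - 12 * v * (x ^ (2 * 3) * Real.exp (-(ω * x ^ 2) - v * x ^ 6))) :=
    ((i0.const_mul 2).sub (i1.const_mul (4 * ω))).sub (i3.const_mul (12 * v))
  have hxi : Integrable (fun x : ℝ => 2 * x * Real.exp (-(ω * x ^ 2) - v * x ^ 6)) := by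
    refine ((i0.add i1)).mono' (by fun_prop) (ae_of_all _ fun x => ?_)
    have he := Real.exp_pos (-(ω * x ^ 2) - v * x ^ 6)
    simp only [norm_mul, Real.norm_eq_abs, abs_of_pos he, Pi.add_apply, mul_zero, pow_zero,
      mul_one, one_mul]
    have : |(2 : ℝ)| * |x| ≤ 1 + x ^ 2 := by
      rw [abs_of_pos two_pos]; nlinarith [sq_nonneg (|x| - 1), sq_abs x]
    nlinarith
  have h0 := integral_eq_zero_of_hasDerivAt_of_integrable
    (f := fun x : ℝ => 2 * x * Real.exp (-(ω * x ^ 2) - v * x ^ 6)) (fun x => ?_) hcint hxi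
  · have e1 := integral_sub ((i0.const_mul 2).sub (i1.const_mul (4 * ω))) (i3.const_mul (12 * v))
    have e2 := integral_sub (i0.const_mul 2) (i1.const_mul (4 * ω))
    simp only [Pi.sub_apply] at e1
    rw [e1, e2, integral_const_mul, integral_const_mul, integral_const_mul] at h0
    exact h0
  · have h1 : HasDerivAt (fun x : ℝ => -(ω * x ^ 2) - v * x ^ 6)
        (-(ω * (2 * x)) - v * (6 * x ^ 5)) x := by
      have a := ((hasDerivAt_pow 2 x).const_mul ω).neg
      have b := (hasDerivAt_pow 6 x).const_mul v
      exact (a.sub b).congr_deriv (by push_cast; ring)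
    have h2 : HasDerivAt (fun x : ℝ => 2 * x) 2 x := by
      simpa using (hasDerivAt_id x).const_mul 2
    exact (h2.mul h1.exp).congr_deriv (by ring)

theorem sexticMoment_scaling {u : ℝ} (hu : 0 < u) :
    sexticMoment 0 (u ^ ((2 : ℝ) / 3)) (1 / 12)
      = u ^ (-(1 : ℝ) / 3) * sexticMoment 0 1 (1 / (12 * u ^ 2)) := by
  set w := u ^ ((1 : ℝ) / 3) with hw
  have hw0 : 0 < w := Real.rpow_pos_of_pos hu _
  have hw3 : w ^ 3 = u := by
    rw [hw, ← Real.rpow_natCast, ← Real.rpow_mul hu.le]; norm_num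
  have h1 : u ^ ((2 : ℝ) / 3) = w ^ 2 := by
    rw [hw, ← Real.rpow_natCast, ← Real.rpow_mul hu.le]; norm_num
  have h2 : u ^ (-(1 : ℝ) / 3) = w⁻¹ := by
    rw [hw, ← Real.rpow_neg hu.le]; norm_num
  rw [h1, h2, ← hw3]
  unfold sexticMoment
  have := Measure.integral_comp_mul_left
    (fun x : ℝ => x ^ (2 * 0) * Real.exp (-(1 * x ^ 2) - 1 / (12 * (w ^ 3) ^ 2) * x ^ 6)) w
  rw [abs_of_pos (inv_pos.2 hw0), smul_eq_mul] at this
  rw [← this]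
  congr 1
  ext x
  simp only [mul_zero, pow_zero, one_mul]
  congr 1
  field_simp

theorem sexticMoment_zero_left (j : ℕ) :
    sexticMoment j 0 (1 / 12)
      = 2 * ((1 / 12 : ℝ) ^ (-((2 * j : ℕ) + 1 : ℝ) / 6) * (1 / 6)
          * Real.Gamma (((2 * j : ℕ) + 1) / 6)) := by
  have h := _root_.integral_rpow_mul_exp_neg_mul_rpow (p := 6) (q := ((2 * j : ℕ) : ℝ))
      (b := 1 / 12)
    (by norm_num) (by
      have : (0 : ℝ) ≤ ((2 * j : ℕ) : ℝ) := Nat.cast_nonneg _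
      linarith) (by norm_num)
  rw [← h]
  have h2 := integral_comp_abs (f := fun x : ℝ => x ^ (2 * j) * Real.exp (-(1 / 12) * x ^ 6))
  unfold sexticMoment
  have e : ∀ x : ℝ, |x| ^ (2 * j) * Real.exp (-(1 / 12) * |x| ^ 6)
      = x ^ (2 * j) * Real.exp (-(0 * x ^ 2) - 1 / 12 * x ^ 6) := by
    intro x
    rw [Even.pow_abs ⟨j, by ring⟩, Even.pow_abs ⟨3, rfl⟩]
    congr 2
    ring
  simp_rw [e] at h2
  rw [h2]
  congr 1
  refine setIntegral_congr_fun measurableSet_Ioi fun x hx => ?_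
  have e6 : x ^ (6 : ℝ) = x ^ 6 := by exact_mod_cast Real.rpow_natCast x 6
  rw [Real.rpow_natCast, e6]

theorem sexticMoment_zero_left_eq_pow {t s : ℝ} (ht : 0 < t) (hs : 0 < s)
    (ht3 : t ^ 3 = 2) (hs6 : s ^ 6 = 3) (j : ℕ) :
    sexticMoment j 0 (1 / 12)
      = 1 / 3 * ((t * s) ^ (2 * j + 1) * Real.Gamma (((2 * j : ℕ) + 1) / 6)) := by
  have h12 : (1 / 12 : ℝ) = ((t * s) ^ 6)⁻¹ := by
    have : (t * s) ^ 6 = (t ^ 3) ^ 2 * s ^ 6 := by ring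
    rw [this, ht3, hs6]; norm_num
  have h : (1 / 12 : ℝ) ^ (-((2 * j : ℕ) + 1 : ℝ) / 6) = (t * s) ^ (2 * j + 1) := by
    have hts : 0 < t * s := mul_pos ht hs
    rw [h12, Real.inv_rpow (by positivity), ← Real.rpow_neg (by positivity),
      ← Real.rpow_natCast (t * s) 6, ← Real.rpow_mul hts.le, ← Real.rpow_natCast]
    congr 1
    push_cast; ring
  rw [sexticMoment_zero_left, h]
  ring

/-- The two relations between the Airy initial values and the sextic moments at `0`. -/
theorem airy_initial_relations :
    (3 : ℝ) ^ (-(2 : ℝ) / 3) / Real.Gamma (2 / 3) * sexticMoment 1 0 (1 / 12)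
        = (3 : ℝ) ^ (-(1 : ℝ) / 3) / Real.Gamma (1 / 3) * sexticMoment 0 0 (1 / 12) ∧
      2 * ((3 : ℝ) ^ (-(1 : ℝ) / 3) / Real.Gamma (1 / 3)) * sexticMoment 1 0 (1 / 12)
        = (3 : ℝ) ^ (-(2 : ℝ) / 3) / Real.Gamma (2 / 3) * sexticMoment 2 0 (1 / 12) := by
  set t : ℝ := 2 ^ ((1 : ℝ) / 3) with ht
  set s : ℝ := 3 ^ ((1 : ℝ) / 6) with hs
  have ht0 : 0 < t := Real.rpow_pos_of_pos two_pos _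
  have hs0 : 0 < s := Real.rpow_pos_of_pos three_pos _
  have ht3 : t ^ 3 = 2 := by
    rw [ht, ← Real.rpow_natCast, ← Real.rpow_mul two_pos.le]; norm_num
  have hs6 : s ^ 6 = 3 := by
    rw [hs, ← Real.rpow_natCast, ← Real.rpow_mul three_pos.le]; norm_num
  have h3a : (3 : ℝ) ^ (-(2 : ℝ) / 3) = (s ^ 4)⁻¹ := by
    rw [hs, ← Real.rpow_natCast, ← Real.rpow_mul three_pos.le, ← Real.rpow_neg three_pos.le]
    norm_num
  have h3b : (3 : ℝ) ^ (-(1 : ℝ) / 3) = (s ^ 2)⁻¹ := by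
    rw [hs, ← Real.rpow_natCast, ← Real.rpow_mul three_pos.le, ← Real.rpow_neg three_pos.le]
    norm_num
  have hg1 := Real.Gamma_mul_Gamma_add_half (1 / 6)
  have hg2 := Real.Gamma_mul_Gamma_add_half (1 / 3)
  have ha1 : (2 : ℝ) ^ (1 - 2 * (1 / 6 : ℝ)) = t ^ 2 := by
    rw [ht, ← Real.rpow_natCast, ← Real.rpow_mul two_pos.le]; norm_num
  have ha2 : (2 : ℝ) ^ (1 - 2 * (1 / 3 : ℝ)) = t := by
    rw [ht]; norm_num
  rw [ha1] at hg1
  rw [ha2] at hg2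
  norm_num at hg1 hg2
  have G1 : 0 < Real.Gamma (1 / 3) := Real.Gamma_pos_of_pos (by norm_num)
  have G2 : 0 < Real.Gamma (2 / 3) := Real.Gamma_pos_of_pos (by norm_num)
  have m0 := sexticMoment_zero_left_eq_pow ht0 hs0 ht3 hs6 0
  have m1 := sexticMoment_zero_left_eq_pow ht0 hs0 ht3 hs6 1
  have m2 := sexticMoment_zero_left_eq_pow ht0 hs0 ht3 hs6 2
  norm_num at m0 m1 m2
  have hhalf : Real.Gamma (1 / 2) = √π := Real.Gamma_one_half_eq
  norm_num at hhalf
  rw [h3a, h3b, m0, m1, m2, hhalf]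
  generalize Real.Gamma (1 / 6) = g16 at *
  generalize Real.Gamma (5 / 6) = g56 at *
  generalize Real.Gamma (1 / 3) = g1 at *
  generalize Real.Gamma (2 / 3) = g2 at *
  constructor
  · field_simp
    have : t ^ 2 * (g1 * √π) = g16 * g2 := by linarith
    linear_combination this
  · field_simp
    have e1 : t * (g2 * √π) = g1 * g56 := by linarith
    linear_combination t ^ 2 * e1 - √π * g2 * ht3

theorem eq_zero_of_appell_ode {a b e : ℝ → ℂ}
    (ha : ∀ t, HasDerivAt a (b t) t) (hb : ∀ t, HasDerivAt b (e t) t)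
    (he : ∀ t, HasDerivAt e (-4 * t * b t - 2 * a t) t)
    (ha0 : a 0 = 0) (hb0 : b 0 = 0) (he0 : e 0 = 0) {t : ℝ} (ht : 0 ≤ t) : a t = 0 := by
  set f : ℝ → ℂ × ℂ × ℂ := fun t => (a t, b t, e t) with hf
  have hfd : ∀ t, HasDerivAt f (b t, e t, -4 * t * b t - 2 * a t) t := fun t =>
    (ha t).prodMk ((hb t).prodMk (he t))
  have h := norm_le_gronwallBound_of_norm_deriv_right_le (f := f)
    (f' := fun t => (b t, e t, -4 * t * b t - 2 * a t)) (δ := 0) (K := 4 * t + 2) (ε := 0)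
    (a := 0) (b := t) (fun x _ => (hfd x).continuousAt.continuousWithinAt)
    (fun x _ => (hfd x).hasDerivWithinAt) (by simp [hf, ha0, hb0, he0]) (fun x hx => ?_) t
    ⟨ht, le_rfl⟩
  · rw [gronwallBound_ε0_δ0] at h
    have : f t = 0 := norm_le_zero_iff.1 h
    exact congrArg Prod.fst this
  · have n1 : ‖a x‖ ≤ ‖f x‖ := norm_fst_le (f x)
    have n2 : ‖b x‖ ≤ ‖f x‖ := (norm_fst_le (f x).2).trans (norm_snd_le (f x))
    have n3 : ‖e x‖ ≤ ‖f x‖ := (norm_snd_le (f x).2).trans (norm_snd_le (f x))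
    have h0 : 0 ≤ ‖f x‖ := norm_nonneg _
    have hk : ‖f x‖ ≤ (4 * t + 2) * ‖f x‖ := by nlinarith [hx.1, hx.2]
    rw [add_zero]
    refine norm_prod_le_iff.2 ⟨n2.trans hk, norm_prod_le_iff.2 ⟨n3.trans hk, ?_⟩⟩
    have : ‖-4 * (x : ℂ) * b x - 2 * a x‖ ≤ 4 * x * ‖b x‖ + 2 * ‖a x‖ := by
      refine (norm_sub_le _ _).trans ?_
      simp [abs_of_nonneg hx.1]
    refine this.trans ?_
    have := mul_le_mul_of_nonneg_left n2 hx.1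
    have := mul_le_mul_of_nonneg_right hx.2.le h0
    nlinarith

theorem hasDerivAt_of_exp_neg_mul_I {L : ℝ → ℝ} {E : ℝ → ℂ} {E' : ℂ} {w₀ : ℝ}
    (hL : Continuous L) (hLE : ∀ w, Complex.exp (-(L w : ℂ) * Complex.I) = E w)
    (hE : HasDerivAt E E' w₀) : HasDerivAt L (Complex.I * (E' / E w₀)).re w₀ := by
  have hne : E w₀ ≠ 0 := by rw [← hLE]; exact Complex.exp_ne_zero _
  have hr : HasDerivAt (fun w => E w / E w₀) (E' / E w₀) w₀ := hE.div_const _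
  have hlog : HasDerivAt (fun w => Complex.log (E w / E w₀)) (E' / E w₀) w₀ := by
    have := hr.clog_real (by rw [div_self hne]; exact Complex.one_mem_slitPlane)
    rwa [div_self hne, div_one] at this
  have hev : (fun w => (L w₀ : ℂ) + Complex.I * Complex.log (E w / E w₀))
      =ᶠ[nhds w₀] fun w => (L w : ℂ) := by
    have hnear : ∀ᶠ w in nhds w₀, |L w - L w₀| < π := by
      have := (hL.tendsto w₀).sub_const (L w₀) |>.abs
      rw [sub_self, abs_zero] at this
      exact this.eventually (gt_mem_nhds Real.pi_pos)
    filter_upwards [hnear] with w hw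
    rw [abs_lt] at hw
    have h1 : E w / E w₀ = Complex.exp (-((L w - L w₀ : ℝ) : ℂ) * Complex.I) := by
      rw [← hLE, ← hLE, ← Complex.exp_sub]
      congr 1
      push_cast; ring
    rw [h1, Complex.log_exp]
    · push_cast
      linear_combination (-(L w : ℂ) + L w₀) * Complex.I_mul_I
    · simp; linarith
    · simp; linarith
  have h2 := ((hlog.const_mul Complex.I).const_add (L w₀ : ℂ)).congr_of_eventuallyEq hev.symm
  have h3 := (Complex.reCLM.hasFDerivAt (x := (L w₀ : ℂ))).comp_hasDerivAt w₀ h2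
  simpa [Function.comp_def] using h3

theorem hasDerivAt_rotated_airy {Ai : ℂ → ℂ} (h1 : Differentiable ℂ Ai)
    (h2 : Differentiable ℂ (deriv Ai)) (hode : ∀ z, deriv (deriv Ai) z = z * Ai z)
    {c : ℂ} (hc : c ^ 3 = -1) (t : ℝ) :
    HasDerivAt (fun t : ℝ => c * Ai (c * t)) (c ^ 2 * deriv Ai (c * t)) t ∧
      HasDerivAt (fun t : ℝ => c ^ 2 * deriv Ai (c * t)) (-t * (c * Ai (c * t))) t := by
  have hl : HasDerivAt (fun t : ℝ => c * (t : ℂ)) c t := by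
    simpa using (Complex.ofRealCLM.hasDerivAt (x := t)).const_mul c
  constructor
  · exact (((h1 (c * t)).hasDerivAt.comp t hl).const_mul c).congr_deriv (by ring)
  · refine (((h2 (c * t)).hasDerivAt.comp t hl).const_mul (c ^ 2)).congr_deriv ?_
    rw [hode]
    linear_combination c * t * Ai (c * t) * hc

/-- The derivative of the reflection phase is an inverse sextic moment. -/
theorem hasDerivAt_airyPhase {Ai : ℂ → ℂ} (hd : Differentiable ℂ Ai)
    (hd' : Differentiable ℂ (deriv Ai)) (hode : ∀ z : ℂ, deriv (deriv Ai) z = z * Ai z)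
    (hzero : Ai 0 = (3 : ℂ) ^ (-(2 : ℂ) / 3) / Complex.Gamma (2 / 3))
    (hzero' : deriv Ai 0 = -((3 : ℂ) ^ (-(1 : ℂ) / 3)) / Complex.Gamma (1 / 3))
    {L : ℝ → ℝ} (hL : Continuous L) (hAp : ∀ w : ℝ, Aplus Ai w ≠ 0)
    (hLc : ∀ w : ℝ, Complex.exp (-(L w : ℂ) * Complex.I) = -(Aminus Ai w) / (Aplus Ai w))
    {w : ℝ} (hw : 0 < w) :
    HasDerivAt L (√3 * sexticMoment 1 0 (1 / 12) / sexticMoment 0 w (1 / 12)) w := by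
  set c : ℂ := Complex.exp (-(Real.pi / 3 : ℂ) * Complex.I) with hcdef
  set d : ℂ := Complex.exp ((Real.pi / 3 : ℂ) * Complex.I) with hddef
  have hdv : d = 1 / 2 + √3 / 2 * Complex.I := by
    rw [hddef, show (Real.pi / 3 : ℂ) = ((Real.pi / 3 : ℝ) : ℂ) by push_cast; rfl,
      Complex.exp_mul_I, ← Complex.ofReal_cos, ← Complex.ofReal_sin, Real.cos_pi_div_three,
      Real.sin_pi_div_three]
    push_cast; ring
  have hcv : c = 1 / 2 - √3 / 2 * Complex.I := by
    rw [hcdef, show -(Real.pi / 3 : ℂ) = ((-(Real.pi / 3) : ℝ) : ℂ) by push_cast; rfl,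
      Complex.exp_mul_I, ← Complex.ofReal_cos, ← Complex.ofReal_sin, Real.cos_neg, Real.sin_neg,
      Real.cos_pi_div_three, Real.sin_pi_div_three]
    push_cast; ring
  have h3 : (√3 : ℂ) ^ 2 = 3 := by
    rw [← Complex.ofReal_pow, Real.sq_sqrt (by norm_num)]; norm_num
  have hsum : c + d = 1 := by rw [hcv, hdv]; ring
  have hprod : c * d = 1 := by
    rw [hcv, hdv]
    linear_combination (1 / 4 : ℂ) * h3 - (√3 : ℂ) ^ 2 / 4 * Complex.I_sq
  have hdiff : d - c = √3 * Complex.I := by rw [hcv, hdv]; ring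
  have hc3 : c ^ 3 = -1 := by linear_combination (c ^ 2 + c) * hsum - (c + 1) * hprod
  have hd3 : d ^ 3 = -1 := by linear_combination (d ^ 2 + d) * hsum - (d + 1) * hprod
  clear_value c d
  have hp := hasDerivAt_rotated_airy hd hd' hode hc3
  have hm := hasDerivAt_rotated_airy hd hd' hode hd3
  obtain ⟨A0, A0pos, hA0, A1, A1pos, hA1, hrel1, hrel2⟩ : ∃ A0 : ℝ, 0 < A0 ∧ Ai 0 = A0 ∧
      ∃ A1 : ℝ, 0 < A1 ∧ deriv Ai 0 = -A1 ∧
      A0 * sexticMoment 1 0 (1 / 12) = A1 * sexticMoment 0 0 (1 / 12) ∧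
      2 * A1 * sexticMoment 1 0 (1 / 12) = A0 * sexticMoment 2 0 (1 / 12) := by
    refine ⟨(3 : ℝ) ^ (-(2 : ℝ) / 3) / Real.Gamma (2 / 3), ?_, ?_,
      (3 : ℝ) ^ (-(1 : ℝ) / 3) / Real.Gamma (1 / 3), ?_, ?_, airy_initial_relations⟩
    · exact div_pos (Real.rpow_pos_of_pos three_pos _) (Real.Gamma_pos_of_pos (by norm_num))
    · rw [hzero, Complex.ofReal_div, Complex.ofReal_cpow three_pos.le, ← Complex.Gamma_ofReal]
      push_cast; rfl
    · exact div_pos (Real.rpow_pos_of_pos three_pos _) (Real.Gamma_pos_of_pos (by norm_num))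
    · rw [hzero', Complex.ofReal_div, Complex.ofReal_cpow three_pos.le, ← Complex.Gamma_ofReal]
      push_cast; ring
  have hJ1 : 0 < sexticMoment 1 0 (1 / 12) := by
    rw [sexticMoment_zero_left]
    have : 0 < Real.Gamma (((2 * 1 : ℕ) + 1) / 6) := Real.Gamma_pos_of_pos (by norm_num)
    positivity
  have hJ : ∀ j t, HasDerivAt (fun t : ℝ => (sexticMoment j t (1 / 12) : ℂ))
      (-(sexticMoment (j + 1) t (1 / 12)) : ℂ) t := fun j t => by
    simpa using (hasDerivAt_sexticMoment_left j t (v := 1 / 12) (by norm_num)).ofReal_comp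
  set K : ℂ := A0 * A1 / (sexticMoment 1 0 (1 / 12) : ℝ) with hK
  have hJ1c : ((sexticMoment 1 0 (1 / 12) : ℝ) : ℂ) ≠ 0 := by exact_mod_cast hJ1.ne'
  have hrel1c : (A0 : ℂ) * (sexticMoment 1 0 (1 / 12) : ℝ)
    = A1 * (sexticMoment 0 0 (1 / 12) : ℝ) := by exact_mod_cast hrel1
  have hrel2c : 2 * (A1 : ℂ) * (sexticMoment 1 0 (1 / 12) : ℝ)
    = A0 * (sexticMoment 2 0 (1 / 12) : ℝ) := by exact_mod_cast hrel2
  have hK0 : K * (sexticMoment 0 0 (1 / 12) : ℝ) = A0 ^ 2 := by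
    rw [hK, div_mul_eq_mul_div, div_eq_iff hJ1c]; linear_combination -(A0 : ℂ) * hrel1c
  have hK1 : K * (sexticMoment 1 0 (1 / 12) : ℝ) = A0 * A1 := div_mul_cancel₀ _ hJ1c
  have hK2 : K * (sexticMoment 2 0 (1 / 12) : ℝ) = 2 * A1 ^ 2 := by
    rw [hK, div_mul_eq_mul_div, div_eq_iff hJ1c]; linear_combination -(A1 : ℂ) * hrel2c
  have hprodK : c * Ai (c * w) * (d * Ai (d * w)) = K * (sexticMoment 0 w (1 / 12) : ℝ) := by
    have h := eq_zero_of_appell_ode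
      (a := fun t => c * Ai (c * t) * (d * Ai (d * t)) - K * (sexticMoment 0 t (1 / 12) : ℝ))
      (b := fun t => c ^ 2 * deriv Ai (c * t) * (d * Ai (d * t))
        + c * Ai (c * t) * (d ^ 2 * deriv Ai (d * t)) + K * (sexticMoment 1 t (1 / 12) : ℝ))
      (e := fun t => -2 * (t * (c * Ai (c * t) * (d * Ai (d * t))))
        + 2 * (c ^ 2 * deriv Ai (c * t) * (d ^ 2 * deriv Ai (d * t)))
        - K * (sexticMoment 2 t (1 / 12) : ℝ))
      (fun t => ?_) (fun t => ?_) (fun t => ?_) ?_ ?_ ?_ hw.le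
    · exact sub_eq_zero.1 h
    · exact (((hp t).1.mul (hm t).1).sub ((hJ 0 t).const_mul K)).congr_deriv (by ring)
    · exact ((((hp t).2.mul (hm t).1).add ((hp t).1.mul (hm t).2)).add
        ((hJ 1 t).const_mul K)).congr_deriv (by ring)
    · have hid : HasDerivAt (fun t : ℝ => (t : ℂ)) 1 t := by
        exact (hasDerivAt_id t).ofReal_comp
      refine ((((hid.mul ((hp t).1.mul (hm t).1)).const_mul (-2)).add
        (((hp t).2.mul (hm t).2).const_mul 2)).sub ((hJ 2 t).const_mul K)).congr_deriv ?_
      have hode' := congrArg Complex.ofReal (sexticMoment_ode t (v := 1 / 12) (by norm_num))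
      push_cast at hode'
      simp only [Pi.mul_apply]
      linear_combination (-K) * hode'
    · simp only [Complex.ofReal_zero, mul_zero, hA0, hK0]
      linear_combination (A0 : ℂ) ^ 2 * hprod
    · simp only [Complex.ofReal_zero, mul_zero, hA0, hA1, hK1]
      linear_combination (-A0 * A1 : ℂ) * ((c + d) * hprod + hsum)
    · simp only [Complex.ofReal_zero, mul_zero, zero_mul, hA1, hK2]
      linear_combination (2 * A1 ^ 2 : ℂ) * (c * d + 1) * hprod
  have hW : ∀ t : ℝ, d ^ 2 * deriv Ai (d * t) * (c * Ai (c * t))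
      - d * Ai (d * t) * (c ^ 2 * deriv Ai (c * t)) = -(√3 * Complex.I * (A0 * A1)) := by
    intro t
    have hder : ∀ t : ℝ, HasDerivAt (fun t : ℝ => d ^ 2 * deriv Ai (d * t) * (c * Ai (c * t))
      - d * Ai (d * t) * (c ^ 2 * deriv Ai (c * t))) 0 t := fun t =>
      (((hm t).2.mul (hp t).1).sub ((hm t).1.mul (hp t).2)).congr_deriv (by ring)
    have := is_const_of_deriv_eq_zero (fun t => (hder t).differentiableAt)
      (fun t => (hder t).deriv) t 0
    rw [this]
    simp only [Complex.ofReal_zero, mul_zero, hA0, hA1]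
    linear_combination (-A0 * A1 : ℂ) * ((d - c) * hprod + hdiff)
  have hyp : ∀ t : ℝ, c * Ai (c * t) ≠ 0 := fun t => by
    have := hAp t
    rwa [Aplus, ← hcdef] at this
  have hE : HasDerivAt (fun t : ℝ => -(d * Ai (d * t)) / (c * Ai (c * t)))
      ((√3 * Complex.I * (A0 * A1)) / (c * Ai (c * w)) ^ 2) w := by
    refine ((hm w).1.neg.div (hp w).1 (hyp w)).congr_deriv ?_
    congr 1
    simp only [Pi.neg_apply]
    linear_combination -(hW w)
  have hmain := hasDerivAt_of_exp_neg_mul_I hL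
      (E := fun t : ℝ => -(d * Ai (d * t)) / (c * Ai (c * t)))
    (fun t => by rw [hLc, Aplus, Aminus, ← hcdef, ← hddef]) hE
  refine hmain.congr_deriv ?_
  have hJ0 : 0 < sexticMoment 0 w (1 / 12) := sexticMoment_pos 0 hw (by norm_num)
  have hJ0c : ((sexticMoment 0 w (1 / 12) : ℝ) : ℂ) ≠ 0 := by exact_mod_cast hJ0.ne'
  have hA0c : (A0 : ℂ) ≠ 0 := by exact_mod_cast A0pos.ne'
  have hA1c : (A1 : ℂ) ≠ 0 := by exact_mod_cast A1pos.ne'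
  have hval : Complex.I * (√3 * Complex.I * (A0 * A1) / (c * Ai (c * w)) ^ 2 /
      (-(d * Ai (d * w)) / (c * Ai (c * w))))
      = ((√3 * sexticMoment 1 0 (1 / 12) / sexticMoment 0 w (1 / 12) : ℝ) : ℂ) := by
    have hym : d * Ai (d * w) ≠ 0 := fun h0 => by
      rw [h0, mul_zero] at hprodK
      have hKne : K ≠ 0 := by rw [hK]; exact div_ne_zero (mul_ne_zero hA0c hA1c) hJ1c
      exact mul_ne_zero hKne hJ0c hprodK.symm
    have hyw := hyp w
    have e1 : Complex.I * (√3 * Complex.I * (A0 * A1) / (c * Ai (c * w)) ^ 2 /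
      (-(d * Ai (d * w)) / (c * Ai (c * w))))
      = √3 * (A0 * A1) / (c * Ai (c * w) * (d * Ai (d * w))) := by
      generalize c * Ai (c * w) = y at *
      generalize d * Ai (d * w) = z at *
      field_simp
      rw [Complex.I_sq]; ring
    rw [e1, hprodK, ← hK1]
    have hKne : K ≠ 0 := by rw [hK]; exact div_ne_zero (mul_ne_zero hA0c hA1c) hJ1c
    push_cast
    field_simp
  rw [hval, Complex.ofReal_re]

/-- A phase `ℓ` with derivatives `q`, `q₁`, `q₂` whose slope tends to `g`, and which is concave of
size exactly `u⁻³`. -/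
structure IsAlmostLinearPhase (ℓ q q₁ q₂ : ℝ → ℝ) (g c C : ℝ) : Prop where
  slope_pos : 0 < g
  lower_pos : 0 < c
  upper_pos : 0 < C
  deriv_zero : ∀ u, 0 < u → HasDerivAt ℓ (q u) u
  deriv_one : ∀ u, 0 < u → HasDerivAt q (q₁ u) u
  deriv_two : ∀ u, 0 < u → HasDerivAt q₁ (q₂ u) u
  continuousOn_two : ContinuousOn q₂ (Set.Ioi 0)
  slope_bound : ∀ u, 1 ≤ u → |q u - g| ≤ C / u ^ 2
  curvature_lower : ∀ u, 1 ≤ u → c / u ^ 3 ≤ -q₁ u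
  curvature_upper : ∀ u, 1 ≤ u → -q₁ u ≤ C / u ^ 3
  third_bound : ∀ u, 1 ≤ u → |q₂ u| ≤ C / u ^ 4

theorem hasDerivAt_one_div_twelve_sq {u : ℝ} (hu : 0 < u) :
    HasDerivAt (fun u : ℝ => 1 / (12 * u ^ 2)) (-(1 / (6 * u ^ 3))) u := by
  have h := ((hasDerivAt_pow 2 u).const_mul 12).fun_inv (by positivity)
  simp only [one_div]
  refine h.congr_deriv ?_
  field_simp
  norm_num
  ring

theorem exists_isAlmostLinearPhase {L : ℝ → ℝ} {k : ℝ} (hk : 0 < k)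
    (hL : ∀ w, 0 < w → HasDerivAt L (k / sexticMoment 0 w (1 / 12)) w) :
    ∃ q q₁ q₂ : ℝ → ℝ, ∃ g c C : ℝ,
      IsAlmostLinearPhase (fun u => L (u ^ ((2 : ℝ) / 3))) q q₁ q₂ g c C := by
  set v : ℝ → ℝ := fun u => 1 / (12 * u ^ 2) with hv
  set m : ℕ → ℝ → ℝ := fun j u => sexticMoment j 1 (v u) with hm
  have hv0 : ∀ u, 0 < u → 0 < v u := fun u hu => by simp only [hv]; positivity
  have hv1 : ∀ u, 1 ≤ u → v u ≤ 1 / 12 := fun u hu => by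
    simp only [hv]
    gcongr
    nlinarith
  have hmd : ∀ j u, 0 < u → HasDerivAt (m j) (m (j + 3) u / (6 * u ^ 3)) u := fun j u hu => by
    have h1 := hasDerivAt_one_div_twelve_sq hu
    have h2 := hasDerivAt_sexticMoment_right j (p := 1) one_pos (hv0 u hu)
    refine (h2.comp u h1).congr_deriv ?_
    simp only [hm, hv]
    ring
  have hmpos : ∀ j u, 0 < u → 0 < m j u := fun j u hu => sexticMoment_pos j one_pos (hv0 u hu).le
  have hmlow : ∀ j u, 1 ≤ u → sexticMoment j 1 (1 / 12) ≤ m j u := fun j u hu =>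
    sexticMoment_antitone_right j one_pos (hv0 u (by linarith)).le (hv1 u hu)
  have hmup : ∀ j u, 0 < u → m j u ≤ sexticMoment j 1 0 := fun j u hu =>
    sexticMoment_antitone_right j one_pos le_rfl (hv0 u hu).le
  set G : ℝ := 2 / 3 * k with hG
  have hGp : 0 < G := by positivity
  obtain ⟨a0, ha0, ha0'⟩ : ∃ a, 0 < a ∧ ∀ u, 1 ≤ u → a ≤ m 0 u :=
    ⟨_, sexticMoment_pos 0 one_pos (by norm_num), fun u hu => hmlow 0 u hu⟩
  obtain ⟨a3, ha3, ha3'⟩ : ∃ a, 0 < a ∧ ∀ u, 1 ≤ u → a ≤ m 3 u :=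
    ⟨_, sexticMoment_pos 3 one_pos (by norm_num), fun u hu => hmlow 3 u hu⟩
  obtain ⟨b0, hb0, hb0p⟩ : ∃ b, b = sexticMoment 0 1 0 ∧ 0 < b :=
    ⟨_, rfl, sexticMoment_pos 0 one_pos le_rfl⟩
  obtain ⟨b3, hb3, hb3p⟩ : ∃ b, b = sexticMoment 3 1 0 ∧ 0 < b :=
    ⟨_, rfl, sexticMoment_pos 3 one_pos le_rfl⟩
  obtain ⟨b6, hb6, hb6p⟩ : ∃ b, b = sexticMoment 6 1 0 ∧ 0 < b :=
    ⟨_, rfl, sexticMoment_pos 6 one_pos le_rfl⟩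
  have hdiff : ∀ u, 1 ≤ u → b0 - m 0 u ≤ v u * b3 := fun u hu => by
    rw [hb0, hb3]; exact sexticMoment_zero_sub_le one_pos (hv0 u (by linarith)).le
  set q₂ : ℝ → ℝ := fun u => -(G / 6) * (-3 / u ^ 4 * (m 3 u / m 0 u ^ 2)
    + 1 / u ^ 3 * ((m 6 u / m 0 u ^ 2 - 2 * m 3 u ^ 2 / m 0 u ^ 3) / (6 * u ^ 3))) with hq₂
  set C1 : ℝ := G * b3 / (12 * a0 ^ 2) with hC1
  set C2 : ℝ := G * b3 / (6 * a0 ^ 2) with hC2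
  set C3 : ℝ := G / 6 * (3 * (b3 / a0 ^ 2) + (b6 / a0 ^ 2 + 2 * b3 ^ 2 / a0 ^ 3) / 6) with hC3
  have C1p : 0 < C1 := by positivity
  have C2p : 0 < C2 := by positivity
  have C3p : 0 < C3 := by positivity
  refine ⟨fun u => G / m 0 u, fun u => -(G / 6) * (1 / u ^ 3 * (m 3 u / m 0 u ^ 2)), q₂,
    G / b0, G * a3 / (6 * b0 ^ 2), C1 + C2 + C3, by positivity, by positivity,
    by positivity, fun u hu => ?_, fun u hu => ?_, fun u hu => ?_, fun u hu => ?_,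
    fun u hu => ?_, fun u hu => ?_, fun u hu => ?_, fun u hu => ?_⟩
  · have h1 := hL (u ^ ((2 : ℝ) / 3)) (Real.rpow_pos_of_pos hu _)
    have h2 := Real.hasDerivAt_rpow_const (x := u) (p := (2 : ℝ) / 3) (Or.inl hu.ne')
    refine (h1.comp u h2).congr_deriv ?_
    rw [sexticMoment_scaling hu, show ((2 : ℝ) / 3 - 1) = -(1 : ℝ) / 3 by norm_num]
    have hr : 0 < u ^ (-(1 : ℝ) / 3) := Real.rpow_pos_of_pos hu _
    have hm0 := hmpos 0 u hu
    simp only [hm, hv] at hm0 ⊢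
    field_simp
    rw [hG]; ring
  · have hm0 := hmpos 0 u hu
    refine ((hmd 0 u hu).fun_inv hm0.ne' |>.const_mul G).congr_deriv ?_ |>.congr_of_eventuallyEq ?_
    · ring
    · exact Eventually.of_forall fun u => by simp only [div_eq_mul_inv]
  · have hm0 := hmpos 0 u hu
    have hp3 : HasDerivAt (fun u : ℝ => 1 / u ^ 3) (-3 / u ^ 4) u := by
      have := (hasDerivAt_pow 3 u).fun_inv (by positivity)
      simp only [one_div]
      refine this.congr_deriv ?_
      field_simp
      norm_num
      ring
    have hq := (hmd 3 u hu).fun_div ((hmd 0 u hu).fun_pow 2) (by positivity)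
    refine ((hp3.fun_mul hq).const_mul (-(G / 6))).congr_deriv ?_
    simp only [hq₂]
    congr 2
    congr 1
    norm_num
    field_simp
  · have hu' : (0 : ℝ) < u := hu
    have hm0 := hmpos 0 u hu
    refine ContinuousAt.continuousWithinAt ?_
    have c0 := (hmd 0 u hu).continuousAt
    have c3 := (hmd 3 u hu).continuousAt
    have c6 := (hmd 6 u hu).continuousAt
    simp only [hq₂]
    have e0 : m 0 u ^ 2 ≠ 0 := by positivity
    have e1 : m 0 u ^ 3 ≠ 0 := by positivity
    have e2 : u ^ 3 ≠ 0 := by positivity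
    have e3 : u ^ 4 ≠ 0 := by positivity
    have e4 : 6 * u ^ 3 ≠ 0 := by positivity
    fun_prop (disch := assumption)
  · have hu0 : 0 < u := by linarith
    have hm0 := hmpos 0 u hu0
    have h1 : m 0 u ≤ b0 := hb0 ▸ hmup 0 u hu0
    have h2 := hdiff u hu
    have h3 := ha0' u hu
    have e : G / m 0 u - G / b0 = G * (b0 - m 0 u) / (m 0 u * b0) := by field_simp
    rw [e, abs_of_nonneg (by have : 0 ≤ b0 - m 0 u := by linarith
                             positivity)]
    calc G * (b0 - m 0 u) / (m 0 u * b0) ≤ G * (v u * b3) / (a0 * a0) := by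
          have : 0 ≤ v u := (hv0 u hu0).le
          gcongr
          linarith
      _ = C1 / u ^ 2 := by simp only [hv, hC1]; field_simp
      _ ≤ _ := by gcongr; linarith
  · have hu0 : 0 < u := by linarith
    have hm0 := hmpos 0 u hu0
    have h1 : m 0 u ≤ b0 := hb0 ▸ hmup 0 u hu0
    have h3 := ha3' u hu
    have hm3 := (hmpos 3 u hu0).le
    calc G * a3 / (6 * b0 ^ 2) / u ^ 3 = G / 6 * (1 / u ^ 3 * (a3 / b0 ^ 2)) := by field_simp
      _ ≤ G / 6 * (1 / u ^ 3 * (m 3 u / m 0 u ^ 2)) := by gcongr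
      _ = _ := by ring
  · have hu0 : 0 < u := by linarith
    have h1 : m 3 u ≤ b3 := hb3 ▸ hmup 3 u hu0
    have h3 := ha0' u hu
    calc -(-(G / 6) * (1 / u ^ 3 * (m 3 u / m 0 u ^ 2)))
        = G / 6 * (1 / u ^ 3 * (m 3 u / m 0 u ^ 2)) := by ring
      _ ≤ G / 6 * (1 / u ^ 3 * (b3 / a0 ^ 2)) := by gcongr
      _ = C2 / u ^ 3 := by simp only [hC2]; field_simp
      _ ≤ _ := by gcongr; linarith
  · have hu0 : 0 < u := by linarith
    have h0 := ha0' u hu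
    have h1 : m 3 u ≤ b3 := hb3 ▸ hmup 3 u hu0
    have h2 : m 6 u ≤ b6 := hb6 ▸ hmup 6 u hu0
    have m3 := hmpos 3 u hu0
    have m6 := hmpos 6 u hu0
    have m0 := hmpos 0 u hu0
    have p1 : m 3 u / m 0 u ^ 2 ≤ b3 / a0 ^ 2 := by gcongr
    have p2 : m 6 u / m 0 u ^ 2 ≤ b6 / a0 ^ 2 := by gcongr
    have p3 : 2 * m 3 u ^ 2 / m 0 u ^ 3 ≤ 2 * b3 ^ 2 / a0 ^ 3 := by gcongr
    have p4 : |m 6 u / m 0 u ^ 2 - 2 * m 3 u ^ 2 / m 0 u ^ 3|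
        ≤ b6 / a0 ^ 2 + 2 * b3 ^ 2 / a0 ^ 3 := by
      have : 0 < m 6 u / m 0 u ^ 2 := by positivity
      have : 0 < 2 * m 3 u ^ 2 / m 0 u ^ 3 := by positivity
      rw [abs_le]; constructor <;> linarith
    have p5 : 1 / u ^ 3 * (1 / u ^ 3) ≤ 1 / u ^ 4 := by
      rw [div_mul_div_comm, one_mul, ← pow_add]
      exact one_div_le_one_div_of_le (by positivity) (pow_le_pow_right₀ hu (by norm_num))
    calc |q₂ u| ≤ G / 6 * (|(-3 / u ^ 4 * (m 3 u / m 0 u ^ 2))|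
        + |1 / u ^ 3 * ((m 6 u / m 0 u ^ 2 - 2 * m 3 u ^ 2 / m 0 u ^ 3) / (6 * u ^ 3))|) := by
          simp only [hq₂]
          rw [abs_mul, abs_neg, abs_of_pos (by positivity : 0 < G / 6)]
          gcongr
          exact abs_add_le _ _
      _ = G / 6 * (3 / u ^ 4 * (m 3 u / m 0 u ^ 2) + (1 / u ^ 3 * (1 / u ^ 3))
          * (|m 6 u / m 0 u ^ 2 - 2 * m 3 u ^ 2 / m 0 u ^ 3| / 6)) := by
          rw [abs_mul, abs_mul, abs_of_pos (by positivity : 0 < m 3 u / m 0 u ^ 2), abs_div,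
            abs_div (m 6 u / m 0 u ^ 2 - 2 * m 3 u ^ 2 / m 0 u ^ 3),
                abs_of_pos (by positivity : 0 < 1 / u ^ 3),
                abs_of_pos (by positivity : 0 < u ^ 4),
            abs_of_pos (by positivity : 0 < 6 * u ^ 3)]
          rw [show |(-3 : ℝ)| = 3 by norm_num]
          generalize |m 6 u / m 0 u ^ 2 - 2 * m 3 u ^ 2 / m 0 u ^ 3| = z
          field_simp
      _ ≤ G / 6 * (3 / u ^ 4 * (b3 / a0 ^ 2) + 1 / u ^ 4
          * ((b6 / a0 ^ 2 + 2 * b3 ^ 2 / a0 ^ 3) / 6)) := by gcongr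
      _ = C3 / u ^ 4 := by simp only [hC3]; field_simp
      _ ≤ _ := by gcongr; linarith

theorem integral_one_div_one_add_mul_sq_le {f f' : ℝ → ℝ} {a b k m : ℝ} (hab : a ≤ b)
    (hk : 0 < k) (hm : 0 < m) (hf : ∀ x ∈ Set.Icc a b, HasDerivAt f (f' x) x)
    (hf' : ContinuousOn f' (Set.Icc a b))
    (h : (∀ x ∈ Set.Icc a b, m ≤ f' x) ∨ ∀ x ∈ Set.Icc a b, f' x ≤ -m) :
    ∫ x in a..b, 1 / (1 + k * f x ^ 2) ≤ π / (m * √k) := by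
  wlog hpos : ∀ x ∈ Set.Icc a b, m ≤ f' x generalizing f f'
  · have hneg := h.resolve_left hpos
    simpa using this (f := fun x => -f x) (f' := fun x => -f' x) (fun x hx => (hf x hx).fun_neg)
      hf'.fun_neg (Or.inl fun x hx => le_neg.1 (hneg x hx)) (fun x hx => le_neg.1 (hneg x hx))
  have hfc : ContinuousOn f (Set.Icc a b) := fun x hx => (hf x hx).continuousAt.continuousWithinAt
  have hden : ∀ x, (0 : ℝ) < 1 + k * f x ^ 2 := fun x => by positivity
  have hc1 : ContinuousOn (fun x => 1 / (1 + k * f x ^ 2)) (Set.Icc a b) := by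
    have : ∀ x ∈ Set.Icc a b, 1 + k * f x ^ 2 ≠ 0 := fun x _ => (hden x).ne'
    fun_prop (disch := assumption)
  have hsk : 0 < √k := Real.sqrt_pos.2 hk
  have hd : ∀ x ∈ Set.uIcc a b, HasDerivAt (fun x => Real.arctan (√k * f x))
      (√k * f' x * (1 / (1 + k * f x ^ 2))) x := fun x hx => by
    rw [Set.uIcc_of_le hab] at hx
    refine (((hf x hx).const_mul (√k)).arctan).congr_deriv ?_
    rw [mul_pow, Real.sq_sqrt hk.le]
    ring
  have hc2 : ContinuousOn (fun x => √k * f' x * (1 / (1 + k * f x ^ 2))) (Set.uIcc a b) := by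
    rw [Set.uIcc_of_le hab]
    exact (continuousOn_const.mul hf').mul hc1
  have hftc := intervalIntegral.integral_eq_sub_of_hasDerivAt hd hc2.intervalIntegrable
  have hle : m * √k * ∫ x in a..b, 1 / (1 + k * f x ^ 2)
      ≤ ∫ x in a..b, √k * f' x * (1 / (1 + k * f x ^ 2)) := by
    rw [← intervalIntegral.integral_const_mul]
    refine intervalIntegral.integral_mono_on hab
      ((hc1.intervalIntegrable_of_Icc hab).const_mul _) hc2.intervalIntegrable fun x hx => ?_
    have := hpos x hx
    have := (hden x).le
    rw [mul_comm m]
    gcongr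
  rw [le_div_iff₀ (by positivity), mul_comm]
  have h1 := Real.arctan_lt_pi_div_two (√k * f b)
  have h2 := Real.neg_pi_div_two_lt_arctan (√k * f a)
  linarith

/-- Integration by parts against an oscillating exponential, without boundary terms. -/
theorem integral_exp_mul_deriv_eq {θ p u u' : ℝ → ℝ} {a b : ℝ} (hab : a ≤ b)
    (hθ : ∀ x ∈ Set.Icc a b, HasDerivAt θ (p x) x) (hp : ContinuousOn p (Set.Icc a b))
    (hu : ∀ x ∈ Set.Icc a b, HasDerivAt u (u' x) x) (hu' : ContinuousOn u' (Set.Icc a b))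
    (ha : u a = 0) (hb : u b = 0) :
    ∫ x in a..b, Complex.exp (Complex.I * θ x) * u' x
      = -Complex.I * ∫ x in a..b, Complex.exp (Complex.I * θ x) * (p x * u x : ℝ) := by
  have hθc : ContinuousOn θ (Set.Icc a b) := fun x hx => (hθ x hx).continuousAt.continuousWithinAt
  have huc : ContinuousOn u (Set.Icc a b) := fun x hx => (hu x hx).continuousAt.continuousWithinAt
  have hd : ∀ x ∈ Set.uIcc a b, HasDerivAt (fun x : ℝ => Complex.exp (Complex.I * θ x) * u x)
      (Complex.exp (Complex.I * θ x) * u' x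
        + Complex.I * (Complex.exp (Complex.I * θ x) * (p x * u x : ℝ))) x := fun x hx => by
    rw [Set.uIcc_of_le hab] at hx
    refine ((((hθ x hx).ofReal_comp.const_mul Complex.I).cexp).mul
      (hu x hx).ofReal_comp).congr_deriv ?_
    push_cast; ring
  have i1 : IntervalIntegrable (fun x => Complex.exp (Complex.I * θ x) * u' x) volume a b := by
    refine ContinuousOn.intervalIntegrable_of_Icc hab ?_
    fun_prop
  have i2 : IntervalIntegrable (fun x => Complex.exp (Complex.I * θ x) * (p x * u x : ℝ))
      volume a b := by
    refine ContinuousOn.intervalIntegrable_of_Icc hab ?_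
    fun_prop
  have h := intervalIntegral.integral_eq_sub_of_hasDerivAt hd (i1.add (i2.const_mul _))
  rw [intervalIntegral.integral_add i1 (i2.const_mul _), intervalIntegral.integral_const_mul,
    ha, hb] at h
  simp only [Complex.ofReal_zero, mul_zero, sub_zero] at h
  linear_combination h

theorem norm_integral_exp_mul_le {θ u v : ℝ → ℝ} {a b : ℝ} (hab : a ≤ b)
    (hv : ContinuousOn v (Set.Icc a b)) (h : ∀ x ∈ Set.Icc a b, |u x| ≤ v x) :
    ‖∫ x in a..b, Complex.exp (Complex.I * θ x) * u x‖ ≤ ∫ x in a..b, v x := by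
  refine intervalIntegral.norm_integral_le_of_norm_le hab (ae_of_all _ fun x hx => ?_)
    (hv.intervalIntegrable_of_Icc hab)
  rw [norm_mul, mul_comm Complex.I, Complex.norm_exp_ofReal_mul_I, one_mul, Complex.norm_real]
  exact h x ⟨hx.1.le, hx.2⟩

/-- Van der Corput type bound: if the second derivative of the phase is comparable to `μ⁻¹`, the
oscillatory integral is `O(√μ)`. -/
theorem norm_integral_exp_le_sqrt {θ p p₁ ζ ζ₁ : ℝ → ℝ} {a b μ c C Z : ℝ} (hab : a ≤ b)
    (hμ : 0 < μ) (hc : 0 < c) (hC : 0 ≤ C) (hZ : 0 ≤ Z)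
    (hθ : ∀ x ∈ Set.Icc a b, HasDerivAt θ (p x) x)
    (hp : ∀ x ∈ Set.Icc a b, HasDerivAt p (p₁ x) x) (hp₁ : ContinuousOn p₁ (Set.Icc a b))
    (hζ : ∀ x ∈ Set.Icc a b, HasDerivAt ζ (ζ₁ x) x) (hζ₁ : ContinuousOn ζ₁ (Set.Icc a b))
    (ha : ζ a = 0) (hb : ζ b = 0) (hZ0 : ∀ x ∈ Set.Icc a b, |ζ x| ≤ Z)
    (hZ1 : ∀ x ∈ Set.Icc a b, |ζ₁ x| ≤ Z)
    (hlow : (∀ x ∈ Set.Icc a b, c / μ ≤ p₁ x) ∨ ∀ x ∈ Set.Icc a b, p₁ x ≤ -(c / μ))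
    (hup : ∀ x ∈ Set.Icc a b, |p₁ x| ≤ C / μ) :
    ‖∫ x in a..b, Complex.exp (Complex.I * θ x) * ζ x‖
      ≤ Z * ((1 + 3 * C) * π / c + (b - a)) * √μ := by
  have hpc : ContinuousOn p (Set.Icc a b) := fun x hx => (hp x hx).continuousAt.continuousWithinAt
  have hθc : ContinuousOn θ (Set.Icc a b) := fun x hx => (hθ x hx).continuousAt.continuousWithinAt
  have hζc : ContinuousOn ζ (Set.Icc a b) := fun x hx => (hζ x hx).continuousAt.continuousWithinAt
  set D : ℝ → ℝ := fun x => 1 + μ * p x ^ 2 with hD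
  have hDpos : ∀ x, 0 < D x := fun x => by simp only [hD]; positivity
  have hDd : ∀ x ∈ Set.Icc a b, HasDerivAt D (2 * μ * p x * p₁ x) x := fun x hx => by
    refine ((((hp x hx).fun_pow 2).const_mul μ).const_add 1).congr_deriv ?_
    norm_num; ring
  have hDc : ContinuousOn D (Set.Icc a b) := fun x hx => (hDd x hx).continuousAt.continuousWithinAt
  have hDne : ∀ x ∈ Set.Icc a b, D x ≠ 0 := fun x _ => (hDpos x).ne'
  have hDne2 : ∀ x ∈ Set.Icc a b, D x ^ 2 ≠ 0 := fun x _ => (pow_pos (hDpos x) 2).ne'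
  set u' : ℝ → ℝ := fun x => ((p₁ x * ζ x + p x * ζ₁ x) * D x
    - p x * ζ x * (2 * μ * p x * p₁ x)) / D x ^ 2 with hu'
  have hu'c : ContinuousOn u' (Set.Icc a b) := by
    simp only [hu']
    fun_prop (disch := assumption)
  have hibp := integral_exp_mul_deriv_eq (u := fun x => p x * ζ x / D x) (u' := u') hab hθ hpc
    (fun x hx => ((hp x hx).fun_mul (hζ x hx)).fun_div (hDd x hx) (hDne x hx)) hu'c
    (by simp [ha]) (by simp [hb])
  have hcint : ∀ {w : ℝ → ℝ}, ContinuousOn w (Set.Icc a b) →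
      IntervalIntegrable (fun x => Complex.exp (Complex.I * θ x) * w x) volume a b := fun hw => by
    refine ContinuousOn.intervalIntegrable_of_Icc hab ?_
    fun_prop
  have c1 : ContinuousOn (fun x => ζ x / D x) (Set.Icc a b) := by fun_prop (disch := assumption)
  have c2 : ContinuousOn (fun x => p x * (p x * ζ x / D x)) (Set.Icc a b) := by
    fun_prop (disch := assumption)
  have hsplit : ∫ x in a..b, Complex.exp (Complex.I * θ x) * ζ x
      = (∫ x in a..b, Complex.exp (Complex.I * θ x) * (ζ x / D x : ℝ))
        + μ * Complex.I * ∫ x in a..b, Complex.exp (Complex.I * θ x) * u' x := by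
    rw [hibp, show (μ : ℂ) * Complex.I * (-Complex.I * _)
      = μ * ∫ x in a..b, Complex.exp (Complex.I * θ x) * ((p x * (p x * ζ x / D x) : ℝ) : ℂ) by
        linear_combination (-μ * ∫ x in a..b, Complex.exp (Complex.I * θ x) *
          ((p x * (p x * ζ x / D x) : ℝ) : ℂ)) * Complex.I_mul_I,
      ← intervalIntegral.integral_const_mul, ← intervalIntegral.integral_add (hcint c1)
        ((hcint c2).const_mul _)]
    refine intervalIntegral.integral_congr fun x hx => ?_
    have : ζ x = ζ x / D x + μ * (p x * (p x * ζ x / D x)) := by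
      have := (hDpos x).ne'
      field_simp
      simp only [hD]
    have hc := congrArg Complex.ofReal this
    push_cast at hc ⊢
    linear_combination Complex.exp (Complex.I * θ x) * hc
  have cD : ContinuousOn (fun x => 1 / D x) (Set.Icc a b) := by fun_prop (disch := assumption)
  have hA := integral_one_div_one_add_mul_sq_le hab hμ (by positivity : 0 < c / μ) hp hp₁ hlow
  have hA' : ∫ x in a..b, 1 / D x ≤ π / c * √μ := by
    refine hA.trans_eq ?_
    rw [div_eq_iff (by positivity)]
    field_simp
    rw [Real.sq_sqrt hμ.le]
  have hsμ : 0 < √μ := Real.sqrt_pos.2 hμ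
  have hsq : √μ ^ 2 = μ := Real.sq_sqrt hμ.le
  have h1 : ‖∫ x in a..b, Complex.exp (Complex.I * θ x) * (ζ x / D x : ℝ)‖
      ≤ ∫ x in a..b, Z * (1 / D x) := by
    refine norm_integral_exp_mul_le hab (continuousOn_const.mul cD) fun x hx => ?_
    rw [abs_div, abs_of_pos (hDpos x), mul_one_div]
    have := hZ0 x hx
    have := hDpos x
    gcongr
  have h2 : ‖∫ x in a..b, Complex.exp (Complex.I * θ x) * u' x‖
      ≤ ∫ x in a..b, (3 * C * Z / μ * (1 / D x) + Z / √μ) := by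
    refine norm_integral_exp_mul_le hab ((continuousOn_const.mul cD).add continuousOn_const)
      fun x hx => ?_
    have hd := hDpos x
    have e : u' x = (p₁ x / D x) * ζ x + ζ₁ x * (p x / D x)
        - 2 * (ζ x * p₁ x / D x) * (μ * p x ^ 2 / D x) := by
      simp only [hu']; field_simp
    have b1 : |μ * p x ^ 2 / D x| ≤ 1 := by
      rw [abs_of_nonneg (by positivity), div_le_one hd]; simp only [hD]; linarith
    have b2 : |p x / D x| ≤ 1 / √μ := by
      rw [abs_div, abs_of_pos hd, div_le_div_iff₀ hd hsμ, one_mul]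
      have : D x = 1 + (|p x| * √μ) ^ 2 := by rw [mul_pow, sq_abs, hsq]; simp only [hD]; ring
      rw [this]
      nlinarith [sq_nonneg (|p x| * √μ - 1)]
    have b3 : |p₁ x / D x| ≤ C / μ * (1 / D x) := by
      rw [abs_div, abs_of_pos hd, ← mul_one_div]
      have := hup x hx
      gcongr
    have b0 := hZ0 x hx
    have b0' := hZ1 x hx
    have b4 : |ζ x * p₁ x / D x| ≤ Z * (C / μ * (1 / D x)) := by
      rw [mul_div_assoc, abs_mul]; gcongr
    calc |u' x| ≤ |p₁ x / D x| * |ζ x| + |ζ₁ x| * |p x / D x|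
          + 2 * |ζ x * p₁ x / D x| * |μ * p x ^ 2 / D x| := by
          rw [e]
          refine (abs_sub _ _).trans (add_le_add ((abs_add_le _ _).trans ?_) ?_)
          · rw [abs_mul, abs_mul]
          · rw [abs_mul, abs_mul, abs_two]
      _ ≤ (C / μ * (1 / D x)) * Z + Z * (1 / √μ) + 2 * (Z * (C / μ * (1 / D x))) * 1 := by gcongr
      _ = _ := by ring
  rw [hsplit]
  have i1 : IntervalIntegrable (fun x => 1 / D x) volume a b := cD.intervalIntegrable_of_Icc hab
  rw [intervalIntegral.integral_const_mul] at h1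
  rw [intervalIntegral.integral_add (i1.const_mul _) (by simp),
    intervalIntegral.integral_const_mul, intervalIntegral.integral_const, smul_eq_mul] at h2
  calc _ ≤ ‖∫ x in a..b, Complex.exp (Complex.I * θ x) * (ζ x / D x : ℝ)‖
        + μ * ‖∫ x in a..b, Complex.exp (Complex.I * θ x) * u' x‖ := by
        refine (norm_add_le _ _).trans (add_le_add le_rfl (le_of_eq ?_))
        rw [norm_mul, norm_mul, Complex.norm_I, mul_one, Complex.norm_real, norm_of_nonneg hμ.le]
    _ ≤ Z * (π / c * √μ) + μ * (3 * C * Z / μ * (π / c * √μ) + (b - a) * (Z / √μ)) := by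
        refine add_le_add (h1.trans ?_) (mul_le_mul_of_nonneg_left (h2.trans ?_) hμ.le)
        · gcongr
        · gcongr
    _ = _ := by
        field_simp
        rw [hsq]; ring

/-- Non-stationary phase with two integrations by parts. -/
theorem norm_integral_exp_le_of_le_abs_deriv {θ p p₁ p₂ ζ ζ₁ ζ₂ : ℝ → ℝ} {a b R C Z : ℝ}
    (hab : a ≤ b) (hR : 0 < R) (hC : 0 ≤ C) (hZ : 0 ≤ Z)
    (hθ : ∀ x ∈ Set.Icc a b, HasDerivAt θ (p x) x)
    (hp : ∀ x ∈ Set.Icc a b, HasDerivAt p (p₁ x) x)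
    (hp₁ : ∀ x ∈ Set.Icc a b, HasDerivAt p₁ (p₂ x) x) (hp₂ : ContinuousOn p₂ (Set.Icc a b))
    (hζ : ∀ x ∈ Set.Icc a b, HasDerivAt ζ (ζ₁ x) x)
    (hζ₁ : ∀ x ∈ Set.Icc a b, HasDerivAt ζ₁ (ζ₂ x) x) (hζ₂ : ContinuousOn ζ₂ (Set.Icc a b))
    (ha : ζ a = 0) (hb : ζ b = 0) (ha1 : ζ₁ a = 0) (hb1 : ζ₁ b = 0)
    (hZ0 : ∀ x ∈ Set.Icc a b, |ζ x| ≤ Z) (hZ1 : ∀ x ∈ Set.Icc a b, |ζ₁ x| ≤ Z)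
    (hZ2 : ∀ x ∈ Set.Icc a b, |ζ₂ x| ≤ Z) (hlow : ∀ x ∈ Set.Icc a b, R ≤ |p x|)
    (hup1 : ∀ x ∈ Set.Icc a b, |p₁ x| ≤ C * R) (hup2 : ∀ x ∈ Set.Icc a b, |p₂ x| ≤ C * R) :
    ‖∫ x in a..b, Complex.exp (Complex.I * θ x) * ζ x‖
      ≤ (b - a) * (Z * (1 + 4 * C + 3 * C ^ 2)) / R ^ 2 := by
  have hpne : ∀ x ∈ Set.Icc a b, p x ≠ 0 := fun x hx h0 => by
    have := hlow x hx; rw [h0, abs_zero] at this; linarith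
  have hpc : ContinuousOn p (Set.Icc a b) := fun x hx => (hp x hx).continuousAt.continuousWithinAt
  have hp1c : ContinuousOn p₁ (Set.Icc a b) := fun x hx =>
    (hp₁ x hx).continuousAt.continuousWithinAt
  have hζc : ContinuousOn ζ (Set.Icc a b) := fun x hx => (hζ x hx).continuousAt.continuousWithinAt
  have hζ1c : ContinuousOn ζ₁ (Set.Icc a b) := fun x hx =>
    (hζ₁ x hx).continuousAt.continuousWithinAt
  have hp2ne : ∀ x ∈ Set.Icc a b, p x ^ 2 ≠ 0 := fun x hx => pow_ne_zero 2 (hpne x hx)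
  have hp3ne : ∀ x ∈ Set.Icc a b, p x ^ 3 ≠ 0 := fun x hx => pow_ne_zero 3 (hpne x hx)
  have hp4ne : ∀ x ∈ Set.Icc a b, p x ^ 4 ≠ 0 := fun x hx => pow_ne_zero 4 (hpne x hx)
  set w : ℝ → ℝ := fun x => ζ₁ x / p x - ζ x * p₁ x / p x ^ 2 with hw
  set z : ℝ → ℝ := fun x => ζ₂ x / p x ^ 2 - 3 * (ζ₁ x * p₁ x / p x ^ 3) - ζ x * p₂ x / p x ^ 3
    + 3 * (ζ x * p₁ x ^ 2 / p x ^ 4) with hz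
  have hwc : ContinuousOn w (Set.Icc a b) := by simp only [hw]; fun_prop (disch := assumption)
  have hzc : ContinuousOn z (Set.Icc a b) := by simp only [hz]; fun_prop (disch := assumption)
  have i1 := integral_exp_mul_deriv_eq (u := fun x => ζ x / p x) (u' := w) hab hθ hpc
    (fun x hx => ((hζ x hx).fun_div (hp x hx) (hpne x hx)).congr_deriv (by
      have := hpne x hx
      simp only [hw]; field_simp)) hwc (by simp [ha]) (by simp [hb])
  have i2 := integral_exp_mul_deriv_eq (u := fun x => ζ₁ x / p x ^ 2 - ζ x * p₁ x / p x ^ 3)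
    (u' := z) hab hθ hpc
    (fun x hx => (((hζ₁ x hx).fun_div ((hp x hx).fun_pow 2) (hp2ne x hx)).fun_sub
      (((hζ x hx).fun_mul (hp₁ x hx)).fun_div ((hp x hx).fun_pow 3) (hp3ne x hx))).congr_deriv (by
      have := hpne x hx
      simp only [hz]; norm_num; field_simp; ring)) hzc (by simp [ha, ha1]) (by simp [hb, hb1])
  have e1 : ∫ x in a..b, Complex.exp (Complex.I * θ x) * (p x * (ζ x / p x) : ℝ)
      = ∫ x in a..b, Complex.exp (Complex.I * θ x) * ζ x := by
    refine intervalIntegral.integral_congr fun x hx => ?_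
    rw [Set.uIcc_of_le hab] at hx
    simp only [mul_div_cancel₀ _ (hpne x hx)]
  have e2 : ∫ x in a..b, Complex.exp (Complex.I * θ x)
        * (p x * (ζ₁ x / p x ^ 2 - ζ x * p₁ x / p x ^ 3) : ℝ)
      = ∫ x in a..b, Complex.exp (Complex.I * θ x) * w x := by
    refine intervalIntegral.integral_congr fun x hx => ?_
    rw [Set.uIcc_of_le hab] at hx
    have : p x * (ζ₁ x / p x ^ 2 - ζ x * p₁ x / p x ^ 3) = w x := by
      have := hpne x hx
      simp only [hw]; field_simp
    simp only [this]
  rw [e1] at i1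
  rw [e2] at i2
  have n1 : ‖∫ x in a..b, Complex.exp (Complex.I * θ x) * ζ x‖
      = ‖∫ x in a..b, Complex.exp (Complex.I * θ x) * z x‖ := by
    rw [i2, norm_mul, norm_neg, Complex.norm_I, one_mul, i1, norm_mul, norm_neg, Complex.norm_I,
      one_mul]
  rw [n1]
  refine (norm_integral_exp_mul_le (v := fun _ => Z * (1 + 4 * C + 3 * C ^ 2) / R ^ 2) hab
    continuousOn_const fun x hx => ?_).trans_eq ?_
  · have hP := hlow x hx
    have hPp : 0 < |p x| := hR.trans_le hP
    have z0 := hZ0 x hx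
    have z1 := hZ1 x hx
    have z2 := hZ2 x hx
    have q1 := hup1 x hx
    have q2 := hup2 x hx
    have b1 : |ζ₂ x / p x ^ 2| ≤ Z / R ^ 2 := by rw [abs_div, abs_pow]; gcongr
    have b2 : |ζ₁ x * p₁ x / p x ^ 3| ≤ Z * (C * R) / R ^ 3 := by
      rw [abs_div, abs_pow, abs_mul]; gcongr
    have b3 : |ζ x * p₂ x / p x ^ 3| ≤ Z * (C * R) / R ^ 3 := by
      rw [abs_div, abs_pow, abs_mul]; gcongr
    have b4 : |ζ x * p₁ x ^ 2 / p x ^ 4| ≤ Z * (C * R) ^ 2 / R ^ 4 := by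
      rw [abs_div, abs_pow, abs_mul, abs_pow]; gcongr
    have e : Z * (1 + 4 * C + 3 * C ^ 2) / R ^ 2 = Z / R ^ 2 + 3 * (Z * (C * R) / R ^ 3)
        + Z * (C * R) / R ^ 3 + 3 * (Z * (C * R) ^ 2 / R ^ 4) := by field_simp; ring
    rw [e]
    simp only [hz]
    rw [abs_le] at *
    constructor <;> linarith [b1.1, b1.2, b2.1, b2.2, b3.1, b3.2, b4.1, b4.2]
  · simp only [intervalIntegral.integral_const, smul_eq_mul]; ring

theorem sum_one_div_one_add_sq_le {g : ℝ} (hg : 0 < g) (s : Finset ℤ) (F : ℝ) {M : ℝ}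
    (hM : 1 ≤ M) :
    ∑ N ∈ s, 1 / (1 + ((F - N * g) / M) ^ 2) ≤ (2 + 2 * g ^ 2) * π / g * M := by
  have hM0 : 0 < M := by linarith
  set φ : ℝ → ℝ := fun x => (1 + ((F - x * g) / M) ^ 2)⁻¹ with hφ
  have hφ0 : ∀ x, 0 ≤ φ x := fun x => by simp only [hφ]; positivity
  have haff : ∀ x, φ x = (fun y : ℝ => (1 + y ^ 2)⁻¹) ((-g / M) * x + F / M) := fun x => by
    simp only [hφ]; congr 3; ring
  have hne : -g / M ≠ 0 := div_ne_zero (neg_ne_zero.2 hg.ne') hM0.ne'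
  have hi : Integrable φ := by
    have h1 : Integrable fun y : ℝ => (1 + (y + F / M) ^ 2)⁻¹ :=
      integrable_inv_one_add_sq.comp_add_right (F / M)
    refine (h1.comp_mul_left' hne).congr (ae_of_all _ fun x => (haff x).symm)
  have htot : ∫ x, φ x = π * M / g := by
    have h1 := Measure.integral_comp_mul_left (fun y : ℝ => (1 + (y + F / M) ^ 2)⁻¹) (-g / M)
    have h2 : ∫ y : ℝ, (1 + (y + F / M) ^ 2)⁻¹ = π := by
      rw [integral_add_right_eq_self (fun y : ℝ => (1 + y ^ 2)⁻¹) (F / M),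
        integral_univ_inv_one_add_sq]
    rw [h2] at h1
    rw [show (fun x => φ x) = fun x => (1 + ((-g / M) * x + F / M) ^ 2)⁻¹ from funext haff, h1,
      smul_eq_mul, inv_div, abs_div, abs_neg, abs_of_pos hg, abs_of_pos hM0]
    ring
  have hterm : ∀ N : ℤ, 1 / (1 + ((F - N * g) / M) ^ 2)
      ≤ (2 + 2 * g ^ 2) * ∫ x in Set.Ioc (N : ℝ) (N + 1), φ x := fun N => by
    rw [← integral_const_mul]
    have hc : ∫ x in Set.Ioc (N : ℝ) (N + 1), 1 / (1 + ((F - N * g) / M) ^ 2)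
        = 1 / (1 + ((F - N * g) / M) ^ 2) := by simp
    rw [← hc]
    refine setIntegral_mono_on (by simp) (hi.const_mul _).integrableOn measurableSet_Ioc
      fun x hx => ?_
    simp only [hφ]
    rw [← div_eq_mul_inv, div_le_div_iff₀ (by positivity) (by positivity)]
    obtain ⟨y, hy, hy'⟩ : ∃ y, y = (F - N * g) / M ∧ (F - x * g) / M = y + (N - x) * g / M :=
      ⟨_, rfl, by ring⟩
    obtain ⟨r, hr⟩ : ∃ r, r = (N - x) * g / M := ⟨_, rfl⟩
    rw [hy', ← hy, ← hr]
    have hr2 : r ^ 2 ≤ g ^ 2 := by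
      rw [hr]
      refine sq_le_sq' ?_ ?_
      · rw [le_div_iff₀ hM0]; nlinarith [hx.1, hx.2]
      · rw [div_le_iff₀ hM0]; nlinarith [hx.1, hx.2]
    nlinarith [sq_nonneg (y - r), sq_nonneg (g * y)]
  calc _ ≤ ∑ N ∈ s, (2 + 2 * g ^ 2) * ∫ x in Set.Ioc (N : ℝ) (N + 1), φ x :=
        Finset.sum_le_sum fun N _ => hterm N
    _ = (2 + 2 * g ^ 2) * ∫ x in ⋃ N ∈ s, Set.Ioc (N : ℝ) (N + 1), φ x := by
        rw [← Finset.mul_sum, integral_biUnion_finset s (fun _ _ => measurableSet_Ioc)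
          (fun i _ j _ hij => Set.pairwise_disjoint_Ioc_intCast ℝ hij) (fun _ _ => hi.integrableOn)]
    _ ≤ (2 + 2 * g ^ 2) * ∫ x, φ x :=
        mul_le_mul_of_nonneg_left (setIntegral_le_integral hi (ae_of_all _ hφ0)) (by positivity)
    _ = _ := by rw [htot]; ring

/-- The one-dimensional oscillatory integral with phase `κ η F - N ℓ(κ η)`. -/
noncomputable def phaseIntegral (ℓ ζ : ℝ → ℝ) (κ F : ℝ) (N : ℤ) : ℂ :=
  ∫ η : ℝ, Complex.exp (Complex.I * ((κ * η * F - N * ℓ (κ * η) : ℝ) : ℂ)) * ζ η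

theorem phaseIntegral_eq_intervalIntegral {ζ : ℝ → ℝ}
    (hs : tsupport ζ ⊆ Set.Icc (1 / 2 : ℝ) (3 / 2)) (ℓ : ℝ → ℝ) (κ F : ℝ) (N : ℤ) :
    phaseIntegral ℓ ζ κ F N = ∫ η in (1 / 4 : ℝ)..2,
      Complex.exp (Complex.I * ((κ * η * F - N * ℓ (κ * η) : ℝ) : ℂ)) * ζ η := by
  rw [intervalIntegral.integral_of_le (by norm_num), phaseIntegral,
      setIntegral_eq_integral_of_forall_compl_eq_zero]
  intro x hx
  have : ζ x = 0 := by
    by_contra h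
    have := hs (subset_tsupport ζ h)
    exact hx ⟨by linarith [this.1], by linarith [this.2]⟩
  simp [this]

theorem exists_phaseIntegral_bounds {ℓ q q₁ q₂ : ℝ → ℝ} {g c C : ℝ}
    (hℓ : IsAlmostLinearPhase ℓ q q₁ q₂ g c C) {ζ : ℝ → ℝ} (hζ : ContDiff ℝ (⊤ : ℕ∞) ζ)
    (hs : tsupport ζ ⊆ Set.Icc (1 / 2 : ℝ) (3 / 2)) :
    ∃ B > 0, ∃ K ≥ 1, ∃ κ₀ ≥ 4, ∀ κ ≥ κ₀, ∀ (F : ℝ) (N : ℤ),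
      ‖phaseIntegral ℓ ζ κ F N‖ ≤ B ∧
      (N ≠ 0 → ‖phaseIntegral ℓ ζ κ F N‖ ≤ B * √(κ / |(N : ℝ)|)) ∧
      (K * (1 + |F| / κ ^ 2) ≤ |F - N * g| →
        ‖phaseIntegral ℓ ζ κ F N‖ ≤ B / (κ ^ 2 * (F - N * g) ^ 2)) := by
  obtain ⟨hg, hc, hC, hd0, hd1, hd2, hcont, hb0, hlow, hup, hb2⟩ := hℓ
  have hζ' : ContDiff ℝ (⊤ : ℕ∞) (deriv ζ) := (contDiff_infty_iff_deriv.1 hζ).2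
  have hζ'' : ContDiff ℝ (⊤ : ℕ∞) (deriv (deriv ζ)) := (contDiff_infty_iff_deriv.1 hζ').2
  have hζd : ∀ x, HasDerivAt ζ (deriv ζ x) x := fun x =>
    (hζ.differentiable (by simp) x).hasDerivAt
  have hζd' : ∀ x, HasDerivAt (deriv ζ) (deriv (deriv ζ) x) x := fun x =>
    (hζ'.differentiable (by simp) x).hasDerivAt
  have hout : ∀ x, x ∉ Set.Icc (1 / 2 : ℝ) (3 / 2) → ζ x = 0 ∧ deriv ζ x = 0 := fun x hx => by
    have hx' : x ∉ tsupport ζ := fun h => hx (hs h)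
    exact ⟨image_eq_zero_of_notMem_tsupport hx',
      image_eq_zero_of_notMem_tsupport fun h => hx' (tsupport_deriv_subset h)⟩
  have ha := hout (1 / 4) (by norm_num)
  have hb := hout 2 (by norm_num)
  obtain ⟨Z, hZp, hZ⟩ : ∃ Z > 0, ∀ x ∈ Set.Icc (1 / 4 : ℝ) 2, |ζ x| ≤ Z ∧ |deriv ζ x| ≤ Z ∧
      |deriv (deriv ζ) x| ≤ Z := by
    obtain ⟨z0, h0⟩ := isCompact_Icc.exists_bound_of_continuousOn (s := Set.Icc (1 / 4 : ℝ) 2)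
      hζ.continuous.continuousOn
    obtain ⟨z1, h1⟩ := isCompact_Icc.exists_bound_of_continuousOn (s := Set.Icc (1 / 4 : ℝ) 2)
      hζ'.continuous.continuousOn
    obtain ⟨z2, h2⟩ := isCompact_Icc.exists_bound_of_continuousOn (s := Set.Icc (1 / 4 : ℝ) 2)
      hζ''.continuous.continuousOn
    refine ⟨|z0| + |z1| + |z2| + 1, by positivity, fun x hx => ⟨?_, ?_, ?_⟩⟩
    · linarith [h0 x hx, Real.norm_eq_abs (ζ x), le_abs_self z0, abs_nonneg z1, abs_nonneg z2]
    · linarith [h1 x hx, Real.norm_eq_abs (deriv ζ x), le_abs_self z1, abs_nonneg z0,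
        abs_nonneg z2]
    · linarith [h2 x hx, Real.norm_eq_abs (deriv (deriv ζ) x), le_abs_self z2, abs_nonneg z0,
        abs_nonneg z1]
  set C' : ℝ := 1024 * C / g with hC'
  have hC'p : 0 < C' := by positivity
  set B1 : ℝ := Z * ((1 + 3 * (64 * C)) * π / (c / 8) + (2 - 1 / 4)) with hB1
  set B2 : ℝ := 7 * (Z * (1 + 4 * C' + 3 * C' ^ 2)) with hB2
  have hB1p : 0 < B1 := by
    have := Real.pi_pos
    have : (0 : ℝ) < 2 - 1 / 4 := by norm_num
    positivity
  have hB2p : 0 < B2 := by positivity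
  refine ⟨2 * Z + B1 + B2, by positivity, 1 + 64 * C / g, by
    have : 0 < 64 * C / g := by positivity
    linarith, 4 + 64 * C / g, by
    have : 0 < 64 * C / g := by positivity
    linarith, fun κ hκ F N => ?_⟩
  have hκ4 : 4 ≤ κ := by
    have : 0 < 64 * C / g := by positivity
    linarith
  have hκ0 : 0 < κ := by linarith
  have hκC : 64 * C / g ≤ κ ^ 2 := by
    have : κ ≤ κ ^ 2 := by nlinarith
    linarith
  have hu1 : ∀ x ∈ Set.Icc (1 / 4 : ℝ) 2, 1 ≤ κ * x := fun x hx => by nlinarith [hx.1]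
  have hu0 : ∀ x ∈ Set.Icc (1 / 4 : ℝ) 2, 0 < κ * x := fun x hx => by linarith [hu1 x hx]
  have hmul : ∀ x : ℝ, HasDerivAt (fun x : ℝ => κ * x) κ x := fun x => by
    simpa using (hasDerivAt_id x).const_mul κ
  set θ : ℝ → ℝ := fun x => κ * x * F - N * ℓ (κ * x) with hθ
  set p : ℝ → ℝ := fun x => κ * F - N * (q (κ * x) * κ) with hp
  set p₁ : ℝ → ℝ := fun x => -(N * (q₁ (κ * x) * κ * κ)) with hp1
  set p₂ : ℝ → ℝ := fun x => -(N * (q₂ (κ * x) * κ * κ * κ)) with hp2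
  have dθ : ∀ x ∈ Set.Icc (1 / 4 : ℝ) 2, HasDerivAt θ (p x) x := fun x hx =>
    ((hmul x).mul_const F).fun_sub (((hd0 _ (hu0 x hx)).comp x (hmul x)).const_mul (N : ℝ))
  have dp : ∀ x ∈ Set.Icc (1 / 4 : ℝ) 2, HasDerivAt p (p₁ x) x := fun x hx =>
    ((((hd1 _ (hu0 x hx)).comp x (hmul x)).mul_const κ).const_mul (N : ℝ)).const_sub _
  have dp1 : ∀ x ∈ Set.Icc (1 / 4 : ℝ) 2, HasDerivAt p₁ (p₂ x) x := fun x hx =>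
    (((((hd2 _ (hu0 x hx)).comp x (hmul x)).mul_const κ).mul_const κ).const_mul (N : ℝ)).fun_neg
  have cp1 : ContinuousOn p₁ (Set.Icc (1 / 4) 2) := fun x hx =>
    (dp1 x hx).continuousAt.continuousWithinAt
  have cp2 : ContinuousOn p₂ (Set.Icc (1 / 4) 2) := by
    have : ContinuousOn (fun x => q₂ (κ * x)) (Set.Icc (1 / 4) 2) :=
      hcont.comp (by fun_prop) fun x hx => hu0 x hx
    exact (continuousOn_const.mul (((this.mul continuousOn_const).mul continuousOn_const).mul
      continuousOn_const)).neg
  have hpow : ∀ n : ℕ, ∀ x ∈ Set.Icc (1 / 4 : ℝ) 2, ∀ D : ℝ, 0 < D →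
      D / (κ * x) ^ n ≤ 4 ^ n * D / κ ^ n := fun n x hx D hD => by
    rw [mul_pow, div_le_div_iff₀ (by have := hx.1; positivity) (by positivity)]
    have : 1 ≤ (4 * x) ^ n := one_le_pow₀ (by linarith [hx.1])
    rw [mul_pow] at this
    have h2 : 0 < D * κ ^ n := by positivity
    nlinarith
  rw [phaseIntegral_eq_intervalIntegral hs]
  refine ⟨?_, fun hN => ?_, fun hfar => ?_⟩
  · refine (norm_integral_exp_mul_le (θ := θ) (by norm_num) (continuousOn_const (c := Z))
      fun x hx => (hZ x hx).1).trans ?_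
    rw [intervalIntegral.integral_const, smul_eq_mul]
    linarith
  · have hNp : 0 < |(N : ℝ)| := by positivity
    have hup' : ∀ x ∈ Set.Icc (1 / 4 : ℝ) 2, |p₁ x| ≤ 64 * C / (κ / |(N : ℝ)|) := fun x hx => by
      have h1 := hup _ (hu1 x hx)
      have h2 := hpow 3 x hx C hC
      have h3 : 0 ≤ -q₁ (κ * x) := le_trans (by have := hu0 x hx; positivity) (hlow _ (hu1 x hx))
      have e : |p₁ x| = |(N : ℝ)| * κ ^ 2 * (-q₁ (κ * x)) := by
        simp only [hp1]
        rw [abs_neg, abs_mul, abs_mul, abs_mul, abs_of_pos hκ0, ← abs_neg (q₁ _),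
          abs_of_nonneg h3]
        ring
      rw [e]
      calc _ ≤ |(N : ℝ)| * κ ^ 2 * (4 ^ 3 * C / κ ^ 3) := by
            gcongr; linarith
        _ = _ := by field_simp; norm_num
    have hlow' : ∀ x ∈ Set.Icc (1 / 4 : ℝ) 2, c / 8 / κ ≤ κ ^ 2 * (-q₁ (κ * x)) := fun x hx => by
      have h1 := hlow _ (hu1 x hx)
      have h2 : c / (2 * κ) ^ 3 ≤ c / (κ * x) ^ 3 := by
        have := hu0 x hx
        refine div_le_div_of_nonneg_left hc.le (by positivity) (pow_le_pow_left₀ this.le ?_ 3)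
        nlinarith [hx.2]
      calc c / 8 / κ = κ ^ 2 * (c / (2 * κ) ^ 3) := by field_simp; norm_num
        _ ≤ _ := by gcongr; linarith
    have := norm_integral_exp_le_sqrt (θ := θ) (ζ := ζ) (μ := κ / |(N : ℝ)|) (c := c / 8)
      (C := 64 * C) (Z := Z) (by norm_num) (by positivity) (by positivity) (by positivity) hZp.le
      dθ dp cp1 (fun x _ => hζd x) hζ'.continuous.continuousOn ha.1 hb.1
      (fun x hx => (hZ x hx).1) (fun x hx => (hZ x hx).2.1) (by
        rcases lt_or_gt_of_ne hN with h | h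
        · right
          intro x hx
          have hN' : (N : ℝ) < 0 := by exact_mod_cast h
          have h1 := mul_le_mul_of_nonneg_left (hlow' x hx) hNp.le
          rw [abs_of_neg hN'] at h1 ⊢
          have e : c / 8 / (κ / -(N : ℝ)) = -(N : ℝ) * (c / 8 / κ) := by
            have : (N : ℝ) ≠ 0 := hN'.ne
            field_simp
          rw [e]
          simp only [hp1]
          linarith
        · left
          intro x hx
          have hN' : (0 : ℝ) < N := by exact_mod_cast h
          have h1 := mul_le_mul_of_nonneg_left (hlow' x hx) hNp.le
          rw [abs_of_pos hN'] at h1 ⊢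
          have e : c / 8 / (κ / (N : ℝ)) = (N : ℝ) * (c / 8 / κ) := by field_simp
          rw [e]
          simp only [hp1]
          linarith) hup'
    refine this.trans ?_
    gcongr
    linarith
  · set y : ℝ := F - N * g with hy
    have hG : 0 < 64 * C / g := by positivity
    have hF : |F| ≤ κ ^ 2 * (|y| / (1 + 64 * C / g)) := by
      have h1 : (1 + 64 * C / g) * (|F| / κ ^ 2) ≤ |y| := by nlinarith [abs_nonneg F]
      rw [mul_comm, ← le_div_iff₀ (by positivity)] at h1
      rw [div_le_iff₀ (by positivity)] at h1
      linarith
    have hyp : 0 < |y| := lt_of_lt_of_le (by positivity) hfar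
    have hNg : |(N : ℝ)| * g ≤ |F| + |y| := by
      have : (N : ℝ) * g = F - y := by rw [hy]; ring
      have h := abs_sub F y
      rw [← this, abs_mul, abs_of_pos hg] at h
      exact h
    have hF' : |F| ≤ κ ^ 2 * |y| := by
      refine hF.trans ?_
      gcongr
      exact div_le_self hyp.le (by linarith)
    have hN2 : |(N : ℝ)| ≤ 2 * κ ^ 2 * |y| / g := by
      rw [le_div_iff₀ hg]
      have : 1 * |y| ≤ κ ^ 2 * |y| := by gcongr; nlinarith
      linarith
    have hslope : ∀ x ∈ Set.Icc (1 / 4 : ℝ) 2, |N * (q (κ * x) - g)| ≤ |y| / 2 := fun x hx => by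
      have h1 := (hb0 _ (hu1 x hx)).trans (hpow 2 x hx C hC)
      have h2 : |(N : ℝ)| ≤ (κ ^ 2 * (|y| / (1 + 64 * C / g)) + |y|) / g := by
        rw [le_div_iff₀ hg]; linarith
      rw [abs_mul]
      calc |(N : ℝ)| * |q (κ * x) - g|
          ≤ (κ ^ 2 * (|y| / (1 + 64 * C / g)) + |y|) / g * (4 ^ 2 * C / κ ^ 2) := by gcongr
        _ = |y| * (64 * C / g / (1 + 64 * C / g)) / 4 + |y| * (64 * C / g / κ ^ 2) / 4 := by
            field_simp; ring
        _ ≤ |y| * 1 / 4 + |y| * 1 / 4 := by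
            gcongr
            · rw [div_le_one (by positivity)]; linarith
            · rw [div_le_one (by positivity)]; exact hκC
        _ = _ := by ring
    have := norm_integral_exp_le_of_le_abs_deriv (θ := θ) (ζ := ζ) (R := κ * (|y| / 2)) (C := C')
      (Z := Z) (a := 1 / 4) (b := 2) (by norm_num) (by positivity) hC'p.le hZp.le dθ dp dp1 cp2
      (fun x _ => hζd x) (fun x _ => hζd' x) hζ''.continuous.continuousOn ha.1 hb.1 ha.2 hb.2
      (fun x hx => (hZ x hx).1) (fun x hx => (hZ x hx).2.1) (fun x hx => (hZ x hx).2.2)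
      (fun x hx => ?_) (fun x hx => ?_) (fun x hx => ?_)
    · refine this.trans ?_
      have e : (2 - 1 / 4) * (Z * (1 + 4 * C' + 3 * C' ^ 2)) / (κ * (|y| / 2)) ^ 2
          = B2 / (κ ^ 2 * y ^ 2) := by
        rw [hB2, ← sq_abs y]
        clear_value C'
        field_simp
        norm_num
      rw [e]
      gcongr
      linarith
    · have e : p x = κ * (y - N * (q (κ * x) - g)) := by simp only [hp, hy]; ring
      rw [e, abs_mul, abs_of_pos hκ0]
      have h1 := hslope x hx
      have h2 := abs_sub_abs_le_abs_sub y (N * (q (κ * x) - g))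
      gcongr
      linarith
    · have h1 := hup _ (hu1 x hx)
      have h2 := hpow 3 x hx C hC
      have h3 : 0 ≤ -q₁ (κ * x) := le_trans (by have := hu0 x hx; positivity) (hlow _ (hu1 x hx))
      have e : |p₁ x| = |(N : ℝ)| * κ ^ 2 * (-q₁ (κ * x)) := by
        simp only [hp1]
        rw [abs_neg, abs_mul, abs_mul, abs_mul, abs_of_pos hκ0, ← abs_neg (q₁ _),
          abs_of_nonneg h3]
        ring
      rw [e]
      calc _ ≤ 2 * κ ^ 2 * |y| / g * κ ^ 2 * (4 ^ 3 * C / κ ^ 3) := by gcongr; linarith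
        _ = C' / 4 * (κ * (|y| / 2)) := by rw [hC']; field_simp; norm_num
        _ ≤ _ := by gcongr; linarith
    · have h1 := (hb2 _ (hu1 x hx)).trans (hpow 4 x hx C hC)
      have e : |p₂ x| = |(N : ℝ)| * κ ^ 3 * |q₂ (κ * x)| := by
        simp only [hp2]
        rw [abs_neg, abs_mul, abs_mul, abs_mul, abs_mul, abs_of_pos hκ0]
        ring
      rw [e]
      calc _ ≤ 2 * κ ^ 2 * |y| / g * κ ^ 3 * (4 ^ 4 * C / κ ^ 4) := by gcongr
        _ = C' * (κ * (|y| / 2)) := by rw [hC']; field_simp; norm_num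

set_option maxHeartbeats 800000 in
/-- Summing the one-dimensional oscillatory integrals over all reflections. -/
theorem exists_sum_phaseIntegral_le {ℓ q q₁ q₂ : ℝ → ℝ} {g c C : ℝ}
    (hℓ : IsAlmostLinearPhase ℓ q q₁ q₂ g c C) {ζ : ℝ → ℝ} (hζ : ContDiff ℝ (⊤ : ℕ∞) ζ)
    (hs : tsupport ζ ⊆ Set.Icc (1 / 2 : ℝ) (3 / 2)) {δ : ℝ} (hδ : 0 < δ) (hδ1 : δ ≤ 1) :
    ∃ K > 0, ∃ κ₀ ≥ 4, ∀ κ ≥ κ₀, ∀ (F : ℝ) (s : Finset ℤ),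
      ∑ N ∈ s, ‖phaseIntegral ℓ ζ κ F N‖ ≤ K * (1 + √|F| / (κ * √κ)) ∧
      (δ * κ ^ 2 ≤ |F| → ∑ N ∈ s, ‖phaseIntegral ℓ ζ κ F N‖ ≤ K * (√|F| / (κ * √κ))) := by
  have hg := hℓ.slope_pos
  obtain ⟨B, hB, K₀, hK₀, κ₀, hκ₀, hbd⟩ := exists_phaseIntegral_bounds hℓ hζ hs
  set G : ℝ := (2 + 2 * g ^ 2) * π / g with hG
  have hGp : 0 < G := by have := Real.pi_pos; positivity
  set B' : ℝ := 2 * √(2 * g) + 2 with hB'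
  have hB'p : 0 < B' := by positivity
  set E : ℝ := K₀ * (1 / δ + 1) with hE
  have hEp : 0 < E := by positivity
  have hE2 : 2 * K₀ ≤ E := by
    have : 1 ≤ 1 / δ := by rw [le_div_iff₀ hδ]; linarith
    nlinarith
  refine ⟨B * B' * G * E, by positivity, κ₀ + 2 * E, by linarith, fun κ hκ F s => ?_⟩
  have hκ1 : κ₀ ≤ κ := by linarith
  have hκ4 : 4 ≤ κ := by linarith
  have hκ0 : 0 < κ := by linarith
  have hκE : 2 * E ≤ κ ^ 2 := by nlinarith
  set M : ℝ := K₀ * (1 + |F| / κ ^ 2) with hM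
  have hF0 : 0 ≤ |F| / κ ^ 2 := by positivity
  have hM1 : 1 ≤ M := by nlinarith
  have hM0 : 0 < M := by linarith
  have hsum := sum_one_div_one_add_sq_le hg s F hM1
  have hW : ∀ N : ℤ, |F - N * g| < M → 1 ≤ 2 * (1 / (1 + ((F - N * g) / M) ^ 2)) := fun N h => by
    rw [mul_one_div, le_div_iff₀ (by positivity), one_mul]
    have : ((F - N * g) / M) ^ 2 ≤ 1 := by
      rw [sq_le_one_iff_abs_le_one, abs_div, abs_of_pos hM0, div_le_one hM0]; exact h.le
    linarith
  have hW' : ∀ N : ℤ, M ≤ |F - N * g| →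
      1 / (F - N * g) ^ 2 ≤ 2 * (1 / (1 + ((F - N * g) / M) ^ 2)) / M ^ 2 := fun N h => by
    have h2 : M ^ 2 ≤ (F - N * g) ^ 2 := by rw [← sq_abs (F - N * g)]; gcongr
    have h3 : 0 < (F - N * g) ^ 2 := lt_of_lt_of_le (by positivity) h2
    have e : 2 * (1 / (1 + ((F - N * g) / M) ^ 2)) / M ^ 2 = 2 / (M ^ 2 + (F - N * g) ^ 2) := by
      field_simp
    rw [e, div_le_div_iff₀ h3 (by positivity)]
    linarith
  have hlarge : δ * κ ^ 2 ≤ |F| →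
      ∑ N ∈ s, ‖phaseIntegral ℓ ζ κ F N‖ ≤ B * B' * G * E * (√|F| / (κ * √κ)) := fun hF => by
    have hFp : 0 < |F| := lt_of_lt_of_le (by positivity) hF
    have hME : M ≤ E * (|F| / κ ^ 2) := by
      have : 1 ≤ 1 / δ * (|F| / κ ^ 2) := by
        rw [div_mul_div_comm, one_mul, le_div_iff₀ (by positivity)]; linarith
      rw [hM, hE, mul_assoc]
      gcongr
      linarith
    have hMF : M ≤ |F| / 2 := by
      refine hME.trans ?_
      rw [mul_div_assoc', div_le_div_iff₀ (by positivity) two_pos]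
      nlinarith
    set r : ℝ := √(κ / |F|) with hr
    have hrp : 0 < r := Real.sqrt_pos.2 (by positivity)
    have hterm : ∀ N ∈ s, ‖phaseIntegral ℓ ζ κ F N‖
        ≤ B * B' * r * (1 / (1 + ((F - N * g) / M) ^ 2)) := fun N _ => by
      have hWp : 0 < 1 / (1 + ((F - N * g) / M) ^ 2) := by positivity
      rcases lt_or_ge |F - N * g| M with h | h
      · have h1 := hW N h
        have hNF : |F| / (2 * g) ≤ |(N : ℝ)| := by
          rw [div_le_iff₀ (by positivity)]
          have h2 := abs_sub_abs_le_abs_sub F (N * g)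
          rw [abs_mul, abs_of_pos hg] at h2
          linarith
        have hN0 : N ≠ 0 := fun h0 => by
          rw [h0, Int.cast_zero, abs_zero] at hNF
          have : 0 < |F| / (2 * g) := by positivity
          linarith
        have h3 : √(κ / |(N : ℝ)|) ≤ √(2 * g) * r := by
          rw [hr, ← Real.sqrt_mul (by positivity)]
          refine Real.sqrt_le_sqrt ?_
          calc κ / |(N : ℝ)| ≤ κ / (|F| / (2 * g)) := by gcongr
            _ = _ := by field_simp
        calc _ ≤ B * √(κ / |(N : ℝ)|) := (hbd κ hκ1 F N).2.1 hN0
          _ ≤ B * (√(2 * g) * r) * 1 := by rw [mul_one]; gcongr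
          _ ≤ B * (√(2 * g) * r) * (2 * (1 / (1 + ((F - N * g) / M) ^ 2))) := by gcongr
          _ = B * (2 * √(2 * g)) * r * (1 / (1 + ((F - N * g) / M) ^ 2)) := by ring
          _ ≤ _ := by gcongr; rw [hB']; linarith
      · have h1 := hW' N h
        have h3 : 1 / (κ ^ 2 * M ^ 2) ≤ r := by
          refine Real.le_sqrt_of_sq_le ?_
          rw [div_pow, one_pow, div_le_div_iff₀ (by positivity) hFp, one_mul]
          have hFM : |F| ≤ κ ^ 2 * M := by
            have : |F| / κ ^ 2 ≤ M := by nlinarith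
            rw [div_le_iff₀ (by positivity)] at this
            linarith
          have e : κ * (κ ^ 2 * M ^ 2) ^ 2 = κ ^ 2 * M * (κ ^ 3 * M ^ 3) := by ring
          rw [e]
          have : 1 ≤ κ ^ 3 * M ^ 3 := one_le_mul_of_one_le_of_one_le
            (one_le_pow₀ (by linarith)) (one_le_pow₀ hM1)
          nlinarith [abs_nonneg F]
        calc _ ≤ B / (κ ^ 2 * (F - N * g) ^ 2) := (hbd κ hκ1 F N).2.2 h
          _ = B / κ ^ 2 * (1 / (F - N * g) ^ 2) := by rw [div_mul_div_comm, mul_one]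
          _ ≤ B / κ ^ 2 * (2 * (1 / (1 + ((F - N * g) / M) ^ 2)) / M ^ 2) := by gcongr
          _ = B * 2 * (1 / (κ ^ 2 * M ^ 2)) * (1 / (1 + ((F - N * g) / M) ^ 2)) := by
              field_simp
          _ ≤ _ := by
              gcongr
              rw [hB']
              linarith [Real.sqrt_nonneg (2 * g)]
    calc _ ≤ ∑ N ∈ s, B * B' * r * (1 / (1 + ((F - N * g) / M) ^ 2)) := Finset.sum_le_sum hterm
      _ = B * B' * r * ∑ N ∈ s, 1 / (1 + ((F - N * g) / M) ^ 2) := by rw [Finset.mul_sum]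
      _ ≤ B * B' * r * (G * (E * (|F| / κ ^ 2))) := by
          gcongr
          exact hsum.trans (by gcongr)
      _ = B * B' * G * E * (r * (|F| / κ ^ 2)) := by ring
      _ = _ := by
          congr 1
          rw [hr, Real.sqrt_div hκ0.le]
          have h1 : √|F| ^ 2 = |F| := Real.sq_sqrt hFp.le
          have h2 : √κ ^ 2 = κ := Real.sq_sqrt hκ0.le
          have h3 : 0 < √|F| := Real.sqrt_pos.2 hFp
          have h4 : 0 < √κ := Real.sqrt_pos.2 hκ0
          generalize √|F| = x at *
          generalize √κ = z at *
          rw [← h1, ← h2]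
          field_simp
  refine ⟨?_, hlarge⟩
  rcases le_total (δ * κ ^ 2) |F| with hF | hF
  · refine (hlarge hF).trans ?_
    gcongr
    linarith
  · have hterm : ∀ N ∈ s, ‖phaseIntegral ℓ ζ κ F N‖
        ≤ B * 2 * (1 / (1 + ((F - N * g) / M) ^ 2)) := fun N _ => by
      rcases lt_or_ge |F - N * g| M with h | h
      · have := hW N h
        have h2 := (hbd κ hκ1 F N).1
        nlinarith
      · have hy : 0 < (F - N * g) ^ 2 := by
          rw [← sq_abs]
          have : 0 < |F - N * g| := by linarith
          positivity
        calc _ ≤ B / (κ ^ 2 * (F - N * g) ^ 2) := (hbd κ hκ1 F N).2.2 h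
          _ ≤ B / (F - N * g) ^ 2 := by
              gcongr
              nlinarith
          _ = B * (1 / (F - N * g) ^ 2) := by ring
          _ ≤ B * (2 * (1 / (1 + ((F - N * g) / M) ^ 2)) / M ^ 2) :=
              mul_le_mul_of_nonneg_left (hW' N h) hB.le
          _ ≤ B * (2 * (1 / (1 + ((F - N * g) / M) ^ 2))) := by
              gcongr
              exact div_le_self (by positivity) (one_le_pow₀ hM1)
          _ = _ := by ring
    have hM2 : M ≤ E := by
      have : |F| / κ ^ 2 ≤ 1 := by
        rw [div_le_one (by positivity)]
        nlinarith
      nlinarith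
    calc _ ≤ ∑ N ∈ s, B * 2 * (1 / (1 + ((F - N * g) / M) ^ 2)) := Finset.sum_le_sum hterm
      _ = B * 2 * ∑ N ∈ s, 1 / (1 + ((F - N * g) / M) ^ 2) := by rw [Finset.mul_sum]
      _ ≤ B * 2 * (G * E) := by
          gcongr
          exact hsum.trans (by gcongr)
      _ ≤ B * B' * (G * E) := by
          gcongr
          rw [hB']
          linarith [Real.sqrt_nonneg (2 * g)]
      _ = B * B' * G * E * 1 := by ring
      _ ≤ _ := by
          gcongr
          have : 0 ≤ √|F| / (κ * √κ) := by positivity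
          linarith

theorem ContinuousOn.integrable_of_eq_zero_off {E : Type*} [TopologicalSpace E] [T2Space E]
    [MeasurableSpace E] [BorelSpace E] {μ : Measure E} [IsFiniteMeasureOnCompacts μ] {K : Set E}
    {f : E → ℂ} (hf : ContinuousOn f K) (hK : IsCompact K)
    (hf0 : ∀ x ∉ K, f x = 0) : Integrable f μ :=
  (integrableOn_iff_integrable_of_support_subset fun x hx => by
    by_contra h
    exact hx (hf0 x h)).1 (hf.integrableOn_compact hK)

/-- The integral of a directional derivative of a function supported in a compact set vanishes. -/
theorem integral_eq_zero_of_hasLineDerivAt {E : Type*} [NormedAddCommGroup E] [NormedSpace ℝ E]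
    [FiniteDimensional ℝ E] [MeasurableSpace E] [BorelSpace E] {μ : Measure E}
    [μ.IsAddHaarMeasure] {K : Set E} {f f' : E → ℂ} {v : E} (hK : IsCompact K)
    (hf : ContinuousOn f K) (hf0 : ∀ x ∉ K, f x = 0)
    (hf' : ContinuousOn f' K) (hf0' : ∀ x ∉ K, f' x = 0)
    (hd : ∀ x ∈ K, HasLineDerivAt ℝ f (f' x) x v) : ∫ x, f' x ∂μ = 0 := by
  have hd' : ∀ x, HasLineDerivAt ℝ f (f' x) x v := fun x => by
    by_cases hx : x ∈ K
    · exact hd x hx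
    · rw [hf0' x hx]
      have hc : Continuous fun t : ℝ => x + t • v := by fun_prop
      have hev : ∀ᶠ t : ℝ in nhds 0, f (x + t • v) = 0 := by
        filter_upwards [hc.continuousAt.preimage_mem_nhds
          (hK.isClosed.isOpen_compl.mem_nhds (by simpa using hx))] with t ht
        exact hf0 _ ht
      exact (hasDerivAt_const (0 : ℝ) (0 : ℂ)).congr_of_eventuallyEq hev
  have h := integral_bilinear_hasLineDerivAt_right_eq_neg_left_of_integrable (μ := μ)
    (f := fun _ : E => (1 : ℝ)) (f' := fun _ => 0) (g := f) (g' := f') (v := v)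
    (B := ContinuousLinearMap.lsmul ℝ ℝ) (by simp)
    (by simpa using hf'.integrable_of_eq_zero_off hK hf0')
    (by simpa using hf.integrable_of_eq_zero_off hK hf0)
    (fun x _ => hasDerivAt_const _ _) (fun x _ => hd' x)
  simpa using h

/-- Non-stationary phase in one direction, with the weight `1 / (1 + m⁴ p²)` interpolating between
the stationary and the non-stationary region. -/
theorem integral_eq_add_of_hasLineDerivAt {E : Type*} [NormedAddCommGroup E] [NormedSpace ℝ E]
    [FiniteDimensional ℝ E] [MeasurableSpace E] [BorelSpace E] {μ : Measure E}
    [μ.IsAddHaarMeasure] {K : Set E} {v : E} {m : ℝ} (hm : 0 < m) (hK : IsCompact K) {e : E → ℂ}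
    {w p p' x x' : E → ℝ} (he : ContinuousOn e K) (hw : ContinuousOn w K) (hw0 : ∀ z ∈ K, w z ≠ 0)
    (hp : ContinuousOn p K) (hp' : ContinuousOn p' K) (hx : ContinuousOn x K)
    (hx' : ContinuousOn x' K) (hx0 : ∀ z ∉ K, x z = 0) (hx0' : ∀ z ∉ K, x' z = 0)
    (hdw : ∀ z ∈ K, HasLineDerivAt ℝ w 0 z v)
    (hde : ∀ z ∈ K, HasLineDerivAt ℝ e (I * ((m ^ 3 * w z * p z : ℝ) : ℂ) * e z) z v)
    (hdp : ∀ z ∈ K, HasLineDerivAt ℝ p (p' z) z v)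
    (hdx : ∀ z ∈ K, HasLineDerivAt ℝ x (x' z) z v) :
    ∫ z, e z * x z ∂μ = ∫ z, e z * ((1 / (1 + m ^ 4 * p z ^ 2) * x z : ℝ) : ℂ) ∂μ
      + I * ∫ z, e z * ((m * p z / (1 + m ^ 4 * p z ^ 2) * (x' z / w z) : ℝ) : ℂ) ∂μ
      + I * ∫ z, e z * ((p' z * m * (1 - m ^ 4 * p z ^ 2) / (1 + m ^ 4 * p z ^ 2) ^ 2
          * (x z / w z) : ℝ) : ℂ) ∂μ := by
  have hD : ∀ z, 1 + m ^ 4 * p z ^ 2 ≠ 0 := fun z => by positivity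
  have hDc : ContinuousOn (fun z => 1 + m ^ 4 * p z ^ 2) K := by fun_prop
  have c0 : ContinuousOn (fun z => ((1 / (1 + m ^ 4 * p z ^ 2) * x z : ℝ) : ℂ)) K :=
    continuous_ofReal.comp_continuousOn
      ((continuousOn_const.div hDc fun z _ => hD z).mul hx)
  have c1 : ContinuousOn (fun z => ((m * p z / (1 + m ^ 4 * p z ^ 2) * (x' z / w z) : ℝ) : ℂ)) K :=
    continuous_ofReal.comp_continuousOn
      (((continuousOn_const.mul hp).div hDc fun z _ => hD z).mul (hx'.div hw hw0))
  have c2 : ContinuousOn (fun z => ((p' z * m * (1 - m ^ 4 * p z ^ 2) / (1 + m ^ 4 * p z ^ 2) ^ 2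
          * (x z / w z) : ℝ) : ℂ)) K :=
    continuous_ofReal.comp_continuousOn ((ContinuousOn.div (by fun_prop) (hDc.pow 2)
      fun z _ => pow_ne_zero 2 (hD z)).mul (hx.div hw hw0))
  have cf : ContinuousOn (fun z => ((m * p z / (1 + m ^ 4 * p z ^ 2) * (x z / w z) : ℝ) : ℂ)) K :=
    continuous_ofReal.comp_continuousOn
      (((continuousOn_const.mul hp).div hDc fun z _ => hD z).mul (hx.div hw hw0))
  have hI : ∀ y : E → ℝ, ContinuousOn (fun z => (y z : ℂ)) K → (∀ z ∉ K, y z = 0) →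
      Integrable (fun z => e z * (y z : ℂ)) μ := fun y hy hy0 =>
    (he.mul hy).integrable_of_eq_zero_off hK fun z hz => by simp [hy0 z hz]
  have i0 := hI _ c0 fun z hz => by simp [hx0 z hz]
  have i1 := hI _ c1 fun z hz => by simp [hx0' z hz]
  have i2 := hI _ c2 fun z hz => by simp [hx0 z hz]
  have ix := hI x (continuous_ofReal.comp_continuousOn hx) hx0
  have isub : Integrable (fun z => I * (e z * (x z : ℂ)
      - e z * ((1 / (1 + m ^ 4 * p z ^ 2) * x z : ℝ) : ℂ))) μ := (ix.sub i0).const_mul I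
  have iadd : Integrable (fun z =>
      e z * ((m * p z / (1 + m ^ 4 * p z ^ 2) * (x' z / w z) : ℝ) : ℂ)
      + e z * ((p' z * m * (1 - m ^ 4 * p z ^ 2) / (1 + m ^ 4 * p z ^ 2) ^ 2
          * (x z / w z) : ℝ) : ℂ)) μ := i1.add i2
  have key := integral_eq_zero_of_hasLineDerivAt (μ := μ) (v := v) (K := K)
    (f := fun z => e z * ((m * p z / (1 + m ^ 4 * p z ^ 2) * (x z / w z) : ℝ) : ℂ))
    (f' := fun z => I * (e z * x z - e z * ((1 / (1 + m ^ 4 * p z ^ 2) * x z : ℝ) : ℂ))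
      + (e z * ((m * p z / (1 + m ^ 4 * p z ^ 2) * (x' z / w z) : ℝ) : ℂ)
      + e z * ((p' z * m * (1 - m ^ 4 * p z ^ 2) / (1 + m ^ 4 * p z ^ 2) ^ 2
          * (x z / w z) : ℝ) : ℂ))) hK (he.mul cf) (fun z hz => by simp [hx0 z hz])
    ((continuousOn_const.mul ((he.mul (continuous_ofReal.comp_continuousOn hx)).sub
      (he.mul c0))).add ((he.mul c1).add (he.mul c2)))
    (fun z hz => by simp [hx0 z hz, hx0' z hz]) (fun z hz => by
      have h1 : HasDerivAt (fun t : ℝ => p (z + t • v)) (p' z) 0 := hdp z hz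
      have h2 : HasDerivAt (fun t : ℝ => x (z + t • v)) (x' z) 0 := hdx z hz
      have h3 : HasDerivAt (fun t : ℝ => w (z + t • v)) 0 0 := hdw z hz
      have h4 : HasDerivAt (fun t : ℝ => e (z + t • v)) _ 0 := hde z hz
      have h5 := (((h1.const_mul m).fun_div (((h1.fun_pow 2).const_mul (m ^ 4)).const_add 1)
        (hD _)).fun_mul (h2.fun_div h3 (by simpa using hw0 z hz))).ofReal_comp
      have h6 := h4.fun_mul h5
      refine h6.congr_deriv ?_
      have hw' := hw0 z hz
      have hD' := hD z
      simp only [zero_smul, add_zero]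
      have e1 : (1 / (1 + m ^ 4 * p z ^ 2) * x z : ℝ) =
          x z - m ^ 4 * p z ^ 2 * x z / (1 + m ^ 4 * p z ^ 2) := by
        field_simp; ring
      rw [e1]
      push_cast
      have hD'' : (1 : ℂ) + (m : ℂ) ^ 4 * (p z : ℂ) ^ 2 ≠ 0 := by exact_mod_cast hD'
      have hw'' : (w z : ℂ) ≠ 0 := by exact_mod_cast hw'
      field_simp
      ring)
  rw [integral_add isub iadd, integral_const_mul,
    integral_sub ix i0, integral_add i1 i2] at key
  linear_combination (-I) * key + (∫ z, e z * x z ∂μ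
    - ∫ z, e z * ((1 / (1 + m ^ 4 * p z ^ 2) * x z : ℝ) : ℂ) ∂μ) * Complex.I_sq

/-- Non-stationary phase along the vector field `b ∂₁ - (3/2) w ∂₂`, where `b` and `w` are the
coordinates in the directions `v₁` and `v₂`. -/
theorem integral_eq_add_of_scaling {E : Type*} [NormedAddCommGroup E] [NormedSpace ℝ E]
    [FiniteDimensional ℝ E] [MeasurableSpace E] [BorelSpace E] {μ : Measure E}
    [μ.IsAddHaarMeasure] {K : Set E} {v₁ v₂ : E} {k τ : ℝ} (hk : 0 < k) (hτ : 0 < τ)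
    (hK : IsCompact K) {e : E → ℂ} {e₁ e₂ b w H H' x x' ζ ζ' : E → ℝ} (he : ContinuousOn e K)
    (he₁ : ContinuousOn e₁ K) (he₂ : ContinuousOn e₂ K) (hb : ContinuousOn b K)
    (hw : ContinuousOn w K) (hw0 : ∀ z ∈ K, w z ≠ 0) (hH : ContinuousOn H K)
    (hH' : ContinuousOn H' K) (hx : ContinuousOn x K) (hx' : ContinuousOn x' K)
    (hζ : ContinuousOn ζ K) (hζ' : ContinuousOn ζ' K)
    (h0 : ∀ z ∉ K, x z * ζ z = 0 ∧ x' z * ζ z = 0 ∧ x z * ζ' z = 0)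
    (hde₁ : ∀ z ∈ K, HasLineDerivAt ℝ e (I * (e₁ z : ℂ) * e z) z v₁)
    (hde₂ : ∀ z ∈ K, HasLineDerivAt ℝ e (I * (e₂ z : ℂ) * e z) z v₂)
    (he₁₂ : ∀ z ∈ K, b z * e₁ z - 3 / 2 * w z * e₂ z = k * τ * w z * H z)
    (hdb₁ : ∀ z ∈ K, HasLineDerivAt ℝ b 1 z v₁)
    (hdw₁ : ∀ z ∈ K, HasLineDerivAt ℝ w 0 z v₁)
    (hdH₁ : ∀ z ∈ K, HasLineDerivAt ℝ H (H' z) z v₁)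
    (hdH₂ : ∀ z ∈ K, HasLineDerivAt ℝ H 0 z v₂)
    (hdx₁ : ∀ z ∈ K, HasLineDerivAt ℝ x (x' z) z v₁)
    (hdx₂ : ∀ z ∈ K, HasLineDerivAt ℝ x 0 z v₂)
    (hdζ₁ : ∀ z ∈ K, HasLineDerivAt ℝ ζ 0 z v₁)
    (hdζ₂ : ∀ z ∈ K, HasLineDerivAt ℝ ζ (ζ' z) z v₂) :
    ∫ z, e z * ((x z * ζ z : ℝ) : ℂ) ∂μ
      = ∫ z, e z * ((1 / (1 + k * H z ^ 2) * x z * ζ z : ℝ) : ℂ) ∂μ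
      + I * (∫ z, e z * ((τ⁻¹ * ((H z * x z + b z * H z * x' z) / (1 + k * H z ^ 2)
          + b z * x z * H' z * (1 - k * H z ^ 2) / (1 + k * H z ^ 2) ^ 2)
          * (ζ z / w z) : ℝ) : ℂ) ∂μ)
      - I * (∫ z, e z * ((τ⁻¹ * (3 / 2 * (H z * x z / (1 + k * H z ^ 2)))
          * ζ' z : ℝ) : ℂ) ∂μ) := by
  have hD : ∀ z, 1 + k * H z ^ 2 ≠ 0 := fun z => by positivity
  have hDc : ContinuousOn (fun z => 1 + k * H z ^ 2) K := by fun_prop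
  have hre : ∀ y : E → ℝ, ContinuousOn y K → ContinuousOn (fun z => (y z : ℂ)) K := fun y hy =>
    continuous_ofReal.comp_continuousOn hy
  have hI : ∀ y : E → ℝ, ContinuousOn y K → (∀ z ∉ K, y z = 0) →
      Integrable (fun z => e z * (y z : ℂ)) μ := fun y hy hy0 =>
    (he.mul (hre y hy)).integrable_of_eq_zero_off hK fun z hz => by simp [hy0 z hz]
  have z0 : ∀ z ∉ K, ∀ r : ℝ, r * x z * ζ z = 0 := fun z hz r => by
    rw [mul_assoc, (h0 z hz).1, mul_zero]
  set y0 : E → ℝ := fun z => x z * ζ z with hy0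
  set y1 : E → ℝ := fun z => 1 / (1 + k * H z ^ 2) * x z * ζ z with hy1
  set y2 : E → ℝ := fun z => τ⁻¹ * ((H z * x z + b z * H z * x' z) / (1 + k * H z ^ 2)
          + b z * x z * H' z * (1 - k * H z ^ 2) / (1 + k * H z ^ 2) ^ 2)
          * (ζ z / w z) with hy2
  set y3 : E → ℝ := fun z => τ⁻¹ * (3 / 2 * (H z * x z / (1 + k * H z ^ 2))) * ζ' z with hy3
  have c0 : ContinuousOn y0 K := hx.mul hζ
  have c1 : ContinuousOn y1 K := ((continuousOn_const.div hDc fun z _ => hD z).mul hx).mul hζ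
  have c2 : ContinuousOn y2 K := (continuousOn_const.mul ((((hH.mul hx).add
    ((hb.mul hH).mul hx')).div hDc fun z _ => hD z).add (ContinuousOn.div (by fun_prop) (hDc.pow 2)
      fun z _ => pow_ne_zero 2 (hD z)))).mul (hζ.div hw hw0)
  have c3 : ContinuousOn y3 K := (continuousOn_const.mul (continuousOn_const.mul
    ((hH.mul hx).div hDc fun z _ => hD z))).mul hζ'
  have o0 : ∀ z ∉ K, y0 z = 0 := fun z hz => (h0 z hz).1
  have o1 : ∀ z ∉ K, y1 z = 0 := fun z hz => z0 z hz _
  have o2 : ∀ z ∉ K, y2 z = 0 := fun z hz => by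
    have e : y2 z = τ⁻¹ * (H z * (x z * ζ z) / (1 + k * H z ^ 2)
      + b z * H z * (x' z * ζ z) / (1 + k * H z ^ 2)
      + b z * (x z * ζ z) * H' z * (1 - k * H z ^ 2) / (1 + k * H z ^ 2) ^ 2) / w z := by
      simp only [hy2]; ring
    rw [e, (h0 z hz).1, (h0 z hz).2.1]
    simp
  have o3 : ∀ z ∉ K, y3 z = 0 := fun z hz => by
    have e : y3 z = τ⁻¹ * (3 / 2 * (H z * (x z * ζ' z) / (1 + k * H z ^ 2))) := by
      simp only [hy3]; ring
    rw [e, (h0 z hz).2.2]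
    simp
  set f1 : E → ℝ := fun z => b z * H z * x z * ζ z / (w z * (1 + k * H z ^ 2)) with hf1
  set f2 : E → ℝ := fun z => H z * x z * ζ z / (1 + k * H z ^ 2) with hf2
  have cf1 : ContinuousOn f1 K := ContinuousOn.div (by fun_prop) (hw.mul hDc)
    fun z hz => mul_ne_zero (hw0 z hz) (hD z)
  have cf2 : ContinuousOn f2 K := ContinuousOn.div (by fun_prop) hDc fun z _ => hD z
  have of1 : ∀ z ∉ K, f1 z = 0 := fun z hz => by simp only [hf1, z0 z hz, zero_div]
  have of2 : ∀ z ∉ K, f2 z = 0 := fun z hz => by simp only [hf2, z0 z hz, zero_div]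
  have key1 := integral_eq_zero_of_hasLineDerivAt (μ := μ) (v := v₁) (K := K)
    (f := fun z => e z * (f1 z : ℂ))
    (f' := fun z => I * (e z * ((e₁ z * f1 z : ℝ) : ℂ)) + τ * (e z * (y2 z : ℂ))) hK
    (he.mul (hre _ cf1)) (fun z hz => by simp [of1 z hz])
    ((continuousOn_const.mul (he.mul (hre _ (he₁.mul cf1)))).add
      (continuousOn_const.mul (he.mul (hre _ c2))))
    (fun z hz => by simp [of1 z hz, o2 z hz]) (fun z hz => by
      have d1 : HasDerivAt (fun t : ℝ => b (z + t • v₁)) 1 0 := hdb₁ z hz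
      have d2 : HasDerivAt (fun t : ℝ => w (z + t • v₁)) 0 0 := hdw₁ z hz
      have d3 : HasDerivAt (fun t : ℝ => H (z + t • v₁)) (H' z) 0 := hdH₁ z hz
      have d4 : HasDerivAt (fun t : ℝ => x (z + t • v₁)) (x' z) 0 := hdx₁ z hz
      have d5 : HasDerivAt (fun t : ℝ => ζ (z + t • v₁)) 0 0 := hdζ₁ z hz
      have d6 : HasDerivAt (fun t : ℝ => e (z + t • v₁)) _ 0 := hde₁ z hz
      have d7 := ((((d1.fun_mul d3).fun_mul d4).fun_mul d5).fun_div
        (d2.fun_mul (((d3.fun_pow 2).const_mul k).const_add 1))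
        (mul_ne_zero (by simpa using hw0 z hz) (hD _))).ofReal_comp
      refine (d6.fun_mul d7).congr_deriv ?_
      have hw' := hw0 z hz
      have hD' := hD z
      simp only [zero_smul, add_zero, hf1, hy2]
      push_cast
      have hD'' : (1 : ℂ) + (k : ℂ) * (H z : ℂ) ^ 2 ≠ 0 := by exact_mod_cast hD'
      have hw'' : (w z : ℂ) ≠ 0 := by exact_mod_cast hw'
      have hτ' : (τ : ℂ) ≠ 0 := by exact_mod_cast hτ.ne'
      field_simp
      ring)
  have key2 := integral_eq_zero_of_hasLineDerivAt (μ := μ) (v := v₂) (K := K)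
    (f := fun z => e z * (f2 z : ℂ))
    (f' := fun z => I * (e z * ((e₂ z * f2 z : ℝ) : ℂ)) + (2 / 3 * τ) * (e z * (y3 z : ℂ))) hK
    (he.mul (hre _ cf2)) (fun z hz => by simp [of2 z hz])
    ((continuousOn_const.mul (he.mul (hre _ (he₂.mul cf2)))).add
      (continuousOn_const.mul (he.mul (hre _ c3))))
    (fun z hz => by simp [of2 z hz, o3 z hz]) (fun z hz => by
      have d3 : HasDerivAt (fun t : ℝ => H (z + t • v₂)) 0 0 := hdH₂ z hz
      have d4 : HasDerivAt (fun t : ℝ => x (z + t • v₂)) 0 0 := hdx₂ z hz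
      have d5 : HasDerivAt (fun t : ℝ => ζ (z + t • v₂)) (ζ' z) 0 := hdζ₂ z hz
      have d6 : HasDerivAt (fun t : ℝ => e (z + t • v₂)) _ 0 := hde₂ z hz
      have d7 := ((((d3.fun_mul d4).fun_mul d5).fun_div
        (((d3.fun_pow 2).const_mul k).const_add 1) (hD _)).congr_deriv
        (g' := H z * x z * ζ' z / (1 + k * H z ^ 2)) (by
          have hD' := hD z
          simp only [zero_smul, add_zero, mul_zero, zero_mul, zero_add, sub_zero]
          field_simp)).ofReal_comp
      refine (d6.fun_mul d7).congr_deriv ?_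
      have hD' := hD z
      simp only [zero_smul, add_zero, hf2, hy3]
      push_cast
      have hD'' : (1 : ℂ) + (k : ℂ) * (H z : ℂ) ^ 2 ≠ 0 := by exact_mod_cast hD'
      have hτ' : (τ : ℂ) ≠ 0 := by exact_mod_cast hτ.ne'
      field_simp)
  have i1 : Integrable (fun z => e z * ((e₁ z * f1 z : ℝ) : ℂ)) μ :=
    hI _ (he₁.mul cf1) fun z hz => by simp [of1 z hz]
  have i2 : Integrable (fun z => e z * ((e₂ z * f2 z : ℝ) : ℂ)) μ :=
    hI _ (he₂.mul cf2) fun z hz => by simp [of2 z hz]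
  have j0 := hI _ c0 o0
  have j1 := hI _ c1 o1
  have j2 := hI _ c2 o2
  have j3 := hI _ c3 o3
  rw [integral_add (i1.const_mul I) (j2.const_mul _), integral_const_mul, integral_const_mul]
    at key1
  rw [integral_add (i2.const_mul I) (j3.const_mul _), integral_const_mul, integral_const_mul]
    at key2
  have key3 : (τ : ℂ) * (∫ z, e z * (y0 z : ℂ) ∂μ - ∫ z, e z * (y1 z : ℂ) ∂μ)
      = ∫ z, e z * ((e₁ z * f1 z : ℝ) : ℂ) ∂μ
        - 3 / 2 * ∫ z, e z * ((e₂ z * f2 z : ℝ) : ℂ) ∂μ := by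
    rw [← integral_const_mul, ← integral_sub j0 j1, ← integral_const_mul,
      ← integral_sub i1 (i2.const_mul _)]
    refine integral_congr_ae (Eventually.of_forall fun z => ?_)
    by_cases hz : z ∈ K
    · have hw' := hw0 z hz
      have hD' := hD z
      have h12 := he₁₂ z hz
      have hr : τ * (y0 z - y1 z) = e₁ z * f1 z - 3 / 2 * (e₂ z * f2 z) := by
        have e2 : e₁ z * f1 z - 3 / 2 * (e₂ z * f2 z) =
            (b z * e₁ z - 3 / 2 * w z * e₂ z) * (H z * x z * ζ z)
              / (w z * (1 + k * H z ^ 2)) := by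
          simp only [hf1, hf2]
          field_simp
        rw [e2, h12]
        simp only [hy0, hy1]
        field_simp
        ring
      have e' : (τ : ℂ) * ((y0 z : ℂ) - (y1 z : ℂ))
          = ((e₁ z * f1 z : ℝ) : ℂ) - 3 / 2 * ((e₂ z * f2 z : ℝ) : ℂ) := by
        have := congrArg (fun r : ℝ => (r : ℂ)) hr
        push_cast at this ⊢
        exact this
      linear_combination (e z) * e'
    · simp [o0 z hz, o1 z hz, of1 z hz, of2 z hz]
  have hτ' : (τ : ℂ) ≠ 0 := by exact_mod_cast hτ.ne'
  have hII := Complex.I_sq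
  generalize (∫ z, e z * ((e₁ z * f1 z : ℝ) : ℂ) ∂μ) = q1 at *
  generalize (∫ z, e z * ((e₂ z * f2 z : ℝ) : ℂ) ∂μ) = q2 at *
  generalize (∫ z, e z * (y0 z : ℂ) ∂μ) = p0 at *
  generalize (∫ z, e z * (y1 z : ℂ) ∂μ) = p1 at *
  generalize (∫ z, e z * (y2 z : ℂ) ∂μ) = p2 at *
  generalize (∫ z, e z * (y3 z : ℂ) ∂μ) = p3 at *
  have : (τ : ℂ) * p0 = τ * (p1 + I * p2 - I * p3) := by
    linear_combination key3 - I * key1 + 3 / 2 * I * key2 + (q1 - 3 / 2 * q2) * hII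
  exact mul_left_cancel₀ hτ' this

theorem enorm_integral_prod_le {β : Type*} [TopologicalSpace β] [T2Space β] [MeasureSpace β]
    [SecondCountableTopology β]
    [BorelSpace β] [SFinite (volume : Measure β)]
    [IsFiniteMeasureOnCompacts (volume : Measure β)] {K₁ : Set ℝ} {K₂ : Set β}
    (hK₁ : IsCompact K₁) (hK₂ : IsCompact K₂) {G : ℝ × β → ℂ} (hG : ContinuousOn G (K₁ ×ˢ K₂))
    (hG0 : ∀ z ∉ K₁ ×ˢ K₂, G z = 0) :
    ‖∫ z, G z‖ₑ ≤ ∫⁻ t, ‖∫ w, G (t, w)‖ₑ := by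
  rw [Measure.volume_eq_prod, integral_prod _ (hG.integrable_of_eq_zero_off (hK₁.prod hK₂) hG0)]
  exact enorm_integral_le_lintegral_enorm _

theorem ContinuousOn.slice_of_eq_zero_off {α β : Type*} [TopologicalSpace α] [TopologicalSpace β]
    {K₁ : Set α} {K₂ : Set β} {G : α × β → ℂ} (hG : ContinuousOn G (K₁ ×ˢ K₂))
    (hG0 : ∀ z ∉ K₁ ×ˢ K₂, G z = 0) (t : α) :
    ContinuousOn (fun w => G (t, w)) K₂ ∧ ∀ w ∉ K₂, G (t, w) = 0 := by
  refine ⟨?_, fun w hw => hG0 _ fun h => hw h.2⟩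
  by_cases ht : t ∈ K₁
  · exact hG.comp (by fun_prop) fun w hw => ⟨ht, hw⟩
  · exact (continuousOn_const (c := (0 : ℂ))).congr fun w _ => hG0 (t, w) fun h => ht h.1

theorem sum_lintegral_le {α ι : Type*} [MeasurableSpace α] (μ : Measure α) (s : Finset ι)
    (f : ι → α → ENNReal) : ∑ i ∈ s, ∫⁻ x, f i x ∂μ ≤ ∫⁻ x, ∑ i ∈ s, f i x ∂μ := by
  classical
  induction s using Finset.induction_on with
  | empty => simp
  | insert i s hi ih =>
    simp only [Finset.sum_insert hi]
    exact (add_le_add le_rfl ih).trans (le_lintegral_add _ _)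

theorem sum_enorm_integral_le {ι : Type*} {K₁ K₂ K₃ K₄ : Set ℝ} (hK₁ : IsCompact K₁)
    (hK₂ : IsCompact K₂) (hK₃ : IsCompact K₃) (hK₄ : IsCompact K₄) (s : Finset ι)
    {G : ι → ℝ × ℝ × ℝ × ℝ → ℂ} (hG : ∀ i, ContinuousOn (G i) (K₁ ×ˢ K₂ ×ˢ K₃ ×ˢ K₄))
    (hG0 : ∀ i, ∀ z ∉ K₁ ×ˢ K₂ ×ˢ K₃ ×ˢ K₄, G i z = 0) {B : ℝ → ℝ → ℝ → ENNReal}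
    (hB : ∀ x y z, ∑ i ∈ s, ‖∫ w, G i (x, y, z, w)‖ₑ ≤ B x y z) :
    ∑ i ∈ s, ‖∫ v, G i v‖ₑ ≤ ∫⁻ x, ∫⁻ y, ∫⁻ z, B x y z := by
  have h1 : ∀ i ∈ s, ‖∫ v, G i v‖ₑ ≤ ∫⁻ x, ∫⁻ y, ∫⁻ z, ‖∫ w, G i (x, y, z, w)‖ₑ := fun i _ => by
    refine (enorm_integral_prod_le hK₁ (hK₂.prod (hK₃.prod hK₄)) (hG i) (hG0 i)).trans
      (lintegral_mono fun x => ?_)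
    obtain ⟨g1, g2⟩ := (hG i).slice_of_eq_zero_off (hG0 i) x
    refine (enorm_integral_prod_le hK₂ (hK₃.prod hK₄) g1 g2).trans (lintegral_mono fun y => ?_)
    obtain ⟨g3, g4⟩ := g1.slice_of_eq_zero_off g2 y
    exact enorm_integral_prod_le hK₃ hK₄ g3 g4
  calc _ ≤ ∑ i ∈ s, ∫⁻ x, ∫⁻ y, ∫⁻ z, ‖∫ w, G i (x, y, z, w)‖ₑ := Finset.sum_le_sum h1
    _ ≤ ∫⁻ x, ∑ i ∈ s, ∫⁻ y, ∫⁻ z, ‖∫ w, G i (x, y, z, w)‖ₑ := sum_lintegral_le _ _ _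
    _ ≤ ∫⁻ x, ∫⁻ y, ∑ i ∈ s, ∫⁻ z, ‖∫ w, G i (x, y, z, w)‖ₑ :=
        lintegral_mono fun x => sum_lintegral_le _ _ _
    _ ≤ ∫⁻ x, ∫⁻ y, ∫⁻ z, ∑ i ∈ s, ‖∫ w, G i (x, y, z, w)‖ₑ :=
        lintegral_mono fun x => lintegral_mono fun y => sum_lintegral_le _ _ _
    _ ≤ _ := lintegral_mono fun x => lintegral_mono fun y => lintegral_mono fun z => hB x y z

/-- The normalised travel time `√(1+a) (A - 1) / (√(1+aA) + √(1+a))`. -/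
noncomputable def travelTime (a A : ℝ) : ℝ := √(1 + a) * (A - 1) / (√(1 + a * A) + √(1 + a))

noncomputable def travelTimeDeriv (a A : ℝ) : ℝ := √(1 + a) / (2 * √(1 + a * A))

noncomputable def travelTimeDeriv₂ (a A : ℝ) : ℝ := -(a * √(1 + a) / (4 * √(1 + a * A) ^ 3))

/-- The part of the phase that does not depend on the number of reflections. -/
noncomputable def cubicPhase (a X Y T S Υ A : ℝ) : ℝ :=
  Y + S ^ 3 / 3 + S * (1 - A) + Υ ^ 3 / 3 + Υ * (X - A) + T * travelTime a A

/-- `A ∂_A P - (3/2) P`, where `P` is the phase `cubicPhase`. -/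
noncomputable def scalingDefect (a X Y T S Υ A : ℝ) : ℝ :=
  -(3 / 2) * (Y + S ^ 3 / 3 + S + Υ ^ 3 / 3 + Υ * X + T * travelTime a A)
    + T * A * travelTimeDeriv a A + (S + Υ) / 2 * A

noncomputable def scalingDefectDeriv (a T S Υ A : ℝ) : ℝ :=
  -(T * travelTimeDeriv a A / 2) + T * A * travelTimeDeriv₂ a A + (S + Υ) / 2

theorem travelTime_eq {a A : ℝ} (ha : 0 < a) (hA : 0 ≤ A) :
    travelTime a A = √(1 + a) * (√(1 + a * A) - √(1 + a)) / a := by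
  have h1 : 0 < √(1 + a) := Real.sqrt_pos.2 (by linarith)
  have h2 : 0 ≤ √(1 + a * A) := Real.sqrt_nonneg _
  have e1 : √(1 + a) ^ 2 = 1 + a := Real.sq_sqrt (by linarith)
  have e2 : √(1 + a * A) ^ 2 = 1 + a * A := Real.sq_sqrt (by positivity)
  rw [travelTime, div_eq_div_iff (by positivity) ha.ne']
  linear_combination √(1 + a) * e1 - √(1 + a) * e2

theorem hasDerivAt_travelTime {a A : ℝ} (ha : 0 < a) (hA : 0 < A) :
    HasDerivAt (travelTime a) (travelTimeDeriv a A) A := by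
  have h0 : 0 < 1 + a * A := by positivity
  have h2 : 0 < √(1 + a * A) := Real.sqrt_pos.2 h0
  have h : HasDerivAt (fun x => √(1 + a) * (√(1 + a * x) - √(1 + a)) / a)
      (travelTimeDeriv a A) A :=
    (((((((hasDerivAt_id A).const_mul a).const_add 1).sqrt h0.ne').sub_const _).const_mul
      (√(1 + a))).div_const a).congr_deriv (by
      rw [travelTimeDeriv]
      simp only [id]
      field_simp)
  refine h.congr_of_eventuallyEq ?_
  filter_upwards [lt_mem_nhds hA] with x hx
  exact travelTime_eq ha hx.le

theorem hasDerivAt_travelTimeDeriv {a A : ℝ} (ha : 0 < a) (hA : 0 < A) :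
    HasDerivAt (travelTimeDeriv a) (travelTimeDeriv₂ a A) A := by
  have h0 : 0 < 1 + a * A := by positivity
  have h2 : 0 < √(1 + a * A) := Real.sqrt_pos.2 h0
  exact ((hasDerivAt_const A (√(1 + a))).fun_div
    (((((hasDerivAt_id A).const_mul a).const_add 1).sqrt h0.ne').const_mul 2)
    (by simp only [id]; positivity)).congr_deriv (by
      rw [travelTimeDeriv₂]
      simp only [id]
      field_simp
      ring)

theorem hasDerivAt_cubicPhase {a A : ℝ} (ha : 0 < a) (hA : 0 < A) (X Y T S Υ : ℝ) :
    HasDerivAt (cubicPhase a X Y T S Υ) (-S - Υ + T * travelTimeDeriv a A) A :=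
  ((((((hasDerivAt_id A).const_sub 1).const_mul S).const_add (Y + S ^ 3 / 3)).add_const
    (Υ ^ 3 / 3)).fun_add (((hasDerivAt_id A).const_sub X).const_mul Υ) |>.fun_add
    ((hasDerivAt_travelTime ha hA).const_mul T)).congr_deriv (by ring)

theorem hasDerivAt_scalingDefect {a A : ℝ} (ha : 0 < a) (hA : 0 < A) (X Y T S Υ : ℝ) :
    HasDerivAt (scalingDefect a X Y T S Υ) (scalingDefectDeriv a T S Υ A) A :=
  (((((hasDerivAt_travelTime ha hA).const_mul T).const_add _).const_mul _).fun_add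
    (((hasDerivAt_id A).const_mul T).fun_mul (hasDerivAt_travelTimeDeriv ha hA)) |>.fun_add
    ((hasDerivAt_id A).const_mul ((S + Υ) / 2))).congr_deriv (by
      simp only [scalingDefectDeriv, id]
      ring)

theorem scalingDefect_eq (a X Y T S Υ A : ℝ) :
    scalingDefect a X Y T S Υ A = A * (-S - Υ + T * travelTimeDeriv a A)
      - 3 / 2 * cubicPhase a X Y T S Υ A := by
  rw [scalingDefect, cubicPhase]
  ring

/-- The oscillating factor of the `N`-th reflected wave. -/
noncomputable def oscFactor (ℓ : ℝ → ℝ) (lam a X Y T : ℝ) (N : ℤ) (v : ℝ × ℝ × ℝ × ℝ) : ℂ :=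
  Complex.exp (I * ((lam * v.2.2.2 * cubicPhase a X Y T v.1 v.2.1 v.2.2.1
    - N * ℓ (lam * v.2.2.2 * v.2.2.1 ^ ((3 : ℝ) / 2)) : ℝ) : ℂ))

theorem integral_oscFactor (ℓ ζ : ℝ → ℝ) (lam a X Y T S Υ : ℝ) {A : ℝ} (hA : 0 < A) (y : ℝ)
    (N : ℤ) :
    ∫ η : ℝ, oscFactor ℓ lam a X Y T N (S, Υ, A, η) * ((y * ζ η : ℝ) : ℂ)
      = y * phaseIntegral ℓ ζ (lam * A ^ ((3 : ℝ) / 2))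
        (cubicPhase a X Y T S Υ A / A ^ ((3 : ℝ) / 2)) N := by
  rw [phaseIntegral, ← integral_const_mul]
  have hr : 0 < A ^ ((3 : ℝ) / 2) := Real.rpow_pos_of_pos hA _
  refine integral_congr_ae (Eventually.of_forall fun η => ?_)
  simp only [oscFactor]
  have e1 : lam * A ^ ((3 : ℝ) / 2) * η * (cubicPhase a X Y T S Υ A / A ^ ((3 : ℝ) / 2))
      = lam * η * cubicPhase a X Y T S Υ A := by field_simp
  have e2 : lam * A ^ ((3 : ℝ) / 2) * η = lam * η * A ^ ((3 : ℝ) / 2) := by ring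
  rw [e1, e2]
  push_cast
  ring

/-- The box containing the support of all the amplitudes. -/
def amplitudeBox : Set (ℝ × ℝ × ℝ × ℝ) :=
  Set.Icc (-3) 3 ×ˢ Set.Icc (-3) 3 ×ˢ Set.Icc (9 / 10) 6 ×ˢ Set.Icc (1 / 2) (3 / 2)

theorem isCompact_amplitudeBox : IsCompact amplitudeBox :=
  isCompact_Icc.prod (isCompact_Icc.prod (isCompact_Icc.prod isCompact_Icc))

theorem mem_amplitudeBox_pos {z : ℝ × ℝ × ℝ × ℝ} (hz : z ∈ amplitudeBox) :
    0 < z.2.2.1 ∧ 0 < z.2.2.2 :=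
  ⟨by linarith [hz.2.2.1.1], by linarith [hz.2.2.2.1]⟩

theorem hasLineDerivAt_first {F : Type*} [NormedAddCommGroup F] [NormedSpace ℝ F]
    {f : ℝ × ℝ × ℝ × ℝ → F} {f' : F} {z : ℝ × ℝ × ℝ × ℝ}
    (h : HasDerivAt (fun t => f (t, z.2)) f' z.1) : HasLineDerivAt ℝ f f' z (1, 0, 0, 0) := by
  have h2 : HasDerivAt (fun t => f (z.1 + t, z.2)) f' 0 :=
    HasDerivAt.comp_const_add z.1 0 (by simpa using h)
  refine h2.congr_of_eventuallyEq (Eventually.of_forall fun t => ?_)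
  exact congrArg f (by ext <;> simp)

theorem hasLineDerivAt_second {F : Type*} [NormedAddCommGroup F] [NormedSpace ℝ F]
    {f : ℝ × ℝ × ℝ × ℝ → F} {f' : F} {z : ℝ × ℝ × ℝ × ℝ}
    (h : HasDerivAt (fun t => f (z.1, t, z.2.2)) f' z.2.1) :
    HasLineDerivAt ℝ f f' z (0, 1, 0, 0) := by
  have h2 : HasDerivAt (fun t => f (z.1, z.2.1 + t, z.2.2)) f' 0 :=
    HasDerivAt.comp_const_add z.2.1 0 (by simpa using h)
  refine h2.congr_of_eventuallyEq (Eventually.of_forall fun t => ?_)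
  exact congrArg f (by ext <;> simp)

theorem hasLineDerivAt_third {F : Type*} [NormedAddCommGroup F] [NormedSpace ℝ F]
    {f : ℝ × ℝ × ℝ × ℝ → F} {f' : F} {z : ℝ × ℝ × ℝ × ℝ}
    (h : HasDerivAt (fun t => f (z.1, z.2.1, t, z.2.2.2)) f' z.2.2.1) :
    HasLineDerivAt ℝ f f' z (0, 0, 1, 0) := by
  have h2 : HasDerivAt (fun t => f (z.1, z.2.1, z.2.2.1 + t, z.2.2.2)) f' 0 :=
    HasDerivAt.comp_const_add z.2.2.1 0 (by simpa using h)
  refine h2.congr_of_eventuallyEq (Eventually.of_forall fun t => ?_)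
  exact congrArg f (by ext <;> simp)

theorem hasLineDerivAt_fourth {F : Type*} [NormedAddCommGroup F] [NormedSpace ℝ F]
    {f : ℝ × ℝ × ℝ × ℝ → F} {f' : F} {z : ℝ × ℝ × ℝ × ℝ}
    (h : HasDerivAt (fun t => f (z.1, z.2.1, z.2.2.1, t)) f' z.2.2.2) :
    HasLineDerivAt ℝ f f' z (0, 0, 0, 1) := by
  have h2 : HasDerivAt (fun t => f (z.1, z.2.1, z.2.2.1, z.2.2.2 + t)) f' 0 :=
    HasDerivAt.comp_const_add z.2.2.2 0 (by simpa using h)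
  refine h2.congr_of_eventuallyEq (Eventually.of_forall fun t => ?_)
  exact congrArg f (by ext <;> simp)

theorem HasDerivAt.exp_I_mul {f : ℝ → ℝ} {f' x : ℝ} (hf : HasDerivAt f f' x) :
    HasDerivAt (fun t => Complex.exp (I * (f t : ℂ))) (I * (f' : ℂ) * Complex.exp (I * (f x : ℂ)))
      x :=
  ((hf.ofReal_comp.const_mul I).cexp).congr_deriv (by ring)

theorem continuousOn_travelTime (a : ℝ) (ha : 0 < a) : ContinuousOn (travelTime a) (Set.Ioi 0) :=
  fun _ hA => (hasDerivAt_travelTime ha hA).continuousAt.continuousWithinAt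

theorem continuousOn_travelTimeDeriv (a : ℝ) (ha : 0 < a) :
    ContinuousOn (travelTimeDeriv a) (Set.Ioi 0) :=
  fun _ hA => (hasDerivAt_travelTimeDeriv ha hA).continuousAt.continuousWithinAt

theorem continuousOn_travelTimeDeriv₂ (a : ℝ) (ha : 0 < a) :
    ContinuousOn (travelTimeDeriv₂ a) (Set.Ioi 0) := by
  have : ∀ A ∈ Set.Ioi (0 : ℝ), 4 * √(1 + a * A) ^ 3 ≠ 0 := fun A hA => by
    have hA' : 0 < A := hA
    have h2 : 0 < √(1 + a * A) := Real.sqrt_pos.2 (by positivity)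
    positivity
  exact (ContinuousOn.div (by fun_prop) (by fun_prop) this).neg

section Box

variable {a : ℝ} (ha : 0 < a) (X Y T : ℝ)
include ha

theorem continuousOn_travelTime_box :
    ContinuousOn (fun z : ℝ × ℝ × ℝ × ℝ => travelTime a z.2.2.1) amplitudeBox :=
  (continuousOn_travelTime a ha).comp (by fun_prop) fun _ hz => (mem_amplitudeBox_pos hz).1

theorem continuousOn_travelTimeDeriv_box :
    ContinuousOn (fun z : ℝ × ℝ × ℝ × ℝ => travelTimeDeriv a z.2.2.1) amplitudeBox :=
  (continuousOn_travelTimeDeriv a ha).comp (by fun_prop) fun _ hz => (mem_amplitudeBox_pos hz).1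

theorem continuousOn_travelTimeDeriv₂_box :
    ContinuousOn (fun z : ℝ × ℝ × ℝ × ℝ => travelTimeDeriv₂ a z.2.2.1) amplitudeBox :=
  (continuousOn_travelTimeDeriv₂ a ha).comp (by fun_prop) fun _ hz => (mem_amplitudeBox_pos hz).1

theorem continuousOn_cubicPhase_box :
    ContinuousOn (fun z : ℝ × ℝ × ℝ × ℝ => cubicPhase a X Y T z.1 z.2.1 z.2.2.1) amplitudeBox := by
  have := continuousOn_travelTime_box ha
  unfold cubicPhase
  fun_prop

theorem continuousOn_scalingDefect_box :
    ContinuousOn (fun z : ℝ × ℝ × ℝ × ℝ => scalingDefect a X Y T z.1 z.2.1 z.2.2.1)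
      amplitudeBox := by
  have := continuousOn_travelTime_box ha
  have := continuousOn_travelTimeDeriv_box ha
  unfold scalingDefect
  fun_prop

theorem continuousOn_scalingDefectDeriv_box :
    ContinuousOn (fun z : ℝ × ℝ × ℝ × ℝ => scalingDefectDeriv a T z.1 z.2.1 z.2.2.1)
      amplitudeBox := by
  have := continuousOn_travelTimeDeriv₂_box ha
  have := continuousOn_travelTimeDeriv_box ha
  unfold scalingDefectDeriv
  fun_prop

end Box

section Osc

variable {ℓ q q₁ q₂ : ℝ → ℝ} {g c C : ℝ} (hℓ : IsAlmostLinearPhase ℓ q q₁ q₂ g c C)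
  {lam a : ℝ} (hlam : 0 < lam) (ha : 0 < a) (X Y T : ℝ) (N : ℤ)

theorem continuousOn_comp_scale {lam : ℝ} (hlam : 0 < lam) {f : ℝ → ℝ}
    (hf : ContinuousOn f (Set.Ioi 0)) :
    ContinuousOn (fun z : ℝ × ℝ × ℝ × ℝ => f (lam * z.2.2.2 * z.2.2.1 ^ ((3 : ℝ) / 2)))
      amplitudeBox := by
  refine hf.comp ?_ fun z hz => ?_
  · have : Continuous fun z : ℝ × ℝ × ℝ × ℝ => z.2.2.1 ^ ((3 : ℝ) / 2) :=
      Continuous.rpow_const (by fun_prop) fun _ => Or.inr (by norm_num)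
    fun_prop
  · obtain ⟨h1, h2⟩ := mem_amplitudeBox_pos hz
    exact mul_pos (mul_pos hlam h2) (Real.rpow_pos_of_pos h1 _)

theorem hasLineDerivAt_oscFactor_first (z : ℝ × ℝ × ℝ × ℝ) :
    HasLineDerivAt ℝ (oscFactor ℓ lam a X Y T N)
      (I * ((lam * z.2.2.2 * (z.1 ^ 2 - (z.2.2.1 - 1)) : ℝ) : ℂ) * oscFactor ℓ lam a X Y T N z) z
      (1, 0, 0, 0) := by
  refine hasLineDerivAt_first (HasDerivAt.exp_I_mul ?_)
  have h1 : HasDerivAt (fun t : ℝ => cubicPhase a X Y T t z.2.1 z.2.2.1)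
      (z.1 ^ 2 - (z.2.2.1 - 1)) z.1 :=
    (((((((hasDerivAt_id z.1).fun_pow 3).div_const 3).const_add Y).fun_add
      ((hasDerivAt_id z.1).mul_const (1 - z.2.2.1))).add_const _).add_const _
      |>.add_const _).congr_deriv (by simp only [id]; push_cast; ring)
  exact (h1.const_mul (lam * z.2.2.2)).sub_const
    (N * ℓ (lam * z.2.2.2 * z.2.2.1 ^ ((3 : ℝ) / 2)))

theorem hasLineDerivAt_oscFactor_second (z : ℝ × ℝ × ℝ × ℝ) :
    HasLineDerivAt ℝ (oscFactor ℓ lam a X Y T N)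
      (I * ((lam * z.2.2.2 * (z.2.1 ^ 2 - (z.2.2.1 - X)) : ℝ) : ℂ)
        * oscFactor ℓ lam a X Y T N z) z (0, 1, 0, 0) := by
  refine hasLineDerivAt_second (HasDerivAt.exp_I_mul ?_)
  have h1 : HasDerivAt (fun t => cubicPhase a X Y T z.1 t z.2.2.1)
      (z.2.1 ^ 2 - (z.2.2.1 - X)) z.2.1 :=
    (((((hasDerivAt_id z.2.1).fun_pow 3).div_const 3).const_add _).fun_add
      ((hasDerivAt_id z.2.1).mul_const (X - z.2.2.1)) |>.add_const _).congr_deriv (by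
        simp only [id]; push_cast; ring)
  exact (h1.const_mul (lam * z.2.2.2)).sub_const
    (N * ℓ (lam * z.2.2.2 * z.2.2.1 ^ ((3 : ℝ) / 2)))

include hℓ hlam

theorem hasLineDerivAt_oscFactor_fourth {z : ℝ × ℝ × ℝ × ℝ} (hz : z ∈ amplitudeBox) :
    HasLineDerivAt ℝ (oscFactor ℓ lam a X Y T N)
      (I * ((lam * cubicPhase a X Y T z.1 z.2.1 z.2.2.1
        - N * (q (lam * z.2.2.2 * z.2.2.1 ^ ((3 : ℝ) / 2)) *
          (lam * z.2.2.1 ^ ((3 : ℝ) / 2))) : ℝ) : ℂ)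
        * oscFactor ℓ lam a X Y T N z) z (0, 0, 0, 1) := by
  obtain ⟨hA, hη⟩ := mem_amplitudeBox_pos hz
  refine hasLineDerivAt_fourth (HasDerivAt.exp_I_mul ?_)
  have h0 : HasDerivAt (fun t : ℝ => lam * t) lam z.2.2.2 := by
    simpa using (hasDerivAt_id z.2.2.2).const_mul lam
  have h1 := h0.mul_const (cubicPhase a X Y T z.1 z.2.1 z.2.2.1)
  have h2 := h0.mul_const (z.2.2.1 ^ ((3 : ℝ) / 2))
  exact h1.fun_sub (((hℓ.deriv_zero _ (mul_pos (mul_pos hlam hη)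
    (Real.rpow_pos_of_pos hA ((3 : ℝ) / 2)))).comp z.2.2.2 h2).const_mul (N : ℝ))

include ha

theorem continuousOn_oscFactor : ContinuousOn (oscFactor ℓ lam a X Y T N) amplitudeBox := by
  have h1 := continuousOn_cubicPhase_box ha X Y T
  have h2 := continuousOn_comp_scale hlam
    (fun u hu => (hℓ.deriv_zero u hu).continuousAt.continuousWithinAt : ContinuousOn ℓ (Set.Ioi 0))
  refine Continuous.comp_continuousOn' (g := fun r : ℝ => Complex.exp (I * (r : ℂ)))
      (by fun_prop) ?_
  exact (ContinuousOn.mul (by fun_prop) h1).sub (continuousOn_const.mul h2)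

theorem hasLineDerivAt_oscFactor_third {z : ℝ × ℝ × ℝ × ℝ} (hz : z ∈ amplitudeBox) :
    HasLineDerivAt ℝ (oscFactor ℓ lam a X Y T N)
      (I * ((lam * z.2.2.2 * (-z.1 - z.2.1 + T * travelTimeDeriv a z.2.2.1)
        - N * (q (lam * z.2.2.2 * z.2.2.1 ^ ((3 : ℝ) / 2)) *
          (lam * z.2.2.2 * (3 / 2 * z.2.2.1 ^ ((1 : ℝ) / 2)))) : ℝ) : ℂ)
        * oscFactor ℓ lam a X Y T N z) z (0, 0, 1, 0) := by
  obtain ⟨hA, hη⟩ := mem_amplitudeBox_pos hz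
  refine hasLineDerivAt_third (HasDerivAt.exp_I_mul ?_)
  have h1 := (hasDerivAt_cubicPhase ha hA X Y T z.1 z.2.1).const_mul (lam * z.2.2.2)
  have h2 : HasDerivAt (fun t : ℝ => lam * z.2.2.2 * t ^ ((3 : ℝ) / 2))
      (lam * z.2.2.2 * (3 / 2 * z.2.2.1 ^ ((1 : ℝ) / 2))) z.2.2.1 :=
    ((Real.hasDerivAt_rpow_const (p := 3 / 2) (Or.inl hA.ne')).const_mul _).congr_deriv (by
      norm_num)
  exact h1.fun_sub (((hℓ.deriv_zero _ (mul_pos (mul_pos hlam hη)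
    (Real.rpow_pos_of_pos hA _))).comp z.2.2.1 h2).const_mul (N : ℝ))

end Osc

/-- Smooth functions supported in the range of the frequency variable. -/
structure IsFrequencyCutoff (ζ : ℝ → ℝ) : Prop where
  smooth : ContDiff ℝ (⊤ : ℕ∞) ζ
  support : tsupport ζ ⊆ Set.Icc (1 / 2) (3 / 2)

/-- Smooth functions supported in the range of the two phase variables. -/
structure IsSpaceCutoff (χ : ℝ × ℝ → ℝ) : Prop where
  smooth : ContDiff ℝ (⊤ : ℕ∞) χ
  support : tsupport χ ⊆ {p : ℝ × ℝ | |p.1| < 3 ∧ |p.2| < 3}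

namespace IsFrequencyCutoff

theorem eq_zero {ζ : ℝ → ℝ} (h : IsFrequencyCutoff ζ) {x : ℝ}
    (hx : x ∉ Set.Icc (1 / 2 : ℝ) (3 / 2)) :
    ζ x = 0 :=
  image_eq_zero_of_notMem_tsupport fun h' => hx (h.support h')

theorem div_id {ζ : ℝ → ℝ} (h : IsFrequencyCutoff ζ) : IsFrequencyCutoff fun x => ζ x / x := by
  refine ⟨contDiff_iff_contDiffAt.2 fun x => ?_, (closure_mono fun x hx => ?_).trans h.support⟩
  · by_cases hx : x = 0
    · have h0 : (0 : ℝ) ∉ tsupport ζ := fun h' => by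
        have := (h.support h').1
        norm_num at this
      rw [notMem_tsupport_iff_eventuallyEq] at h0
      rw [hx]
      refine (contDiffAt_const (c := (0 : ℝ))).congr_of_eventuallyEq ?_
      filter_upwards [h0] with y hy
      simp [hy]
    · exact h.smooth.contDiffAt.div contDiffAt_id hx
  · intro h0
    exact hx (by simp [h0])

theorem deriv {ζ : ℝ → ℝ} (h : IsFrequencyCutoff ζ) : IsFrequencyCutoff (deriv ζ) :=
  ⟨h.smooth.iterate_deriv 1, (tsupport_deriv_subset (𝕜 := ℝ)).trans h.support⟩

end IsFrequencyCutoff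

namespace IsSpaceCutoff

theorem eq_zero {χ : ℝ × ℝ → ℝ} (h : IsSpaceCutoff χ) {x y : ℝ}
    (hx : ¬(x ∈ Set.Icc (-3 : ℝ) 3 ∧ y ∈ Set.Icc (-3 : ℝ) 3)) : χ (x, y) = 0 :=
  image_eq_zero_of_notMem_tsupport fun h' => hx
    ⟨abs_le.1 (h.support h').1.le, abs_le.1 (h.support h').2.le⟩

theorem fderiv_apply {χ : ℝ × ℝ → ℝ} (h : IsSpaceCutoff χ) (v : ℝ × ℝ) :
    IsSpaceCutoff fun p => fderiv ℝ χ p v :=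
  ⟨(h.smooth.fderiv_right (m := (⊤ : ℕ∞)) (by norm_cast)).clm_apply contDiff_const,
    (tsupport_fderiv_apply_subset ℝ v).trans h.support⟩

theorem hasDerivAt_fst {χ : ℝ × ℝ → ℝ} (h : IsSpaceCutoff χ) (x y : ℝ) :
    HasDerivAt (fun t => χ (t, y)) (fderiv ℝ χ (x, y) (1, 0)) x :=
  ((h.smooth.differentiable (by simp)) (x, y)).hasFDerivAt.comp_hasDerivAt x
    ((hasDerivAt_id x).prodMk (hasDerivAt_const x y))

theorem hasDerivAt_snd {χ : ℝ × ℝ → ℝ} (h : IsSpaceCutoff χ) (x y : ℝ) :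
    HasDerivAt (fun t => χ (x, t)) (fderiv ℝ χ (x, y) (0, 1)) y :=
  ((h.smooth.differentiable (by simp)) (x, y)).hasFDerivAt.comp_hasDerivAt y
    ((hasDerivAt_const y x).prodMk (hasDerivAt_id y))

theorem exists_bound {χ : ℝ × ℝ → ℝ} (h : IsSpaceCutoff χ) : ∃ M > 0, ∀ p, |χ p| ≤ M := by
  have hc : HasCompactSupport χ := by
    refine ((isCompact_Icc (a := (-3 : ℝ)) (b := 3)).prod
        (isCompact_Icc (a := (-3 : ℝ)) (b := 3))).of_isClosed_subset
      (isClosed_tsupport χ) fun p hp => ?_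
    exact ⟨abs_le.1 (h.support hp).1.le, abs_le.1 (h.support hp).2.le⟩
  obtain ⟨M, hM⟩ := hc.exists_bound_of_continuous h.smooth.continuous
  exact ⟨max M 1, by positivity, fun p => (hM p).trans (le_max_left _ _)⟩

end IsSpaceCutoff

/-- The size of the amplitudes created by integrating by parts against a phase with derivative
`m³ (s² - c)`. -/
noncomputable def cuspWeight (m s c : ℝ) : ℝ :=
    (1 + m * |s|) / (1 + m ^ 4 * (s ^ 2 - c) ^ 2) + 1 / m

/-- Amplitudes of size `cuspWeight`, with a loss of `m²` for each derivative in `c`. -/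
structure IsCuspAmplitude (m : ℝ) (f f' : ℝ → ℝ → ℝ) : Prop where
  cont : Continuous fun z : ℝ × ℝ => f z.1 z.2
  cont' : Continuous fun z : ℝ × ℝ => f' z.1 z.2
  hasDerivAt : ∀ s c, HasDerivAt (f s) (f' s c) c
  bound : ∀ s c, |f s c| ≤ 6 * cuspWeight m s c
  bound' : ∀ s c, |f' s c| ≤ 6 * m ^ 2 * cuspWeight m s c

section Amplitudes

variable {m : ℝ}

theorem cuspWeight_nonneg (hm : 0 < m) (s c : ℝ) : 0 ≤ cuspWeight m s c := by
  unfold cuspWeight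
  positivity

theorem isCuspAmplitude_one (hm : 1 ≤ m) : IsCuspAmplitude m
    (fun s c => 1 / (1 + m ^ 4 * (s ^ 2 - c) ^ 2))
    (fun s c => 2 * m ^ 4 * (s ^ 2 - c) / (1 + m ^ 4 * (s ^ 2 - c) ^ 2) ^ 2) where
  cont := Continuous.div (by fun_prop) (by fun_prop) fun z => by positivity
  cont' := Continuous.div (by fun_prop) (by fun_prop) fun z => by positivity
  hasDerivAt s c := by
    have hD : 1 + m ^ 4 * (s ^ 2 - c) ^ 2 ≠ 0 := by positivity
    exact ((hasDerivAt_const c (1 : ℝ)).fun_div ((((((hasDerivAt_id c).const_sub (s ^ 2)).fun_pow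
      2).const_mul (m ^ 4)).const_add 1)) hD).congr_deriv (by simp only [id]; push_cast; ring)
  bound s c := by
    have hD : 0 < 1 + m ^ 4 * (s ^ 2 - c) ^ 2 := by positivity
    rw [abs_of_nonneg (by positivity), cuspWeight]
    have h1 : 1 / (1 + m ^ 4 * (s ^ 2 - c) ^ 2) ≤
        (1 + m * |s|) / (1 + m ^ 4 * (s ^ 2 - c) ^ 2) := by
      gcongr
      linarith [show 0 ≤ m * |s| by positivity]
    have h2 : 0 ≤ 1 / m := by positivity
    have h3 : 0 ≤ (1 + m * |s|) / (1 + m ^ 4 * (s ^ 2 - c) ^ 2) := by positivity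
    linarith
  bound' s c := by
    set p := s ^ 2 - c
    have hD : 0 < 1 + m ^ 4 * p ^ 2 := by positivity
    have h0 : |2 * m ^ 4 * p / (1 + m ^ 4 * p ^ 2) ^ 2| ≤ m ^ 2 * (1 / (1 + m ^ 4 * p ^ 2)) := by
      rw [abs_div, abs_of_pos (pow_pos hD 2), div_le_iff₀ (pow_pos hD 2)]
      have e : m ^ 2 * (1 / (1 + m ^ 4 * p ^ 2)) * (1 + m ^ 4 * p ^ 2) ^ 2
        = m ^ 2 * (1 + m ^ 4 * p ^ 2) := by field_simp
      rw [e, abs_le]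
      constructor <;> nlinarith [sq_nonneg (m ^ 3 * p - m), sq_nonneg (m ^ 3 * p + m)]
    refine h0.trans ?_
    have h1 : 1 / (1 + m ^ 4 * p ^ 2) ≤ cuspWeight m s c := by
      rw [cuspWeight]
      have h1 : 1 / (1 + m ^ 4 * p ^ 2) ≤ (1 + m * |s|) / (1 + m ^ 4 * p ^ 2) := by
        gcongr
        linarith [show 0 ≤ m * |s| by positivity]
      have h2 : 0 ≤ 1 / m := by positivity
      linarith
    have h2 := cuspWeight_nonneg (by linarith) s c (m := m)
    nlinarith [mul_le_mul_of_nonneg_left h1 (sq_nonneg m), mul_nonneg (sq_nonneg m) h2]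

theorem isCuspAmplitude_two (hm : 1 ≤ m) : IsCuspAmplitude m
    (fun s c => 2 * s * m * (1 - m ^ 4 * (s ^ 2 - c) ^ 2) / (1 + m ^ 4 * (s ^ 2 - c) ^ 2) ^ 2)
    (fun s c => 2 * s * m * (2 * m ^ 4 * (s ^ 2 - c) * (3 - m ^ 4 * (s ^ 2 - c) ^ 2))
      / (1 + m ^ 4 * (s ^ 2 - c) ^ 2) ^ 3) where
  cont := Continuous.div (by fun_prop) (by fun_prop) fun z => by positivity
  cont' := Continuous.div (by fun_prop) (by fun_prop) fun z => by positivity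
  hasDerivAt s c := by
    have hD : 1 + m ^ 4 * (s ^ 2 - c) ^ 2 ≠ 0 := by positivity
    have h1 : HasDerivAt (fun c => m ^ 4 * (s ^ 2 - c) ^ 2) (-(2 * m ^ 4 * (s ^ 2 - c))) c :=
      ((((hasDerivAt_id c).const_sub (s ^ 2)).fun_pow 2).const_mul (m ^ 4)).congr_deriv (by
        simp only [id]; push_cast; ring)
    exact (((h1.const_sub 1).const_mul (2 * s * m)).fun_div ((h1.const_add 1).fun_pow 2)
      (pow_ne_zero 2 hD)).congr_deriv (by
        push_cast; field_simp; ring)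
  bound s c := by
    set p := s ^ 2 - c with hp
    have hD : 0 < 1 + m ^ 4 * p ^ 2 := by positivity
    have h0 : |2 * s * m * (1 - m ^ 4 * p ^ 2) / (1 + m ^ 4 * p ^ 2) ^ 2|
        ≤ 2 * (m * |s|) / (1 + m ^ 4 * p ^ 2) := by
      rw [abs_div, abs_of_pos (pow_pos hD 2), div_le_div_iff₀ (pow_pos hD 2) hD, abs_mul, abs_mul,
        abs_mul, abs_of_pos (by linarith : 0 < m), abs_two]
      have h1 : |1 - m ^ 4 * p ^ 2| ≤ 1 + m ^ 4 * p ^ 2 := by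
        rw [abs_le]
        constructor <;> nlinarith [show 0 ≤ m ^ 4 * p ^ 2 by positivity]
      have := mul_le_mul_of_nonneg_left h1 (by positivity : 0 ≤ 2 * (m * |s|) * (1 + m ^ 4 * p ^ 2))
      nlinarith
    refine h0.trans ?_
    rw [cuspWeight, ← hp]
    have h1 : 2 * (m * |s|) / (1 + m ^ 4 * p ^ 2) ≤ 2 * ((1 + m * |s|) / (1 + m ^ 4 * p ^ 2)) := by
      rw [mul_div_assoc]
      gcongr
      linarith
    have h2 : 0 ≤ 1 / m := by positivity
    have h3 : 0 ≤ (1 + m * |s|) / (1 + m ^ 4 * p ^ 2) := by positivity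
    linarith
  bound' s c := by
    set p := s ^ 2 - c with hp
    have hD : 0 < 1 + m ^ 4 * p ^ 2 := by positivity
    have h0 : |2 * s * m * (2 * m ^ 4 * p * (3 - m ^ 4 * p ^ 2)) / (1 + m ^ 4 * p ^ 2) ^ 3|
        ≤ 6 * m ^ 2 * (m * |s| / (1 + m ^ 4 * p ^ 2)) := by
      have e : 6 * m ^ 2 * (m * |s| / (1 + m ^ 4 * p ^ 2))
        = (2 * |s| * m) * ((m ^ 2 * (1 + m ^ 4 * p ^ 2)) * (3 * (1 + m ^ 4 * p ^ 2)))
          / (1 + m ^ 4 * p ^ 2) ^ 3 := by field_simp; ring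
      rw [abs_div, abs_of_pos (pow_pos hD 3), e, abs_mul, abs_mul, abs_mul, abs_mul (2 * m ^ 4 * p),
        abs_of_pos (by linarith : 0 < m), abs_two]
      have h1 : |3 - m ^ 4 * p ^ 2| ≤ 3 * (1 + m ^ 4 * p ^ 2) := by
        rw [abs_le]
        constructor <;> nlinarith [show 0 ≤ m ^ 4 * p ^ 2 by positivity]
      have h2 : |2 * m ^ 4 * p| ≤ m ^ 2 * (1 + m ^ 4 * p ^ 2) := by
        rw [abs_le]
        constructor <;> nlinarith [sq_nonneg (m ^ 3 * p - m), sq_nonneg (m ^ 3 * p + m)]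
      gcongr
    refine h0.trans ?_
    refine mul_le_mul_of_nonneg_left ?_ (by positivity)
    rw [cuspWeight, ← hp]
    have h1 : (m * |s|) / (1 + m ^ 4 * p ^ 2) ≤ (1 + m * |s|) / (1 + m ^ 4 * p ^ 2) := by
      gcongr
      linarith
    have h2 : 0 ≤ 1 / m := by positivity
    linarith

theorem isCuspAmplitude_three (hm : 1 ≤ m) : IsCuspAmplitude m
    (fun s c => m * (s ^ 2 - c) / (1 + m ^ 4 * (s ^ 2 - c) ^ 2))
    (fun s c => -(m * (1 - m ^ 4 * (s ^ 2 - c) ^ 2)) / (1 + m ^ 4 * (s ^ 2 - c) ^ 2) ^ 2) where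
  cont := Continuous.div (by fun_prop) (by fun_prop) fun z => by positivity
  cont' := Continuous.div (by fun_prop) (by fun_prop) fun z => by positivity
  hasDerivAt s c := by
    have hD : 1 + m ^ 4 * (s ^ 2 - c) ^ 2 ≠ 0 := by positivity
    have h0 := (hasDerivAt_id c).const_sub (s ^ 2)
    exact ((h0.const_mul m).fun_div (((h0.fun_pow 2).const_mul (m ^ 4)).const_add 1)
      hD).congr_deriv (by simp only [id]; push_cast; ring)
  bound s c := by
    set p := s ^ 2 - c with hp
    have hD : 0 < 1 + m ^ 4 * p ^ 2 := by positivity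
    have hm0 : 0 < m := by linarith
    have h0 : |m * p / (1 + m ^ 4 * p ^ 2)| ≤ 1 / m := by
      rw [abs_div, abs_of_pos hD, div_le_div_iff₀ hD hm0, ← abs_of_pos hm0, ← abs_mul,
        abs_of_pos hm0, abs_le]
      constructor <;> nlinarith [sq_nonneg (m ^ 2 * p - 1), sq_nonneg (m ^ 2 * p + 1)]
    have h3 : 0 ≤ (1 + m * |s|) / (1 + m ^ 4 * p ^ 2) := by positivity
    have h4 : 0 ≤ 1 / m := by positivity
    rw [cuspWeight, ← hp]
    linarith
  bound' s c := by
    set p := s ^ 2 - c with hp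
    have hD : 0 < 1 + m ^ 4 * p ^ 2 := by positivity
    have h0 : |-(m * (1 - m ^ 4 * p ^ 2)) / (1 + m ^ 4 * p ^ 2) ^ 2|
        ≤ m ^ 2 * ((1 + m * |s|) / (1 + m ^ 4 * p ^ 2)) := by
      have e : m ^ 2 * ((1 + m * |s|) / (1 + m ^ 4 * p ^ 2))
        = m ^ 2 * (1 + m * |s|) * (1 + m ^ 4 * p ^ 2) / (1 + m ^ 4 * p ^ 2) ^ 2 := by field_simp
      rw [abs_div, abs_of_pos (pow_pos hD 2), e, abs_neg, abs_mul, abs_of_pos (by linarith : 0 < m)]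
      have h1 : |1 - m ^ 4 * p ^ 2| ≤ 1 + m ^ 4 * p ^ 2 := by
        rw [abs_le]
        constructor <;> nlinarith [show 0 ≤ m ^ 4 * p ^ 2 by positivity]
      have h2 : m ≤ m ^ 2 * (1 + m * |s|) := by
        nlinarith [show 0 ≤ m ^ 2 * (m * |s|) by positivity]
      gcongr
    refine h0.trans ?_
    rw [cuspWeight, ← hp]
    have h3 : 0 ≤ (1 + m * |s|) / (1 + m ^ 4 * p ^ 2) := by positivity
    have h4 : 0 ≤ 1 / m := by positivity
    nlinarith [mul_nonneg (sq_nonneg m) h3, mul_nonneg (sq_nonneg m) h4]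

end Amplitudes

theorem isAddHaarMeasure_volume_real_prod :
    (volume : Measure (ℝ × ℝ × ℝ × ℝ)).IsAddHaarMeasure := by
  have h2 : (volume : Measure (ℝ × ℝ)).IsAddHaarMeasure := by
    rw [Measure.volume_eq_prod]
    infer_instance
  have h3 : (volume : Measure (ℝ × ℝ × ℝ)).IsAddHaarMeasure := by
    rw [Measure.volume_eq_prod]
    infer_instance
  rw [Measure.volume_eq_prod]
  infer_instance

/-- The amplitude `f(S, A - 1) g(Υ, A - X) χ(S, Υ) ψ₃(A)`. -/
noncomputable def waveAmplitude (X : ℝ) (f g : ℝ → ℝ → ℝ) (χ : ℝ × ℝ → ℝ) (ψ₃ : ℝ → ℝ)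
    (z : ℝ × ℝ × ℝ × ℝ) : ℝ :=
  f z.1 (z.2.2.1 - 1) * g z.2.1 (z.2.2.1 - X) * χ (z.1, z.2.1) * ψ₃ z.2.2.1

noncomputable def waveIntegral (ℓ : ℝ → ℝ) (lam a X Y T : ℝ) (f g : ℝ → ℝ → ℝ) (χ : ℝ × ℝ → ℝ)
    (ψ₃ ζ : ℝ → ℝ) (N : ℤ) : ℂ :=
  ∫ z : ℝ × ℝ × ℝ × ℝ, oscFactor ℓ lam a X Y T N z
    * ((waveAmplitude X f g χ ψ₃ z * ζ z.2.2.2 : ℝ) : ℂ)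

theorem waveAmplitude_mul_eq_zero {X : ℝ} {f g : ℝ → ℝ → ℝ} {χ : ℝ × ℝ → ℝ} {ψ₃ ζ : ℝ → ℝ}
    (hχ : IsSpaceCutoff χ) (hψ₃ : tsupport ψ₃ ⊆ Set.Icc (9 / 10) 6) (hζ : IsFrequencyCutoff ζ)
    {z : ℝ × ℝ × ℝ × ℝ} (hz : z ∉ amplitudeBox) : waveAmplitude X f g χ ψ₃ z * ζ z.2.2.2 = 0 := by
  unfold waveAmplitude
  by_cases h1 : z.1 ∈ Set.Icc (-3 : ℝ) 3 ∧ z.2.1 ∈ Set.Icc (-3 : ℝ) 3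
  · by_cases h2 : z.2.2.1 ∈ Set.Icc (9 / 10 : ℝ) 6
    · rw [hζ.eq_zero fun h3 => hz ⟨h1.1, h1.2, h2, h3⟩, mul_zero]
    · rw [image_eq_zero_of_notMem_tsupport fun h => h2 (hψ₃ h)]
      ring
  · rw [hχ.eq_zero h1]
    ring

theorem continuous_waveAmplitude {X : ℝ} {f g : ℝ → ℝ → ℝ} {χ : ℝ × ℝ → ℝ} {ψ₃ : ℝ → ℝ}
    (hf : Continuous fun z : ℝ × ℝ => f z.1 z.2) (hg : Continuous fun z : ℝ × ℝ => g z.1 z.2)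
    (hχ : Continuous χ) (hψ₃ : Continuous ψ₃) : Continuous (waveAmplitude X f g χ ψ₃) := by
  unfold waveAmplitude
  have h1 : Continuous fun z : ℝ × ℝ × ℝ × ℝ => f z.1 (z.2.2.1 - 1) :=
    hf.comp (by fun_prop : Continuous fun z : ℝ × ℝ × ℝ × ℝ => (z.1, z.2.2.1 - 1))
  have h2 : Continuous fun z : ℝ × ℝ × ℝ × ℝ => g z.2.1 (z.2.2.1 - X) :=
    hg.comp (by fun_prop : Continuous fun z : ℝ × ℝ × ℝ × ℝ => (z.2.1, z.2.2.1 - X))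
  fun_prop

section Parts

variable {ℓ q q₁ q₂ : ℝ → ℝ} {γ c C : ℝ} (hℓ : IsAlmostLinearPhase ℓ q q₁ q₂ γ c C)
  {m a : ℝ} (hm : 0 < m) (ha : 0 < a) (X Y T : ℝ) (N : ℤ) {χ : ℝ × ℝ → ℝ} {ψ₃ ζ : ℝ → ℝ}
  (hχ : IsSpaceCutoff χ) (hψ₃c : Continuous ψ₃) (hψ₃ : tsupport ψ₃ ⊆ Set.Icc (9 / 10) 6)
  (hζ : IsFrequencyCutoff ζ)
include hℓ hm ha hχ hψ₃c hψ₃ hζ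

theorem norm_waveIntegral_le_first {g : ℝ → ℝ → ℝ}
    (hg : Continuous fun z : ℝ × ℝ => g z.1 z.2) :
    ‖waveIntegral ℓ (m ^ 3) a X Y T (fun _ _ => 1) g χ ψ₃ ζ N‖
      ≤ ‖waveIntegral ℓ (m ^ 3) a X Y T (fun s c => 1 / (1 + m ^ 4 * (s ^ 2 - c) ^ 2)) g χ ψ₃ ζ N‖
      + ‖waveIntegral ℓ (m ^ 3) a X Y T (fun s c => m * (s ^ 2 - c) / (1 + m ^ 4 * (s ^ 2 - c) ^ 2))
          g (fun p => fderiv ℝ χ p (1, 0)) ψ₃ (fun x => ζ x / x) N‖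
      + ‖waveIntegral ℓ (m ^ 3) a X Y T
          (fun s c => 2 * s * m * (1 - m ^ 4 * (s ^ 2 - c) ^ 2) / (1 + m ^ 4 * (s ^ 2 - c) ^ 2) ^ 2)
          g χ ψ₃ (fun x => ζ x / x) N‖ := by
  have hχ' := hχ.fderiv_apply (1, 0)
  have hone : Continuous fun z : ℝ × ℝ => (fun _ _ : ℝ => (1 : ℝ)) z.1 z.2 := continuous_const
  have hζc := hζ.smooth.continuous
  have := isAddHaarMeasure_volume_real_prod
  have key := integral_eq_add_of_hasLineDerivAt (μ := (volume : Measure (ℝ × ℝ × ℝ × ℝ)))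
    (v := (1, 0, 0, 0)) hm isCompact_amplitudeBox
    (e := oscFactor ℓ (m ^ 3) a X Y T N) (w := fun z => z.2.2.2)
    (p := fun z => z.1 ^ 2 - (z.2.2.1 - 1)) (p' := fun z => 2 * z.1)
    (x := fun z => waveAmplitude X (fun _ _ => 1) g χ ψ₃ z * ζ z.2.2.2)
    (x' := fun z => waveAmplitude X (fun _ _ => 1) g (fun p => fderiv ℝ χ p (1, 0)) ψ₃ z
      * ζ z.2.2.2)
    (continuousOn_oscFactor hℓ (pow_pos hm 3) ha X Y T N) (by fun_prop)
    (fun z hz => (mem_amplitudeBox_pos hz).2.ne') (by fun_prop) (by fun_prop)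
    ((continuous_waveAmplitude hone hg hχ.smooth.continuous hψ₃c).mul
      (hζc.comp (by fun_prop))).continuousOn
    ((continuous_waveAmplitude hone hg hχ'.smooth.continuous hψ₃c).mul
      (hζc.comp (by fun_prop))).continuousOn
    (fun z hz => waveAmplitude_mul_eq_zero hχ hψ₃ hζ hz)
    (fun z hz => waveAmplitude_mul_eq_zero hχ' hψ₃ hζ hz)
    (fun z _ => hasLineDerivAt_first (hasDerivAt_const z.1 z.2.2.2))
    (fun z _ => hasLineDerivAt_oscFactor_first X Y T N z)
    (fun z _ => hasLineDerivAt_first (((hasDerivAt_id z.1).fun_pow 2).sub_const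
      (z.2.2.1 - 1) |>.congr_deriv (by simp [id])))
    (fun z _ => hasLineDerivAt_first ((((hχ.hasDerivAt_fst z.1 z.2.1).const_mul
      (1 * g z.2.1 (z.2.2.1 - X))).mul_const (ψ₃ z.2.2.1)).mul_const (ζ z.2.2.2)))
  unfold waveIntegral
  rw [key]
  refine (norm_add_le _ _).trans (add_le_add ((norm_add_le _ _).trans (add_le_add ?_ ?_)) ?_)
  · refine le_of_eq (congrArg norm (integral_congr_ae (Eventually.of_forall fun z => ?_)))
    simp only [waveAmplitude]
    congr 2
    ring
  · rw [norm_mul, norm_I, one_mul]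
    refine le_of_eq (congrArg norm (integral_congr_ae (Eventually.of_forall fun z => ?_)))
    simp only [waveAmplitude]
    congr 2
    ring
  · rw [norm_mul, norm_I, one_mul]
    refine le_of_eq (congrArg norm (integral_congr_ae (Eventually.of_forall fun z => ?_)))
    simp only [waveAmplitude]
    congr 2
    ring

theorem norm_waveIntegral_le_second {f : ℝ → ℝ → ℝ}
    (hf : Continuous fun z : ℝ × ℝ => f z.1 z.2) :
    ‖waveIntegral ℓ (m ^ 3) a X Y T f (fun _ _ => 1) χ ψ₃ ζ N‖
      ≤ ‖waveIntegral ℓ (m ^ 3) a X Y T f (fun s c => 1 / (1 + m ^ 4 * (s ^ 2 - c) ^ 2)) χ ψ₃ ζ N‖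
      + ‖waveIntegral ℓ (m ^ 3) a X Y T f
          (fun s c => m * (s ^ 2 - c) / (1 + m ^ 4 * (s ^ 2 - c) ^ 2))
          (fun p => fderiv ℝ χ p (0, 1)) ψ₃ (fun x => ζ x / x) N‖
      + ‖waveIntegral ℓ (m ^ 3) a X Y T f
          (fun s c => 2 * s * m * (1 - m ^ 4 * (s ^ 2 - c) ^ 2) / (1 + m ^ 4 * (s ^ 2 - c) ^ 2) ^ 2)
          χ ψ₃ (fun x => ζ x / x) N‖ := by
  have hχ' := hχ.fderiv_apply (0, 1)
  have hone : Continuous fun z : ℝ × ℝ => (fun _ _ : ℝ => (1 : ℝ)) z.1 z.2 := continuous_const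
  have hζc := hζ.smooth.continuous
  have := isAddHaarMeasure_volume_real_prod
  have key := integral_eq_add_of_hasLineDerivAt (μ := (volume : Measure (ℝ × ℝ × ℝ × ℝ)))
    (v := (0, 1, 0, 0)) hm isCompact_amplitudeBox
    (e := oscFactor ℓ (m ^ 3) a X Y T N) (w := fun z => z.2.2.2)
    (p := fun z => z.2.1 ^ 2 - (z.2.2.1 - X)) (p' := fun z => 2 * z.2.1)
    (x := fun z => waveAmplitude X f (fun _ _ => 1) χ ψ₃ z * ζ z.2.2.2)
    (x' := fun z => waveAmplitude X f (fun _ _ => 1) (fun p => fderiv ℝ χ p (0, 1)) ψ₃ z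
      * ζ z.2.2.2)
    (continuousOn_oscFactor hℓ (pow_pos hm 3) ha X Y T N) (by fun_prop)
    (fun z hz => (mem_amplitudeBox_pos hz).2.ne') (by fun_prop) (by fun_prop)
    ((continuous_waveAmplitude hf hone hχ.smooth.continuous hψ₃c).mul
      (hζc.comp (by fun_prop))).continuousOn
    ((continuous_waveAmplitude hf hone hχ'.smooth.continuous hψ₃c).mul
      (hζc.comp (by fun_prop))).continuousOn
    (fun z hz => waveAmplitude_mul_eq_zero hχ hψ₃ hζ hz)
    (fun z hz => waveAmplitude_mul_eq_zero hχ' hψ₃ hζ hz)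
    (fun z _ => hasLineDerivAt_second (hasDerivAt_const z.2.1 z.2.2.2))
    (fun z _ => hasLineDerivAt_oscFactor_second X Y T N z)
    (fun z _ => hasLineDerivAt_second (((hasDerivAt_id z.2.1).fun_pow 2).sub_const
      (z.2.2.1 - X) |>.congr_deriv (by simp [id])))
    (fun z _ => hasLineDerivAt_second ((((hχ.hasDerivAt_snd z.1 z.2.1).const_mul
      (f z.1 (z.2.2.1 - 1) * 1)).mul_const (ψ₃ z.2.2.1)).mul_const (ζ z.2.2.2)))
  unfold waveIntegral
  rw [key]
  refine (norm_add_le _ _).trans (add_le_add ((norm_add_le _ _).trans (add_le_add ?_ ?_)) ?_)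
  · refine le_of_eq (congrArg norm (integral_congr_ae (Eventually.of_forall fun z => ?_)))
    simp only [waveAmplitude]
    congr 2
    ring
  · rw [norm_mul, norm_I, one_mul]
    refine le_of_eq (congrArg norm (integral_congr_ae (Eventually.of_forall fun z => ?_)))
    simp only [waveAmplitude]
    congr 2
    ring
  · rw [norm_mul, norm_I, one_mul]
    refine le_of_eq (congrArg norm (integral_congr_ae (Eventually.of_forall fun z => ?_)))
    simp only [waveAmplitude]
    congr 2
    ring

end Parts

/-- The gain obtained from the scaling vector field `A ∂_A - (3/2) η ∂_η`. -/
noncomputable def scalingWeight (m a X Y T S Υ A : ℝ) : ℝ :=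
  1 / (1 + m ^ 3 / |T| * scalingDefect a X Y T S Υ A ^ 2)
    + m ^ 2 * |scalingDefect a X Y T S Υ A|
      / (|T| * (1 + m ^ 3 / |T| * scalingDefect a X Y T S Υ A ^ 2))

structure IsScalingAmplitude (m a X Y T M : ℝ) (y : ℝ × ℝ × ℝ × ℝ → ℝ) : Prop where
  cont : ContinuousOn y amplitudeBox
  const : ∀ S Υ A η, y (S, Υ, A, η) = y (S, Υ, A, 1)
  eq_zero : ∀ S Υ A, ¬(S ∈ Set.Icc (-3 : ℝ) 3 ∧ Υ ∈ Set.Icc (-3 : ℝ) 3 ∧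
    A ∈ Set.Icc (9 / 10 : ℝ) 6) → y (S, Υ, A, 1) = 0
  bound : ∀ S ∈ Set.Icc (-3 : ℝ) 3, ∀ Υ ∈ Set.Icc (-3 : ℝ) 3, ∀ A ∈ Set.Icc (9 / 10 : ℝ) 6,
    |y (S, Υ, A, 1)| ≤ M * (cuspWeight m S (A - 1) * cuspWeight m Υ (A - X)
      * scalingWeight m a X Y T S Υ A)

theorem travelTimeDeriv_pos {a A : ℝ} (ha : 0 < a) (hA : 0 < A) : 0 < travelTimeDeriv a A := by
  have h1 : 0 < √(1 + a) := Real.sqrt_pos.2 (by linarith)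
  have h2 : 0 < √(1 + a * A) := Real.sqrt_pos.2 (by positivity)
  unfold travelTimeDeriv
  positivity

theorem travelTimeDeriv_le_one {a A : ℝ} (ha : 0 < a) (ha1 : a ≤ 1) (hA : 0 < A) :
    travelTimeDeriv a A ≤ 1 := by
  have h1 : √(1 + a) ≤ 2 := Real.sqrt_le_iff.2 ⟨by norm_num, by linarith⟩
  have h2 : 1 ≤ √(1 + a * A) := Real.one_le_sqrt.2 (by nlinarith [mul_pos ha hA])
  rw [travelTimeDeriv, div_le_one (by linarith)]
  linarith

theorem travelTimeDeriv₂_mem {a A : ℝ} (ha : 0 < a) (ha1 : a ≤ 1) (hA : 0 < A) :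
    travelTimeDeriv₂ a A ∈ Set.Icc (-1) 0 := by
  have h1 : √(1 + a) ≤ 2 := Real.sqrt_le_iff.2 ⟨by norm_num, by linarith⟩
  have h2 : 1 ≤ √(1 + a * A) := Real.one_le_sqrt.2 (by nlinarith [mul_pos ha hA])
  have h3 : 1 ≤ √(1 + a * A) ^ 3 := one_le_pow₀ h2
  rw [travelTimeDeriv₂]
  constructor
  · rw [neg_le_neg_iff, div_le_one (by linarith)]
    nlinarith [Real.sqrt_nonneg (1 + a)]
  · rw [neg_nonpos]
    positivity

theorem abs_scalingDefectDeriv_le {a A T S Υ : ℝ} (ha : 0 < a) (ha1 : a ≤ 1) (hT : 1 ≤ |T|)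
    (hS : S ∈ Set.Icc (-3 : ℝ) 3) (hΥ : Υ ∈ Set.Icc (-3 : ℝ) 3)
    (hA : A ∈ Set.Icc (9 / 10 : ℝ) 6) : |scalingDefectDeriv a T S Υ A| ≤ 10 * |T| := by
  have hA0 : 0 < A := by linarith [hA.1]
  have h1 := travelTimeDeriv_pos ha hA0
  have h2 := travelTimeDeriv_le_one ha ha1 hA0
  have h3 := travelTimeDeriv₂_mem ha ha1 hA0
  have e : scalingDefectDeriv a T S Υ A =
      T * (-(travelTimeDeriv a A / 2) + A * travelTimeDeriv₂ a A)
    + (S + Υ) / 2 := by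
    rw [scalingDefectDeriv]
    ring
  rw [e]
  have h4 : |-(travelTimeDeriv a A / 2) + A * travelTimeDeriv₂ a A| ≤ 7 := by
    rw [abs_le]
    constructor <;> nlinarith [h3.1, h3.2, hA.2]
  have h5 : |(S + Υ) / 2| ≤ 3 := by
    rw [abs_le]
    constructor <;> linarith [hS.1, hS.2, hΥ.1, hΥ.2]
  refine (abs_add_le _ _).trans ?_
  rw [abs_mul]
  nlinarith [mul_le_mul_of_nonneg_left h4 (abs_nonneg T)]

theorem waveAmplitude_eq_zero {X : ℝ} {f g : ℝ → ℝ → ℝ} {χ : ℝ × ℝ → ℝ} {ψ₃ : ℝ → ℝ}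
    (hχ : IsSpaceCutoff χ) (hψ₃ : tsupport ψ₃ ⊆ Set.Icc (9 / 10) 6) {S Υ A η : ℝ}
    (hz : ¬(S ∈ Set.Icc (-3 : ℝ) 3 ∧ Υ ∈ Set.Icc (-3 : ℝ) 3 ∧ A ∈ Set.Icc (9 / 10 : ℝ) 6)) :
    waveAmplitude X f g χ ψ₃ (S, Υ, A, η) = 0 := by
  unfold waveAmplitude
  by_cases h1 : S ∈ Set.Icc (-3 : ℝ) 3 ∧ Υ ∈ Set.Icc (-3 : ℝ) 3
  · rw [image_eq_zero_of_notMem_tsupport (x := A) (f := ψ₃) fun h => hz ⟨h1.1, h1.2, hψ₃ h⟩,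
      mul_zero]
  · rw [hχ.eq_zero h1]
    ring

/-- The three amplitudes produced by integrating by parts along `A ∂_A - (3/2) η ∂_η`. -/
theorem abs_scaling_terms_le {m τ k H H' x x' A P W : ℝ} (hm : 1 ≤ m) (hτ : 0 < τ) (hk : 0 ≤ k)
    (hA0 : 0 ≤ A) (hA : A ≤ 6) (hP : 0 ≤ P) (hW : 0 ≤ W) (hx : |x| ≤ P * W)
    (hx' : |x'| ≤ m ^ 2 * (P * W)) (hH' : |H'| ≤ 10 * τ) :
    |1 / (1 + k * H ^ 2) * x| ≤ 60 * P * (W * (1 / (1 + k * H ^ 2)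
      + m ^ 2 * |H| / (τ * (1 + k * H ^ 2)))) ∧
    |τ⁻¹ * ((H * x + A * H * x') / (1 + k * H ^ 2)
      + A * x * H' * (1 - k * H ^ 2) / (1 + k * H ^ 2) ^ 2)| ≤ 60 * P * (W * (1 / (1 + k * H ^ 2)
      + m ^ 2 * |H| / (τ * (1 + k * H ^ 2)))) ∧
    |τ⁻¹ * (3 / 2 * (H * x / (1 + k * H ^ 2)))| ≤ 60 * P * (W * (1 / (1 + k * H ^ 2)
      + m ^ 2 * |H| / (τ * (1 + k * H ^ 2)))) := by
  have hD : 0 < 1 + k * H ^ 2 := by positivity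
  have e : 60 * P * (W * (1 / (1 + k * H ^ 2) + m ^ 2 * |H| / (τ * (1 + k * H ^ 2))))
      = 60 * (P * W) * (1 + m ^ 2 * |H| * τ⁻¹) / (1 + k * H ^ 2) := by
    field_simp
  have hm2 : 1 ≤ m ^ 2 := one_le_pow₀ hm
  have hPW : 0 ≤ P * W := mul_nonneg hP hW
  have hHT : 0 ≤ |H| * τ⁻¹ := by positivity
  have hHT2 : |H| * τ⁻¹ ≤ m ^ 2 * |H| * τ⁻¹ := by nlinarith
  have hHx : |H| * |x| * τ⁻¹ ≤ m ^ 2 * |H| * τ⁻¹ * (P * W) := by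
    calc |H| * |x| * τ⁻¹ = (|H| * τ⁻¹) * |x| := by ring
      _ ≤ (m ^ 2 * |H| * τ⁻¹) * (P * W) := by gcongr
  rw [e]
  refine ⟨?_, ?_, ?_⟩
  · rw [abs_mul, abs_div, abs_one, abs_of_pos hD, one_div_mul_eq_div]
    gcongr
    nlinarith [mul_nonneg hPW (hHT.trans hHT2)]
  · have h1 : |1 - k * H ^ 2| ≤ 1 + k * H ^ 2 := by
      rw [abs_le]
      constructor <;> nlinarith [show 0 ≤ k * H ^ 2 by positivity]
    have h2 : |A * x * H' * (1 - k * H ^ 2) / (1 + k * H ^ 2) ^ 2|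
        ≤ 6 * (P * W) * (10 * τ) / (1 + k * H ^ 2) := by
      rw [abs_div, abs_of_pos (pow_pos hD 2), abs_mul, abs_mul, abs_mul, abs_of_nonneg hA0]
      calc A * |x| * |H'| * |1 - k * H ^ 2| / (1 + k * H ^ 2) ^ 2
          ≤ 6 * (P * W) * (10 * τ) * (1 + k * H ^ 2) / (1 + k * H ^ 2) ^ 2 := by gcongr
        _ = 6 * (P * W) * (10 * τ) / (1 + k * H ^ 2) := by field_simp
    have h3 : |(H * x + A * H * x') / (1 + k * H ^ 2)|
        ≤ (|H| * |x| + 6 * |H| * (m ^ 2 * (P * W))) / (1 + k * H ^ 2) := by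
      rw [abs_div, abs_of_pos hD]
      gcongr
      refine (abs_add_le _ _).trans ?_
      rw [abs_mul, abs_mul, abs_mul, abs_of_nonneg hA0]
      gcongr
    rw [abs_mul, abs_of_pos (inv_pos.2 hτ)]
    calc τ⁻¹ * |(H * x + A * H * x') / (1 + k * H ^ 2)
          + A * x * H' * (1 - k * H ^ 2) / (1 + k * H ^ 2) ^ 2|
        ≤ τ⁻¹ * ((|H| * |x| + 6 * |H| * (m ^ 2 * (P * W))) / (1 + k * H ^ 2)
          + 6 * (P * W) * (10 * τ) / (1 + k * H ^ 2)) :=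
          mul_le_mul_of_nonneg_left ((abs_add_le _ _).trans (add_le_add h3 h2)) (by positivity)
      _ = (|H| * |x| * τ⁻¹ + 6 * (m ^ 2 * |H| * τ⁻¹ * (P * W)) + 60 * (P * W))
          / (1 + k * H ^ 2) := by
          field_simp
          ring
      _ ≤ 60 * (P * W) * (1 + m ^ 2 * |H| * τ⁻¹) / (1 + k * H ^ 2) := by
          gcongr
          nlinarith [mul_nonneg hPW (hHT.trans hHT2)]
  · rw [abs_mul, abs_mul (3 / 2 : ℝ), abs_div (H * x), abs_mul H, abs_of_pos hD,
      abs_of_pos (inv_pos.2 hτ)]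
    calc τ⁻¹ * (|(3 / 2 : ℝ)| * (|H| * |x| / (1 + k * H ^ 2)))
        = (3 / 2 * (|H| * |x| * τ⁻¹)) / (1 + k * H ^ 2) := by
          rw [abs_of_pos (by norm_num : (0 : ℝ) < 3 / 2)]
          ring
      _ ≤ _ := div_le_div_of_nonneg_right
          (by nlinarith [mul_nonneg hPW (hHT.trans hHT2)]) hD.le

section Scaling

variable {ℓ q q₁ q₂ : ℝ → ℝ} {γ c C : ℝ} (hℓ : IsAlmostLinearPhase ℓ q q₁ q₂ γ c C)
  {χ : ℝ × ℝ → ℝ} {ψ₃ : ℝ → ℝ} (hχ : IsSpaceCutoff χ)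
  (hψ₃c : ContDiff ℝ (⊤ : ℕ∞) ψ₃) (hψ₃ : tsupport ψ₃ ⊆ Set.Icc (9 / 10) 6)
include hℓ hχ hψ₃c hψ₃

theorem exists_isScalingAmplitude : ∃ M > 0, ∀ m a X Y T : ℝ, 1 ≤ m → 0 < a → a ≤ 1 → 1 ≤ |T| →
    ∀ f f' g g' : ℝ → ℝ → ℝ, IsCuspAmplitude m f f' → IsCuspAmplitude m g g' →
    ∃ y₁ y₂ y₃ : ℝ × ℝ × ℝ × ℝ → ℝ, IsScalingAmplitude m a X Y T M y₁ ∧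
      IsScalingAmplitude m a X Y T M y₂ ∧ IsScalingAmplitude m a X Y T M y₃ ∧
      ∀ ζ, IsFrequencyCutoff ζ → ∀ N : ℤ, ‖waveIntegral ℓ (m ^ 3) a X Y T f g χ ψ₃ ζ N‖
        ≤ ‖∫ z, oscFactor ℓ (m ^ 3) a X Y T N z * ((y₁ z * ζ z.2.2.2 : ℝ) : ℂ)‖
        + ‖∫ z, oscFactor ℓ (m ^ 3) a X Y T N z * ((y₂ z * (ζ z.2.2.2 / z.2.2.2) : ℝ) : ℂ)‖
        + ‖∫ z, oscFactor ℓ (m ^ 3) a X Y T N z * ((y₃ z * deriv ζ z.2.2.2 : ℝ) : ℂ)‖ := by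
  obtain ⟨Mχ, hMχ0, hMχ⟩ := hχ.exists_bound
  have hc3 : HasCompactSupport ψ₃ := isCompact_Icc.of_isClosed_subset (isClosed_tsupport ψ₃) hψ₃
  obtain ⟨B, hB⟩ := hc3.exists_bound_of_continuous hψ₃c.continuous
  obtain ⟨B', hB'⟩ := hc3.deriv.exists_bound_of_continuous (hψ₃c.continuous_deriv (by simp))
  have hB0 : 0 ≤ B := (norm_nonneg _).trans (hB 0)
  have hB0' : 0 ≤ B' := (norm_nonneg _).trans (hB' 0)
  have hψ₃' : tsupport (deriv ψ₃) ⊆ Set.Icc (9 / 10) 6 := (tsupport_deriv_subset (𝕜 := ℝ)).trans hψ₃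
  set P : ℝ := 36 * Mχ * (2 * B + B' + 1) with hP
  have hP0 : 0 < P := by positivity
  refine ⟨60 * P, by positivity, fun m a X Y T hm ha ha1 hT f f' g g' hf hg => ?_⟩
  have hm0 : 0 < m := by linarith
  have hτ : 0 < |T| := by linarith
  set x := waveAmplitude X f g χ ψ₃ with hx
  set x' : ℝ × ℝ × ℝ × ℝ → ℝ := fun z => waveAmplitude X f' g χ ψ₃ z + waveAmplitude X f g' χ ψ₃ z
    + waveAmplitude X f g χ (deriv ψ₃) z with hx'
  have hxc : Continuous x :=
    continuous_waveAmplitude hf.cont hg.cont hχ.smooth.continuous hψ₃c.continuous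
  have hxc' : Continuous x' := ((continuous_waveAmplitude hf.cont' hg.cont hχ.smooth.continuous
    hψ₃c.continuous).add (continuous_waveAmplitude hf.cont hg.cont' hχ.smooth.continuous
    hψ₃c.continuous)).add (continuous_waveAmplitude hf.cont hg.cont hχ.smooth.continuous
    (hψ₃c.continuous_deriv (by simp)))
  have hx0 : ∀ S Υ A η, ¬(S ∈ Set.Icc (-3 : ℝ) 3 ∧ Υ ∈ Set.Icc (-3 : ℝ) 3 ∧
      A ∈ Set.Icc (9 / 10 : ℝ) 6) → x (S, Υ, A, η) = 0 ∧ x' (S, Υ, A, η) = 0 :=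
    fun S Υ A η h => ⟨waveAmplitude_eq_zero hχ hψ₃ h, by
      simp only [hx', waveAmplitude_eq_zero hχ hψ₃ h, waveAmplitude_eq_zero hχ hψ₃' h, add_zero]⟩
  have hxb : ∀ z : ℝ × ℝ × ℝ × ℝ,
      |x z| ≤ P * (cuspWeight m z.1 (z.2.2.1 - 1) * cuspWeight m z.2.1 (z.2.2.1 - X)) ∧
      |x' z| ≤ m ^ 2 * (P * (cuspWeight m z.1 (z.2.2.1 - 1)
        * cuspWeight m z.2.1 (z.2.2.1 - X))) := fun z => by
    set w₁ := cuspWeight m z.1 (z.2.2.1 - 1) with hw₁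
    set w₂ := cuspWeight m z.2.1 (z.2.2.1 - X) with hw₂
    have hw1 : 0 ≤ w₁ := cuspWeight_nonneg hm0 _ _
    have hw2 : 0 ≤ w₂ := cuspWeight_nonneg hm0 _ _
    have hm2 : 1 ≤ m ^ 2 := one_le_pow₀ hm
    have b1 := hf.bound z.1 (z.2.2.1 - 1)
    have b2 := hg.bound z.2.1 (z.2.2.1 - X)
    have b3 := hf.bound' z.1 (z.2.2.1 - 1)
    have b4 := hg.bound' z.2.1 (z.2.2.1 - X)
    rw [← hw₁] at b1 b3
    rw [← hw₂] at b2 b4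
    have b5 := hMχ (z.1, z.2.1)
    have b6 : |ψ₃ z.2.2.1| ≤ B := hB _
    have b7 : |deriv ψ₃ z.2.2.1| ≤ B' := hB' _
    have c1 : |waveAmplitude X f g χ ψ₃ z| ≤ 6 * w₁ * (6 * w₂) * Mχ * B := by
      rw [waveAmplitude, abs_mul, abs_mul, abs_mul]
      gcongr
    have c2 : |waveAmplitude X f' g χ ψ₃ z| ≤ 6 * m ^ 2 * w₁ * (6 * w₂) * Mχ * B := by
      rw [waveAmplitude, abs_mul, abs_mul, abs_mul]
      gcongr
    have c3 : |waveAmplitude X f g' χ ψ₃ z| ≤ 6 * w₁ * (6 * m ^ 2 * w₂) * Mχ * B := by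
      rw [waveAmplitude, abs_mul, abs_mul, abs_mul]
      gcongr
    have c4 : |waveAmplitude X f g χ (deriv ψ₃) z| ≤ 6 * w₁ * (6 * w₂) * Mχ * B' := by
      rw [waveAmplitude, abs_mul, abs_mul, abs_mul]
      gcongr
    have hww : 0 ≤ w₁ * w₂ * Mχ := by positivity
    constructor
    · refine c1.trans ?_
      rw [hP]
      nlinarith [mul_nonneg hww hB0, mul_nonneg hww hB0']
    · refine (abs_add_three _ _ _).trans ((add_le_add (add_le_add c2 c3) c4).trans ?_)
      rw [hP]
      nlinarith [mul_le_mul_of_nonneg_right hm2 (mul_nonneg hww hB0'), mul_nonneg (sq_nonneg m) hww]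
  set H : ℝ × ℝ × ℝ × ℝ → ℝ := fun z => scalingDefect a X Y T z.1 z.2.1 z.2.2.1 with hH
  set H' : ℝ × ℝ × ℝ × ℝ → ℝ := fun z => scalingDefectDeriv a T z.1 z.2.1 z.2.2.1 with hH'
  have hHc : ContinuousOn H amplitudeBox := continuousOn_scalingDefect_box ha X Y T
  have hHc' : ContinuousOn H' amplitudeBox := continuousOn_scalingDefectDeriv_box ha T
  have hk : 0 < m ^ 3 / |T| := by positivity
  have hD : ∀ z, 1 + m ^ 3 / |T| * H z ^ 2 ≠ 0 := fun z => by positivity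
  have hDc : ContinuousOn (fun z => 1 + m ^ 3 / |T| * H z ^ 2) amplitudeBox := by fun_prop
  have main : ∀ S ∈ Set.Icc (-3 : ℝ) 3, ∀ Υ ∈ Set.Icc (-3 : ℝ) 3, ∀ A ∈ Set.Icc (9 / 10 : ℝ) 6,
      _ := fun S hS Υ hΥ A hA => abs_scaling_terms_le (H := H (S, Υ, A, 1)) hm hτ hk.le
    (by linarith [hA.1] : 0 ≤ A) hA.2 hP0.le
    (mul_nonneg (cuspWeight_nonneg hm0 S (A - 1)) (cuspWeight_nonneg hm0 Υ (A - X)))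
    (hxb (S, Υ, A, 1)).1 (hxb (S, Υ, A, 1)).2 (abs_scalingDefectDeriv_le ha ha1 hT hS hΥ hA)
  refine ⟨fun z => 1 / (1 + m ^ 3 / |T| * H z ^ 2) * x z,
    fun z => |T|⁻¹ * ((H z * x z + z.2.2.1 * H z * x' z) / (1 + m ^ 3 / |T| * H z ^ 2)
          + z.2.2.1 * x z * H' z * (1 - m ^ 3 / |T| * H z ^ 2) / (1 + m ^ 3 / |T| * H z ^ 2) ^ 2),
    fun z => |T|⁻¹ * (3 / 2 * (H z * x z / (1 + m ^ 3 / |T| * H z ^ 2))),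
    ⟨(continuousOn_const.div hDc fun z _ => hD z).mul hxc.continuousOn, fun _ _ _ _ => rfl,
      fun S Υ A h => ?_, fun S hS Υ hΥ A hA => (main S hS Υ hΥ A hA).1⟩,
    ⟨continuousOn_const.mul ((ContinuousOn.div (by fun_prop) hDc fun z _ => hD z).add
      (ContinuousOn.div (by fun_prop) (hDc.pow 2) fun z _ => pow_ne_zero 2 (hD z))),
      fun _ _ _ _ => rfl,
      fun S Υ A h => ?_, fun S hS Υ hΥ A hA => (main S hS Υ hΥ A hA).2.1⟩,
    ⟨continuousOn_const.mul (continuousOn_const.mul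
      (ContinuousOn.div (by fun_prop) hDc fun z _ => hD z)), fun _ _ _ _ => rfl,
      fun S Υ A h => ?_, fun S hS Υ hΥ A hA => (main S hS Υ hΥ A hA).2.2⟩, fun ζ hζ N => ?_⟩
  · simp [(hx0 S Υ A 1 h).1]
  · simp [(hx0 S Υ A 1 h).1, (hx0 S Υ A 1 h).2]
  · simp [(hx0 S Υ A 1 h).1]
  have := isAddHaarMeasure_volume_real_prod
  have hlam : 0 < m ^ 3 := by positivity
  have hζ' := hζ.deriv
  have hζc := hζ.smooth.continuous
  have hζc' := hζ'.smooth.continuous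
  have hqc := continuousOn_comp_scale hlam (f := q)
    fun u hu => (hℓ.deriv_one u hu).continuousAt.continuousWithinAt
  have hP := continuousOn_cubicPhase_box ha X Y T
  have hG := continuousOn_travelTimeDeriv_box ha
  have hr1 : Continuous fun z : ℝ × ℝ × ℝ × ℝ => z.2.2.1 ^ ((3 : ℝ) / 2) :=
    Continuous.rpow_const (by fun_prop) fun _ => Or.inr (by norm_num)
  have hr2 : Continuous fun z : ℝ × ℝ × ℝ × ℝ => z.2.2.1 ^ ((1 : ℝ) / 2) :=
    Continuous.rpow_const (by fun_prop) fun _ => Or.inr (by norm_num)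
  have hoff : ∀ y : ℝ × ℝ × ℝ × ℝ → ℝ, ∀ ξ : ℝ → ℝ, IsFrequencyCutoff ξ →
      (∀ S Υ A η, ¬(S ∈ Set.Icc (-3 : ℝ) 3 ∧ Υ ∈ Set.Icc (-3 : ℝ) 3 ∧
      A ∈ Set.Icc (9 / 10 : ℝ) 6) → y (S, Υ, A, η) = 0) → ∀ z ∉ amplitudeBox,
      y z * ξ z.2.2.2 = 0 := fun y ξ hξ hy z hz => by
    by_cases h : z.1 ∈ Set.Icc (-3 : ℝ) 3 ∧ z.2.1 ∈ Set.Icc (-3 : ℝ) 3 ∧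
      z.2.2.1 ∈ Set.Icc (9 / 10 : ℝ) 6
    · rw [hξ.eq_zero fun h' => hz ⟨h.1, h.2.1, h.2.2, h'⟩, mul_zero]
    · rw [show y z = 0 from hy z.1 z.2.1 z.2.2.1 z.2.2.2 h, zero_mul]
  have key := integral_eq_add_of_scaling (μ := (volume : Measure (ℝ × ℝ × ℝ × ℝ)))
    (v₁ := (0, 0, 1, 0)) (v₂ := (0, 0, 0, 1)) hk hτ isCompact_amplitudeBox
    (e := oscFactor ℓ (m ^ 3) a X Y T N) (w := fun z => z.2.2.2) (b := fun z => z.2.2.1)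
    (e₁ := fun z => m ^ 3 * z.2.2.2 * (-z.1 - z.2.1 + T * travelTimeDeriv a z.2.2.1)
        - N * (q (m ^ 3 * z.2.2.2 * z.2.2.1 ^ ((3 : ℝ) / 2)) *
          (m ^ 3 * z.2.2.2 * (3 / 2 * z.2.2.1 ^ ((1 : ℝ) / 2)))))
    (e₂ := fun z => m ^ 3 * cubicPhase a X Y T z.1 z.2.1 z.2.2.1
        - N * (q (m ^ 3 * z.2.2.2 * z.2.2.1 ^ ((3 : ℝ) / 2)) *
          (m ^ 3 * z.2.2.1 ^ ((3 : ℝ) / 2))))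
    (H := H) (H' := H') (x := x) (x' := x') (ζ := fun z => ζ z.2.2.2)
    (ζ' := fun z => deriv ζ z.2.2.2)
    (continuousOn_oscFactor hℓ hlam ha X Y T N)
    ((ContinuousOn.mul (by fun_prop) (by fun_prop)).sub
      (continuousOn_const.mul (hqc.mul (by fun_prop))))
    ((ContinuousOn.mul (by fun_prop) (by fun_prop)).sub
      (continuousOn_const.mul (hqc.mul (continuous_const.mul hr1).continuousOn))) (by fun_prop)
    (by fun_prop) (fun z hz => (mem_amplitudeBox_pos hz).2.ne') hHc hHc'
        hxc.continuousOn hxc'.continuousOn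
    (by fun_prop) (by fun_prop)
    (fun z hz => ⟨hoff x ζ hζ (fun S Υ A η h => (hx0 S Υ A η h).1) z hz,
      hoff x' ζ hζ (fun S Υ A η h => (hx0 S Υ A η h).2) z hz,
      hoff x (deriv ζ) hζ' (fun S Υ A η h => (hx0 S Υ A η h).1) z hz⟩)
    (fun z hz => hasLineDerivAt_oscFactor_third hℓ hlam ha X Y T N hz)
    (fun z hz => hasLineDerivAt_oscFactor_fourth hℓ hlam X Y T N hz)
    (fun z hz => by
      have hA := (mem_amplitudeBox_pos hz).1
      have e1 : z.2.2.1 ^ ((3 : ℝ) / 2) = z.2.2.1 * z.2.2.1 ^ ((1 : ℝ) / 2) := by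
        rw [← Real.rpow_one_add' hA.le (by norm_num)]
        norm_num
      simp only [hH, scalingDefect_eq, e1]
      field_simp
      ring)
    (fun z _ => hasLineDerivAt_third (hasDerivAt_id z.2.2.1))
    (fun z _ => hasLineDerivAt_third (hasDerivAt_const z.2.2.1 z.2.2.2))
    (fun z hz => hasLineDerivAt_third
      (hasDerivAt_scalingDefect ha (mem_amplitudeBox_pos hz).1 X Y T z.1 z.2.1))
    (fun z _ => hasLineDerivAt_fourth (hasDerivAt_const z.2.2.2 (H z)))
    (fun z _ => hasLineDerivAt_third (by
      have h1 := (hf.hasDerivAt z.1 (z.2.2.1 - 1)).comp_sub_const z.2.2.1 1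
      have h2 := (hg.hasDerivAt z.2.1 (z.2.2.1 - X)).comp_sub_const z.2.2.1 X
      have h3 : HasDerivAt ψ₃ (deriv ψ₃ z.2.2.1) z.2.2.1 :=
        (hψ₃c.differentiable (by simp) _).hasDerivAt
      exact (((h1.fun_mul h2).mul_const (χ (z.1, z.2.1))).fun_mul h3).congr_deriv (by
        simp only [hx', waveAmplitude]
        ring)))
    (fun z _ => hasLineDerivAt_fourth (hasDerivAt_const z.2.2.2 (x z)))
    (fun z _ => hasLineDerivAt_third (hasDerivAt_const z.2.2.1 (ζ z.2.2.2)))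
    (fun z _ => hasLineDerivAt_fourth ((hζ.smooth.differentiable (by simp) _).hasDerivAt))
  rw [waveIntegral, key]
  refine (norm_sub_le _ _).trans (add_le_add ((norm_add_le _ _).trans (add_le_add le_rfl ?_)) ?_)
  · rw [norm_mul, norm_I, one_mul]
  · rw [norm_mul, norm_I, one_mul]

end Scaling

theorem scaling_weight_mul_le {m τ K R r P H Q : ℝ} (hm : 1 ≤ m) (hτ : m ^ 6 ≤ τ) (hK : 0 < K)
    (hr : 1 / 2 ≤ r) (hr' : r ≤ 36) (hQ : 3 / 2 * P = Q - H) (hQ1 : τ / 5 ≤ |Q|)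
    (hQ2 : |Q| ≤ 7 * τ) (hR1 : R ≤ K * (1 + √|P / r| / (m ^ 3 * r * √(m ^ 3 * r))))
    (hR2 : 1 / 10 ^ 6 * (m ^ 3 * r) ^ 2 ≤ |P / r| →
      R ≤ K * (√|P / r| / (m ^ 3 * r * √(m ^ 3 * r)))) :
    (1 / (1 + m ^ 3 / τ * H ^ 2) + m ^ 2 * |H| / (τ * (1 + m ^ 3 / τ * H ^ 2))) * R
      ≤ 2000 * K * (√(τ / m ^ 9) * (1 / (1 + m ^ 3 / τ * H ^ 2)) + 1 / m ^ 6) := by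
  have hm0 : 0 < m := by linarith
  have hm6 : 1 ≤ m ^ 6 := one_le_pow₀ hm
  have hτ0 : 0 < τ := by linarith
  have hr0 : 0 < r := by linarith
  have hD : 0 < 1 + m ^ 3 / τ * H ^ 2 := by positivity
  have hκ : √|P / r| / (m ^ 3 * r * √(m ^ 3 * r)) ≤ √(8 * |P / r| / m ^ 9) := by
    have e : m ^ 3 * r * √(m ^ 3 * r) = √((m ^ 3 * r) ^ 3) := by
      rw [pow_succ (m ^ 3 * r) 2, Real.sqrt_mul (by positivity : 0 ≤ (m ^ 3 * r) ^ 2),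
        Real.sqrt_sq (by positivity)]
    rw [e, ← Real.sqrt_div' _ (by positivity)]
    apply Real.sqrt_le_sqrt
    rw [div_le_div_iff₀ (by positivity) (by positivity)]
    have h1 : (1 : ℝ) ≤ 8 * r ^ 3 := by nlinarith [sq_nonneg (r - 1 / 2), mul_pos hr0 hr0]
    have h2 := mul_le_mul_of_nonneg_left h1 (by positivity : 0 ≤ |P / r| * m ^ 9)
    calc |P / r| * m ^ 9 = |P / r| * m ^ 9 * 1 := by ring
      _ ≤ _ := h2
      _ = _ := by ring
  have hF : |P / r| = |P| / r := by rw [abs_div, abs_of_pos hr0]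
  have hPQ : |Q| - |H| ≤ 3 / 2 * |P| := by
    have : |3 / 2 * P| = |Q - H| := by rw [hQ]
    rw [abs_mul, abs_of_pos (by norm_num : (0 : ℝ) < 3 / 2)] at this
    rw [this]
    exact abs_sub_abs_le_abs_sub Q H
  have hPQ' : 3 / 2 * |P| ≤ |Q| + |H| := by
    have : |3 / 2 * P| = |Q - H| := by rw [hQ]
    rw [abs_mul, abs_of_pos (by norm_num : (0 : ℝ) < 3 / 2)] at this
    rw [this]
    exact abs_sub Q H
  have hF2 : |P / r| ≤ 2 * |P| := by
    rw [hF, div_le_iff₀ hr0]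
    nlinarith [abs_nonneg P]
  set V := 1 / (1 + m ^ 3 / τ * H ^ 2) + m ^ 2 * |H| / (τ * (1 + m ^ 3 / τ * H ^ 2)) with hV
  have hV0 : 0 ≤ V := by positivity
  have hHD : |H| ≠ 0 → m ^ 2 * |H| / (τ * (1 + m ^ 3 / τ * H ^ 2)) ≤ 1 / (m * |H|) := fun hH => by
    have hH0 : 0 < |H| := lt_of_le_of_ne (abs_nonneg H) (Ne.symm hH)
    rw [div_le_div_iff₀ (by positivity) (by positivity)]
    have e : τ * (1 + m ^ 3 / τ * H ^ 2) = τ + m ^ 3 * |H| ^ 2 := by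
      rw [sq_abs]
      field_simp
    rw [e]
    nlinarith
  by_cases hn : |H| ≤ τ / 10
  · have h1 : τ / 15 ≤ |P| := by linarith
    have h2 : |P| ≤ 5 * τ := by linarith
    have h3 : 1 / 10 ^ 6 * (m ^ 3 * r) ^ 2 ≤ |P / r| := by
      rw [hF, le_div_iff₀ hr0]
      have h4 : r ^ 3 ≤ 36 ^ 3 := by gcongr
      have h5 := mul_le_mul_of_nonneg_left h4 (by positivity : 0 ≤ m ^ 6)
      calc 1 / 10 ^ 6 * (m ^ 3 * r) ^ 2 * r = 1 / 10 ^ 6 * (m ^ 6 * r ^ 3) := by ring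
        _ ≤ 1 / 10 ^ 6 * (m ^ 6 * 36 ^ 3) := by gcongr
        _ ≤ τ / 15 := by linarith
        _ ≤ |P| := h1
    have h4 : R ≤ 9 * K * √(τ / m ^ 9) := by
      refine (hR2 h3).trans ?_
      have h5 : √(8 * |P / r| / m ^ 9) ≤ 9 * √(τ / m ^ 9) := by
        rw [Real.sqrt_le_left (by positivity), mul_pow, Real.sq_sqrt (by positivity),
            ← mul_div_assoc]
        exact div_le_div_of_nonneg_right (by linarith) (by positivity)
      calc _ ≤ K * (9 * √(τ / m ^ 9)) := by gcongr; exact hκ.trans h5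
        _ = _ := by ring
    have h5 : V ≤ 2 * (1 / (1 + m ^ 3 / τ * H ^ 2)) + 2 * (m / τ) := by
      have hmt : 0 < m / τ := by positivity
      have hDi : 0 < 1 / (1 + m ^ 3 / τ * H ^ 2) := by positivity
      rw [hV]
      by_cases hs : m ^ 2 * |H| ≤ τ
      · have : m ^ 2 * |H| / (τ * (1 + m ^ 3 / τ * H ^ 2)) ≤ 1 / (1 + m ^ 3 / τ * H ^ 2) := by
          rw [← div_div]
          gcongr
          rwa [div_le_one hτ0]
        linarith
      · push Not at hs
        have hH0 : 0 < |H| := by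
          by_contra h0
          nlinarith [sq_nonneg m]
        have : 1 / (m * |H|) ≤ m / τ := by
          rw [div_le_div_iff₀ (by positivity) hτ0]
          nlinarith
        linarith [hHD hH0.ne']
    have h6 : √(τ / m ^ 9) * (m / τ) ≤ 1 / m ^ 6 := by
      have e : √(τ / m ^ 9) * (m / τ) = √(τ / m ^ 9 * (m / τ) ^ 2) := by
        rw [Real.sqrt_mul (by positivity), Real.sqrt_sq (by positivity)]
      rw [e, Real.sqrt_le_left (by positivity)]
      have e2 : τ / m ^ 9 * (m / τ) ^ 2 = 1 / (m ^ 7 * τ) := by field_simp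
      rw [e2, div_pow, one_pow, ← pow_mul]
      refine one_div_le_one_div_of_le (by positivity) ?_
      calc m ^ (6 * 2) = m ^ 6 * m ^ 6 := by ring
        _ ≤ m ^ 7 * τ := by
          gcongr
          · norm_num
    calc V * R ≤ V * (9 * K * √(τ / m ^ 9)) := by gcongr
      _ ≤ (2 * (1 / (1 + m ^ 3 / τ * H ^ 2)) + 2 * (m / τ)) * (9 * K * √(τ / m ^ 9)) := by gcongr
      _ = 18 * K * (√(τ / m ^ 9) * (1 / (1 + m ^ 3 / τ * H ^ 2)) + √(τ / m ^ 9) * (m / τ)) := by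
        ring
      _ ≤ 2000 * K * (√(τ / m ^ 9) * (1 / (1 + m ^ 3 / τ * H ^ 2)) + 1 / m ^ 6) := by
        gcongr
        norm_num
  · push Not at hn
    have hH0 : 0 < |H| := by linarith
    have h1 : V ≤ 11 / (m * |H|) := by
      have h2 : 1 / (1 + m ^ 3 / τ * H ^ 2) ≤ 10 / (m * |H|) := by
        rw [div_le_div_iff₀ (by positivity) (by positivity)]
        have h3 : m * |H| ≤ 10 * (m ^ 3 / τ * H ^ 2) := by
          rw [← sq_abs H]
          have e : 10 * (m ^ 3 / τ * |H| ^ 2) = (m * |H|) * (m ^ 2 * (10 * |H| / τ)) := by ring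
          rw [e]
          have h4 : 1 ≤ 10 * |H| / τ := by rw [one_le_div hτ0]; linarith
          have h5 : 1 ≤ m ^ 2 := one_le_pow₀ hm
          exact le_mul_of_one_le_right (by positivity) (one_le_mul_of_one_le_of_one_le h5 h4)
        linarith
      have e : 11 / (m * |H|) = 10 / (m * |H|) + 1 / (m * |H|) := by ring
      rw [hV, e]
      exact add_le_add h2 (hHD hH0.ne')
    have h2 : |P / r| ≤ 95 * |H| := by linarith
    have h3 : √(8 * |P / r| / m ^ 9) ≤ 90 * (|H| / m ^ 6) := by
      rw [Real.sqrt_le_left (by positivity)]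
      have h4 : 8 * |P / r| / m ^ 9 ≤ 760 * |H| / m ^ 9 :=
        div_le_div_of_nonneg_right (by linarith) (by positivity)
      refine h4.trans ?_
      rw [mul_pow, div_pow, ← mul_div_assoc, div_le_div_iff₀ (by positivity) (by positivity)]
      have h5 : m ^ 6 ≤ 10 * |H| := by linarith
      have h6 : (m ^ 6) ^ 2 ≤ m ^ 9 * m ^ 6 := by
        rw [← pow_mul, ← pow_add]
        exact pow_le_pow_right₀ hm (by norm_num)
      calc 760 * |H| * (m ^ 6) ^ 2 ≤ 760 * |H| * (m ^ 9 * m ^ 6) := by gcongr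
        _ ≤ 760 * |H| * (m ^ 9 * (10 * |H|)) := by gcongr
        _ ≤ 90 ^ 2 * |H| ^ 2 * m ^ 9 := by nlinarith [show 0 ≤ |H| ^ 2 * m ^ 9 by positivity]
    have h4 : R ≤ K * (100 * (|H| / m ^ 6)) := by
      refine hR1.trans ?_
      gcongr
      have h5 : 1 ≤ 10 * (|H| / m ^ 6) := by
        rw [← mul_div_assoc, one_le_div (by positivity)]
        linarith
      linarith [hκ.trans h3]
    calc V * R ≤ V * (K * (100 * (|H| / m ^ 6))) := by gcongr
      _ ≤ 11 / (m * |H|) * (K * (100 * (|H| / m ^ 6))) := by gcongr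
      _ = 1100 * K * (1 / m ^ 6) * (1 / m) := by field_simp; ring
      _ ≤ 1100 * K * (1 / m ^ 6) * 1 := by
        gcongr
        rw [div_le_one hm0]
        exact hm
      _ ≤ 2000 * K * (√(τ / m ^ 9) * (1 / (1 + m ^ 3 / τ * H ^ 2)) + 1 / m ^ 6) := by
        have h7 : 0 ≤ √(τ / m ^ 9) * (1 / (1 + m ^ 3 / τ * H ^ 2)) := by positivity
        have h8 : 0 ≤ 1 / m ^ 6 := by positivity
        have h9 := mul_nonneg hK.le h7
        have h10 := mul_nonneg hK.le h8
        generalize √(τ / m ^ 9) * (1 / (1 + m ^ 3 / τ * H ^ 2)) = y at h9 ⊢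
        generalize 1 / m ^ 6 = x at h10 ⊢
        linarith

theorem lintegral_lintegral_mul_le {μ ν : Measure ℝ} [SFinite μ] [SFinite ν]
    {u : ℝ → ℝ → ENNReal} {E : ℝ → ENNReal} (hu : Measurable fun p : ℝ × ℝ => u p.1 p.2)
    (hE : Measurable E) {c : ENNReal} (h : ∀ z, ∫⁻ x, u x z ∂μ ≤ c) :
    ∫⁻ x, ∫⁻ z, u x z * E z ∂ν ∂μ ≤ c * ∫⁻ z, E z ∂ν := by
  rw [lintegral_lintegral_swap
    (show Measurable fun p : ℝ × ℝ => u p.1 p.2 * E p.2 by fun_prop).aemeasurable,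
    ← lintegral_const_mul _ hE]
  refine lintegral_mono fun z => ?_
  have hz : Measurable fun x => u x z := hu.comp (show Measurable fun x : ℝ => (x, z) by fun_prop)
  rw [lintegral_mul_const (E z) hz]
  exact mul_le_mul_left (h z) _

theorem lintegral_lintegral_lintegral_mul_le {μ ν κ : Measure ℝ} [SFinite μ] [SFinite ν]
    [SFinite κ] {u : ℝ → ℝ → ENNReal} {G : ℝ → ℝ → ENNReal}
    (hu : Measurable fun p : ℝ × ℝ => u p.1 p.2) (hG : Measurable fun p : ℝ × ℝ => G p.1 p.2)
    {c : ENNReal} (h : ∀ z, ∫⁻ x, u x z ∂μ ≤ c) :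
    ∫⁻ x, ∫⁻ y, ∫⁻ z, u x z * G y z ∂κ ∂ν ∂μ ≤ c * ∫⁻ y, ∫⁻ z, G y z ∂κ ∂ν := by
  have h3 : Measurable fun q : (ℝ × ℝ) × ℝ => u q.1.1 q.2 * G q.1.2 q.2 :=
    (hu.comp (show Measurable fun q : (ℝ × ℝ) × ℝ => (q.1.1, q.2) by fun_prop)).mul
      (hG.comp (show Measurable fun q : (ℝ × ℝ) × ℝ => (q.1.2, q.2) by fun_prop))
  rw [lintegral_lintegral_swap (h3.lintegral_prod_right' (ν := κ)).aemeasurable,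
    ← lintegral_const_mul _ (Measurable.lintegral_prod_right' hG)]
  exact lintegral_mono fun y =>
    lintegral_lintegral_mul_le hu (hG.comp (measurable_const.prodMk measurable_id)) h

theorem setLIntegral_ofReal_le {f : ℝ → ℝ} {a b c : ℝ} (hab : a ≤ b)
    (hf : ContinuousOn f (Set.Icc a b)) (h0 : ∀ x ∈ Set.Icc a b, 0 ≤ f x)
    (h : ∫ x in a..b, f x ≤ c) : ∫⁻ x in Set.Icc a b, ENNReal.ofReal (f x) ≤ ENNReal.ofReal c := by
  rw [← ofReal_integral_eq_lintegral_ofReal (hf.integrableOn_Icc)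
    ((ae_restrict_iff' measurableSet_Icc).2 (ae_of_all _ h0)), integral_Icc_eq_integral_Ioc,
    ← intervalIntegral.integral_of_le hab]
  exact ENNReal.ofReal_le_ofReal h

theorem integral_mul_div_one_add_le {m : ℝ} (hm : 1 ≤ m) (c : ℝ) :
    ∫ s in (0 : ℝ)..3, m * s / (1 + m ^ 4 * (s ^ 2 - c) ^ 2) ≤ π / (2 * m) := by
  have hm0 : 0 < m := by linarith
  have hD : ∀ s : ℝ, 0 < 1 + m ^ 4 * (s ^ 2 - c) ^ 2 := fun s => by positivity
  have hd : ∀ s ∈ Set.uIcc (0 : ℝ) 3, HasDerivAt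
      (fun s => Real.arctan (m ^ 2 * (s ^ 2 - c)) / (2 * m))
      (m * s / (1 + m ^ 4 * (s ^ 2 - c) ^ 2)) s := fun s _ =>
    (((((hasDerivAt_pow 2 s).sub_const c).const_mul (m ^ 2)).arctan).div_const (2 * m)).congr_deriv
      (by
        have := hD s
        have e : 1 + (m ^ 2 * (s ^ 2 - c)) ^ 2 = 1 + m ^ 4 * (s ^ 2 - c) ^ 2 := by ring
        rw [e]
        generalize 1 + m ^ 4 * (s ^ 2 - c) ^ 2 = D at *
        field_simp
        norm_num)
  have hc : Continuous fun s => m * s / (1 + m ^ 4 * (s ^ 2 - c) ^ 2) :=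
    Continuous.div (by fun_prop) (by fun_prop) fun s => (hD s).ne'
  rw [intervalIntegral.integral_eq_sub_of_hasDerivAt hd (hc.intervalIntegrable _ _), ← sub_div]
  refine div_le_div_of_nonneg_right ?_ (by positivity)
  have h := fun x => Real.arctan_lt_pi_div_two x
  have h' := fun x => Real.neg_pi_div_two_lt_arctan x
  exact (sub_le_sub (h _).le (h' _).le).trans_eq (by ring)

theorem cuspWeight_le {m : ℝ} (hm : 1 ≤ m) (s c : ℝ) :
    cuspWeight m s c ≤ 2 * (m * |s| / (1 + m ^ 4 * (s ^ 2 - c) ^ 2))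
      + 2 * (1 / (1 + m ^ 2 * s ^ 2)) + 1 / m := by
  have hm0 : 0 < m := by linarith
  have hD : 1 ≤ 1 + m ^ 4 * (s ^ 2 - c) ^ 2 := by
    have : 0 ≤ m ^ 4 * (s ^ 2 - c) ^ 2 := by positivity
    linarith
  rw [cuspWeight]
  generalize 1 + m ^ 4 * (s ^ 2 - c) ^ 2 = D at *
  have h1 : 1 / D ≤ m * |s| / D + 2 * (1 / (1 + m ^ 2 * s ^ 2)) := by
    rcases le_total 1 (m * |s|) with h | h
    · have : 1 / D ≤ m * |s| / D := by gcongr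
      have : 0 ≤ 2 * (1 / (1 + m ^ 2 * s ^ 2)) := by positivity
      linarith
    · have e : m ^ 2 * s ^ 2 = (m * |s|) ^ 2 := by rw [mul_pow, sq_abs]
      have h2 : 1 / D ≤ 1 := by
        rw [div_le_one (by linarith)]
        exact hD
      have h3 : 1 ≤ 2 * (1 / (1 + m ^ 2 * s ^ 2)) := by
        rw [mul_one_div, one_le_div (by positivity), e]
        nlinarith [show 0 ≤ m * |s| by positivity]
      have : 0 ≤ m * |s| / D := by positivity
      linarith
  have e2 : (1 + m * |s|) / D = 1 / D + m * |s| / D := by rw [add_div]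
  linarith

theorem setLIntegral_cuspWeight_le {m : ℝ} (hm : 1 ≤ m) (c : ℝ) :
    ∫⁻ s in Set.Icc (-3 : ℝ) 3, ENNReal.ofReal (cuspWeight m s c) ≤ ENNReal.ofReal (20 / m) := by
  have hm0 : 0 < m := by linarith
  have hD : ∀ s : ℝ, 0 < 1 + m ^ 4 * (s ^ 2 - c) ^ 2 := fun s => by positivity
  have hc1 : Continuous fun s => m * |s| / (1 + m ^ 4 * (s ^ 2 - c) ^ 2) :=
    Continuous.div (by fun_prop) (by fun_prop) fun s => (hD s).ne'
  have hc2 : Continuous fun s : ℝ => 1 / (1 + m ^ 2 * s ^ 2) :=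
    Continuous.div (by fun_prop) (by fun_prop) fun s => by positivity
  have hcW : Continuous fun s => cuspWeight m s c := by
    unfold cuspWeight
    exact (Continuous.div (by fun_prop) (by fun_prop) fun s => (hD s).ne').add (by fun_prop)
  refine setLIntegral_ofReal_le (by norm_num) hcW.continuousOn
    (fun s _ => cuspWeight_nonneg hm0 s c) ?_
  have i1 : ∫ s in (0 : ℝ)..3, m * |s| / (1 + m ^ 4 * (s ^ 2 - c) ^ 2) ≤ π / (2 * m) := by
    refine le_trans (le_of_eq (intervalIntegral.integral_congr fun s hs => ?_))
      (integral_mul_div_one_add_le hm c)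
    rw [Set.uIcc_of_le (by norm_num)] at hs
    simp only [abs_of_nonneg hs.1]
  have i2 : ∫ s in (-3 : ℝ)..0, m * |s| / (1 + m ^ 4 * (s ^ 2 - c) ^ 2) ≤ π / (2 * m) := by
    have := intervalIntegral.integral_comp_neg (a := 0) (b := 3)
      (fun s => m * |s| / (1 + m ^ 4 * (s ^ 2 - c) ^ 2))
    rw [neg_zero] at this
    rw [← this]
    simpa using i1
  have i3 : ∫ s in (-3 : ℝ)..3, m * |s| / (1 + m ^ 4 * (s ^ 2 - c) ^ 2) ≤ π / m := by
    rw [← intervalIntegral.integral_add_adjacent_intervals (hc1.intervalIntegrable _ 0)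
      (hc1.intervalIntegrable _ _)]
    have e : π / m = π / (2 * m) + π / (2 * m) := by
      field_simp
      norm_num
    linarith
  have i4 : ∫ s in (-3 : ℝ)..3, 1 / (1 + m ^ 2 * s ^ 2) ≤ π / m := by
    have := integral_one_div_one_add_mul_sq_le (f := fun s => s) (f' := fun _ => 1) (a := -3)
      (b := 3) (k := m ^ 2) (m := 1) (by norm_num) (by positivity) one_pos
      (fun x _ => hasDerivAt_id x) continuousOn_const (Or.inl fun x _ => le_rfl)
    rwa [Real.sqrt_sq hm0.le, one_mul] at this
  calc ∫ s in (-3 : ℝ)..3, cuspWeight m s c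
      ≤ ∫ s in (-3 : ℝ)..3, (2 * (m * |s| / (1 + m ^ 4 * (s ^ 2 - c) ^ 2))
        + 2 * (1 / (1 + m ^ 2 * s ^ 2)) + 1 / m) :=
        intervalIntegral.integral_mono_on (by norm_num) (hcW.intervalIntegrable _ _)
          ((((continuous_const.mul hc1).add (continuous_const.mul hc2)).add
            continuous_const).intervalIntegrable _ _) fun s _ => cuspWeight_le hm s c
    _ = 2 * (∫ s in (-3 : ℝ)..3, m * |s| / (1 + m ^ 4 * (s ^ 2 - c) ^ 2))
        + 2 * (∫ s in (-3 : ℝ)..3, 1 / (1 + m ^ 2 * s ^ 2)) + 6 / m := by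
        have j1 : IntervalIntegrable
            (fun s => 2 * (m * |s| / (1 + m ^ 4 * (s ^ 2 - c) ^ 2))) volume (-3) 3 :=
          (hc1.const_mul 2).intervalIntegrable _ _
        have j2 : IntervalIntegrable (fun s => 2 * (1 / (1 + m ^ 2 * s ^ 2))) volume (-3) 3 :=
          (hc2.const_mul 2).intervalIntegrable _ _
        rw [intervalIntegral.integral_add (j1.add j2) (continuous_const.intervalIntegrable _ _),
          intervalIntegral.integral_add j1 j2, intervalIntegral.integral_const_mul,
          intervalIntegral.integral_const_mul, intervalIntegral.integral_const, smul_eq_mul]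
        ring
    _ ≤ (4 * π + 6) / m := by
        have e : (4 * π + 6) / m = 2 * (π / m) + 2 * (π / m) + 6 / m := by ring
        linarith
    _ ≤ 20 / m := by
        gcongr
        linarith [Real.pi_lt_d2]

/-- The number of reflections is controlled by this weight. -/
noncomputable def defectWeight (m a X Y T S Υ A : ℝ) : ℝ :=
  √(|T| / m ^ 9) * (1 / (1 + m ^ 3 / |T| * scalingDefect a X Y T S Υ A ^ 2)) + 1 / m ^ 6

theorem travelTimeDeriv_ge {a A : ℝ} (ha : 0 < a) (ha1 : a ≤ 1 / 2) (hA0 : 0 < A) (hA : A ≤ 6) :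
    1 / 4 ≤ travelTimeDeriv a A := by
  have h1 : 1 ≤ √(1 + a) := Real.one_le_sqrt.2 (by linarith)
  have h2 : √(1 + a * A) ≤ 2 := Real.sqrt_le_iff.2 ⟨by norm_num, by nlinarith⟩
  have h3 : 0 < √(1 + a * A) := Real.sqrt_pos.2 (by positivity)
  rw [travelTimeDeriv, div_le_div_iff₀ (by norm_num) (by positivity)]
  linarith

theorem setLIntegral_defectWeight_le {m a T Υ : ℝ} (hm : 1 ≤ m) (ha : 0 < a) (ha1 : a ≤ 1 / 2)
    (hT : 24 ≤ |T|) (hΥ : Υ ∈ Set.Icc (-3 : ℝ) 3) (X Y : ℝ) :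
    ∫⁻ A in Set.Icc (9 / 10 : ℝ) 6, ENNReal.ofReal (defectWeight m a X Y T 0 Υ A)
      ≤ ENNReal.ofReal (60 / m ^ 6) := by
  have hm0 : 0 < m := by linarith
  have hτ : 0 < |T| := by linarith
  have hpos : ∀ A ∈ Set.Icc (9 / 10 : ℝ) 6, 0 < A := fun A hA => by linarith [hA.1]
  have hder : ∀ A ∈ Set.Icc (9 / 10 : ℝ) 6, HasDerivAt (scalingDefect a X Y T 0 Υ)
      (scalingDefectDeriv a T 0 Υ A) A := fun A hA =>
    hasDerivAt_scalingDefect ha (hpos A hA) X Y T 0 Υ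
  have hcH : ContinuousOn (scalingDefect a X Y T 0 Υ) (Set.Icc (9 / 10) 6) := fun A hA =>
    (hder A hA).continuousAt.continuousWithinAt
  have hc' : ContinuousOn (scalingDefectDeriv a T 0 Υ) (Set.Icc (9 / 10) 6) := by
    have s1 : Set.Icc (9 / 10 : ℝ) 6 ⊆ Set.Ioi 0 := hpos
    unfold scalingDefectDeriv
    exact ((((continuousOn_travelTimeDeriv a ha).mono s1).const_mul T).div_const 2).neg.add
      ((continuousOn_const.mul continuousOn_id).mul
        ((continuousOn_travelTimeDeriv₂ a ha).mono s1)) |>.add continuousOn_const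
  have hcD : ContinuousOn (fun A => 1 / (1 + m ^ 3 / |T| * scalingDefect a X Y T 0 Υ A ^ 2))
      (Set.Icc (9 / 10) 6) :=
    continuousOn_const.div (continuousOn_const.add (continuousOn_const.mul (hcH.pow 2)))
      fun A _ => by positivity
  refine setLIntegral_ofReal_le (by norm_num)
    ((continuousOn_const.mul hcD).add continuousOn_const)
    (fun A _ => add_nonneg (mul_nonneg (Real.sqrt_nonneg _) (by positivity)) (by positivity)) ?_
  have hbr : ∀ A ∈ Set.Icc (9 / 10 : ℝ) 6,
      -(travelTimeDeriv a A / 2) + A * travelTimeDeriv₂ a A ≤ -(1 / 8) := fun A hA => by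
    have h1 := travelTimeDeriv_ge ha ha1 (hpos A hA) hA.2
    have h2 := (travelTimeDeriv₂_mem ha (by linarith) (hpos A hA)).2
    nlinarith [mul_nonneg (hpos A hA).le (neg_nonneg.2 h2)]
  have e : ∀ A, scalingDefectDeriv a T 0 Υ A
      = T * (-(travelTimeDeriv a A / 2) + A * travelTimeDeriv₂ a A) + Υ / 2 := fun A => by
    rw [scalingDefectDeriv]
    ring
  have hsgn : (∀ A ∈ Set.Icc (9 / 10 : ℝ) 6, |T| / 16 ≤ scalingDefectDeriv a T 0 Υ A)
      ∨ ∀ A ∈ Set.Icc (9 / 10 : ℝ) 6, scalingDefectDeriv a T 0 Υ A ≤ -(|T| / 16) := by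
    rcases le_total 0 T with h | h
    · right
      intro A hA
      rw [abs_of_nonneg h] at *
      have := mul_le_mul_of_nonneg_left (hbr A hA) h
      rw [e]
      linarith [hΥ.2]
    · left
      intro A hA
      rw [abs_of_nonpos h] at *
      have := mul_le_mul_of_nonpos_left (hbr A hA) h
      rw [e]
      linarith [hΥ.1]
  have hI := integral_one_div_one_add_mul_sq_le (by norm_num : (9 / 10 : ℝ) ≤ 6)
    (by positivity : 0 < m ^ 3 / |T|) (by positivity : 0 < |T| / 16) hder hc' hsgn
  have hi : IntervalIntegrable (fun A => 1 / (1 + m ^ 3 / |T| * scalingDefect a X Y T 0 Υ A ^ 2))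
      volume (9 / 10) 6 := by
    refine ContinuousOn.intervalIntegrable ?_
    rwa [Set.uIcc_of_le (by norm_num)]
  have hsq : √(|T| / m ^ 9) * (π / (|T| / 16 * √(m ^ 3 / |T|))) = 16 * π / m ^ 6 := by
    have e1 : √(|T| / m ^ 9) = |T| / m ^ 6 * √(m ^ 3 / |T|) := by
      rw [← Real.sqrt_sq (by positivity : 0 ≤ |T| / m ^ 6), ← Real.sqrt_mul (by positivity)]
      congr 1
      field_simp
    have : 0 < √(m ^ 3 / |T|) := Real.sqrt_pos.2 (by positivity)
    rw [e1]
    generalize √(m ^ 3 / |T|) = q at *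
    generalize |T| = τ at *
    field_simp
  calc ∫ A in (9 / 10 : ℝ)..6, defectWeight m a X Y T 0 Υ A
      = √(|T| / m ^ 9) * (∫ A in (9 / 10 : ℝ)..6,
          1 / (1 + m ^ 3 / |T| * scalingDefect a X Y T 0 Υ A ^ 2)) + 51 / 10 * (1 / m ^ 6) := by
        unfold defectWeight
        rw [intervalIntegral.integral_add (hi.const_mul _)
          (continuous_const.intervalIntegrable _ _), intervalIntegral.integral_const_mul,
          intervalIntegral.integral_const, smul_eq_mul]
        norm_num
    _ ≤ √(|T| / m ^ 9) * (π / (|T| / 16 * √(m ^ 3 / |T|))) + 51 / 10 * (1 / m ^ 6) := by gcongr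
    _ = (16 * π + 51 / 10) / m ^ 6 := by
        rw [hsq]
        ring
    _ ≤ 60 / m ^ 6 := by
        gcongr
        linarith [Real.pi_lt_d2]

theorem defectWeight_nonneg {m : ℝ} (hm : 1 ≤ m) (a X Y T S Υ A : ℝ) :
    0 ≤ defectWeight m a X Y T S Υ A := by
  have : 0 < m := by linarith
  unfold defectWeight
  positivity

theorem defectWeight_le_of_abs_sub_le {m a X Y T S Υ S' Υ' A : ℝ} (hm : 1 ≤ m)
    (hT : m ^ 6 ≤ |T|)
    (h : |scalingDefect a X Y T S' Υ' A - scalingDefect a X Y T S Υ A| ≤ 140) :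
    defectWeight m a X Y T S Υ A ≤ 40000 * defectWeight m a X Y T S' Υ' A := by
  have hm0 : 0 < m := by linarith
  have hm6 : 1 ≤ m ^ 6 := one_le_pow₀ hm
  have hτ : 0 < |T| := by linarith
  have hk : m ^ 3 / |T| ≤ 1 := by
    rw [div_le_one hτ]
    exact (pow_le_pow_right₀ hm (by norm_num : 3 ≤ 6)).trans hT
  have hk0 : 0 ≤ m ^ 3 / |T| := by positivity
  have hm6' : 0 ≤ 1 / m ^ 6 := by positivity
  have hρ := Real.sqrt_nonneg (|T| / m ^ 9)
  unfold defectWeight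
  generalize scalingDefect a X Y T S' Υ' A = p at *
  generalize scalingDefect a X Y T S Υ A = q at *
  generalize m ^ 3 / |T| = k at *
  have hpq : (p - q) ^ 2 ≤ 140 ^ 2 := sq_le_sq.2 (by rwa [abs_of_pos (by norm_num : (0:ℝ) < 140)])
  have h1 : p ^ 2 ≤ 2 * q ^ 2 + 2 * 140 ^ 2 := by nlinarith [sq_nonneg (p - 2 * q)]
  have h2 : 1 + k * p ^ 2 ≤ 40000 * (1 + k * q ^ 2) := by
    nlinarith [mul_le_mul_of_nonneg_left h1 hk0, mul_nonneg hk0 (sq_nonneg q)]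
  have h3 : 1 / (1 + k * q ^ 2) ≤ 40000 * (1 / (1 + k * p ^ 2)) := by
    rw [mul_one_div, div_le_div_iff₀ (by positivity) (by positivity)]
    linarith
  nlinarith [mul_le_mul_of_nonneg_left h3 hρ]

theorem abs_cube_third_le {x : ℝ} (hx : x ∈ Set.Icc (-3 : ℝ) 3) : |x ^ 3 / 3| ≤ 9 := by
  have : |x| ≤ 3 := abs_le.2 hx
  have h2 : |x| ^ 3 ≤ 3 ^ 3 := pow_le_pow_left₀ (abs_nonneg x) this 3
  rw [abs_div, abs_pow, abs_of_pos (by norm_num : (0 : ℝ) < 3)]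
  linarith

theorem defectWeight_le_zero_left {m a X Y T S Υ A : ℝ} (hm : 1 ≤ m) (hT : m ^ 6 ≤ |T|)
    (hS : S ∈ Set.Icc (-3 : ℝ) 3) (hA : A ∈ Set.Icc (9 / 10 : ℝ) 6) :
    defectWeight m a X Y T S Υ A ≤ 40000 * defectWeight m a X Y T 0 Υ A := by
  refine defectWeight_le_of_abs_sub_le hm hT ?_
  have h1 := abs_le.1 (abs_cube_third_le hS)
  have e : scalingDefect a X Y T 0 Υ A - scalingDefect a X Y T S Υ A
      = 3 / 2 * (S ^ 3 / 3 + S) - S / 2 * A := by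
    unfold scalingDefect
    ring
  rw [e, abs_le]
  constructor <;> nlinarith [h1.1, h1.2, hS.1, hS.2, hA.1, hA.2]

theorem defectWeight_le_zero {m a X Y T Υ A : ℝ} (hm : 1 ≤ m) (hT : m ^ 6 ≤ |T|)
    (hX : 0 ≤ X) (hX' : X ≤ 20) (hΥ : Υ ∈ Set.Icc (-3 : ℝ) 3) (hA : A ∈ Set.Icc (9 / 10 : ℝ) 6) :
    defectWeight m a X Y T 0 Υ A ≤ 40000 * defectWeight m a X Y T 0 0 A := by
  refine defectWeight_le_of_abs_sub_le hm hT ?_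
  have h1 := abs_le.1 (abs_cube_third_le hΥ)
  have e : scalingDefect a X Y T 0 0 A - scalingDefect a X Y T 0 Υ A
      = 3 / 2 * (Υ ^ 3 / 3 + Υ * X) - Υ / 2 * A := by
    unfold scalingDefect
    ring
  rw [e, abs_le]
  constructor <;> nlinarith [h1.1, h1.2, hΥ.1, hΥ.2, hA.1, hA.2]

theorem cuspWeight_le_of_le {m s c : ℝ} (hm : 1 ≤ m) (hs : s ∈ Set.Icc (-3 : ℝ) 3)
    (hc : c ≤ -14) : cuspWeight m s c ≤ 2 / m := by
  have hm0 : 0 < m := by linarith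
  have hs' : |s| ≤ 3 := abs_le.2 hs
  have h1 : 14 ≤ s ^ 2 - c := by nlinarith [sq_nonneg s]
  have h2 : 196 ≤ (s ^ 2 - c) ^ 2 := by nlinarith
  have h3 : (1 + m * |s|) / (1 + m ^ 4 * (s ^ 2 - c) ^ 2) ≤ 1 / m := by
    rw [div_le_div_iff₀ (by positivity) hm0]
    have h4 : m ^ 4 * 196 ≤ m ^ 4 * (s ^ 2 - c) ^ 2 := by gcongr
    have h5 : m * |s| ≤ m * 3 := by gcongr
    have h6 : m ^ 2 ≤ m ^ 4 := pow_le_pow_right₀ hm (by norm_num)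
    nlinarith
  have e : (2 : ℝ) / m = 1 / m + 1 / m := by ring
  rw [cuspWeight, e]
  linarith

theorem lintegral_cuspWeight_mul_defectWeight_le {m a T X : ℝ} (hm : 1 ≤ m) (ha : 0 < a)
    (ha1 : a ≤ 1 / 2) (hT : 24 ≤ |T|) (hT' : m ^ 6 ≤ |T|) (hX : 0 ≤ X) (Y : ℝ) :
    ∫⁻ S in Set.Icc (-3 : ℝ) 3, ∫⁻ Υ in Set.Icc (-3 : ℝ) 3, ∫⁻ A in Set.Icc (9 / 10 : ℝ) 6,
      ENNReal.ofReal (cuspWeight m S (A - 1) * cuspWeight m Υ (A - X)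
        * defectWeight m a X Y T S Υ A) ≤ ENNReal.ofReal (10 ^ 15 / m ^ 8) := by
  have hm0 : 0 < m := by linarith
  have hW : ∀ s c, 0 ≤ cuspWeight m s c := cuspWeight_nonneg hm0
  have hE := defectWeight_nonneg hm a X Y T
  have mW : Measurable fun p : ℝ × ℝ => cuspWeight m p.1 p.2 := by
    unfold cuspWeight
    fun_prop
  have mE : Measurable fun p : ℝ × ℝ => defectWeight m a X Y T 0 p.1 p.2 := by
    unfold defectWeight scalingDefect travelTime travelTimeDeriv
    fun_prop
  have m1 : Measurable fun p : ℝ × ℝ => ENNReal.ofReal (cuspWeight m p.1 (p.2 - 1)) :=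
    (mW.comp (show Measurable fun p : ℝ × ℝ => (p.1, p.2 - 1) by fun_prop)).ennreal_ofReal
  have m2 : Measurable fun p : ℝ × ℝ => ENNReal.ofReal (cuspWeight m p.1 (p.2 - X)) :=
    (mW.comp (show Measurable fun p : ℝ × ℝ => (p.1, p.2 - X) by fun_prop)).ennreal_ofReal
  have mE0 : Measurable fun A => ENNReal.ofReal (40000 * 40000 * defectWeight m a X Y T 0 0 A) :=
    ((mE.comp (show Measurable fun A : ℝ => ((0 : ℝ), A) by fun_prop)).const_mul _).ennreal_ofReal
  have hlast : ∫⁻ Υ in Set.Icc (-3 : ℝ) 3, ∫⁻ A in Set.Icc (9 / 10 : ℝ) 6,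
      ENNReal.ofReal (cuspWeight m Υ (A - X)) *
          ENNReal.ofReal (40000 * defectWeight m a X Y T 0 Υ A)
      ≤ ENNReal.ofReal (2 * 10 ^ 12 / m ^ 7) := by
    rcases le_total X 20 with hX' | hX'
    · calc _ ≤ ∫⁻ Υ in Set.Icc (-3 : ℝ) 3, ∫⁻ A in Set.Icc (9 / 10 : ℝ) 6,
            ENNReal.ofReal (cuspWeight m Υ (A - X)) *
              ENNReal.ofReal (40000 * 40000 * defectWeight m a X Y T 0 0 A) := by
            refine setLIntegral_mono' measurableSet_Icc fun Υ hΥ =>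
              setLIntegral_mono' measurableSet_Icc fun A hA => ?_
            refine mul_le_mul_right (ENNReal.ofReal_le_ofReal ?_) _
            have := defectWeight_le_zero (a := a) (Y := Y) hm hT' hX hX' hΥ hA
            linarith
        _ ≤ ENNReal.ofReal (20 / m) * ∫⁻ A in Set.Icc (9 / 10 : ℝ) 6,
            ENNReal.ofReal (40000 * 40000 * defectWeight m a X Y T 0 0 A) :=
          lintegral_lintegral_mul_le m2 mE0 fun A => setLIntegral_cuspWeight_le hm _
        _ ≤ ENNReal.ofReal (20 / m) *
            (ENNReal.ofReal (40000 * 40000) * ENNReal.ofReal (60 / m ^ 6)) := by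
          refine mul_le_mul_right ?_ _
          simp only [ENNReal.ofReal_mul (by norm_num : (0 : ℝ) ≤ 40000 * 40000)]
          rw [lintegral_const_mul' _ _ ENNReal.ofReal_ne_top]
          exact mul_le_mul_right
            (setLIntegral_defectWeight_le hm ha ha1 hT (by norm_num) X Y) _
        _ ≤ _ := by
          rw [← ENNReal.ofReal_mul (by positivity), ← ENNReal.ofReal_mul (by positivity)]
          refine ENNReal.ofReal_le_ofReal ?_
          rw [show 20 / m * (40000 * 40000 * (60 / m ^ 6)) = 20 * (40000 * 40000 * 60) / m ^ 7 by
            field_simp]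
          refine div_le_div_of_nonneg_right ?_ (by positivity)
          norm_num
    · calc _ ≤ ∫⁻ Υ in Set.Icc (-3 : ℝ) 3, ENNReal.ofReal (2 / m) *
              (ENNReal.ofReal 40000 * ENNReal.ofReal (60 / m ^ 6)) := by
            refine setLIntegral_mono' measurableSet_Icc fun Υ hΥ => ?_
            refine (setLIntegral_mono' (g := fun A => ENNReal.ofReal (2 / m) *
              (ENNReal.ofReal 40000 * ENNReal.ofReal (defectWeight m a X Y T 0 Υ A)))
              measurableSet_Icc fun A hA => ?_).trans ?_
            · rw [ENNReal.ofReal_mul (by norm_num : (0 : ℝ) ≤ 40000)]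
              exact mul_le_mul_left (ENNReal.ofReal_le_ofReal
                (cuspWeight_le_of_le hm hΥ (by linarith [hA.2]))) _
            · rw [lintegral_const_mul' _ _ ENNReal.ofReal_ne_top,
                lintegral_const_mul' _ _ ENNReal.ofReal_ne_top]
              exact mul_le_mul_right (mul_le_mul_right
                (setLIntegral_defectWeight_le hm ha ha1 hT hΥ X Y) _) _
        _ ≤ _ := by
          rw [setLIntegral_const, Real.volume_Icc, ← ENNReal.ofReal_mul (by positivity),
            ← ENNReal.ofReal_mul (by positivity), ← ENNReal.ofReal_mul (by positivity)]
          refine ENNReal.ofReal_le_ofReal ?_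
          rw [show 2 / m * (40000 * (60 / m ^ 6)) * (3 - -3) = 2 * (40000 * 60) * 6 / m ^ 7 by
            field_simp
            norm_num]
          refine div_le_div_of_nonneg_right ?_ (by positivity)
          norm_num
  calc _ ≤ ∫⁻ S in Set.Icc (-3 : ℝ) 3, ∫⁻ Υ in Set.Icc (-3 : ℝ) 3, ∫⁻ A in Set.Icc (9 / 10 : ℝ) 6,
        ENNReal.ofReal (cuspWeight m S (A - 1)) * (ENNReal.ofReal (cuspWeight m Υ (A - X)) *
          ENNReal.ofReal (40000 * defectWeight m a X Y T 0 Υ A)) := by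
        refine setLIntegral_mono' measurableSet_Icc fun S hS =>
          setLIntegral_mono' measurableSet_Icc fun Υ hΥ =>
          setLIntegral_mono' measurableSet_Icc fun A hA => ?_
        rw [← ENNReal.ofReal_mul (hW _ _), ← ENNReal.ofReal_mul (hW _ _), mul_assoc]
        exact ENNReal.ofReal_le_ofReal (mul_le_mul_of_nonneg_left (mul_le_mul_of_nonneg_left
          (defectWeight_le_zero_left hm hT' hS hA) (hW _ _)) (hW _ _))
    _ ≤ ENNReal.ofReal (20 / m) * ∫⁻ Υ in Set.Icc (-3 : ℝ) 3, ∫⁻ A in Set.Icc (9 / 10 : ℝ) 6,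
        ENNReal.ofReal (cuspWeight m Υ (A - X)) *
          ENNReal.ofReal (40000 * defectWeight m a X Y T 0 Υ A) :=
        lintegral_lintegral_lintegral_mul_le m1 (m2.mul (mE.const_mul _).ennreal_ofReal)
          fun A => setLIntegral_cuspWeight_le hm _
    _ ≤ ENNReal.ofReal (20 / m) * ENNReal.ofReal (2 * 10 ^ 12 / m ^ 7) := mul_le_mul_right hlast _
    _ ≤ _ := by
        rw [← ENNReal.ofReal_mul (by positivity)]
        refine ENNReal.ofReal_le_ofReal ?_
        rw [show 20 / m * (2 * 10 ^ 12 / m ^ 7) = 20 * (2 * 10 ^ 12) / m ^ 8 by field_simp]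
        gcongr
        norm_num

theorem lintegral_le_of_eq_zero_of_le {F G : ℝ → ENNReal} {I : Set ℝ} (hI : MeasurableSet I)
    (h0 : ∀ x ∉ I, F x = 0) (h : ∀ x ∈ I, F x ≤ G x) : ∫⁻ x, F x ≤ ∫⁻ x in I, G x := by
  rw [← lintegral_indicator hI]
  refine lintegral_mono fun x => ?_
  by_cases hx : x ∈ I
  · rw [Set.indicator_of_mem hx]
    exact h x hx
  · rw [h0 x hx]
    exact zero_le

theorem rpow_three_halves_mem {A : ℝ} (hA : A ∈ Set.Icc (9 / 10 : ℝ) 6) :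
    1 / 2 ≤ A ^ ((3 : ℝ) / 2) ∧ A ^ ((3 : ℝ) / 2) ≤ 36 := by
  have hA0 : 0 < A := by linarith [hA.1]
  have h1 : A ^ ((3 : ℝ) / 2) = A * √A := by
    rw [Real.sqrt_eq_rpow, ← Real.rpow_one_add' hA0.le (by norm_num)]
    norm_num
  have h2 : 6 / 10 ≤ √A := Real.le_sqrt_of_sq_le (by linarith [hA.1])
  have h3 : √A ≤ 6 := Real.sqrt_le_iff.2 ⟨by norm_num, by linarith [hA.2]⟩
  rw [h1]
  constructor <;> nlinarith [hA.1, hA.2]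

theorem abs_mul_travelTimeDeriv_mem {a S Υ A T : ℝ} (ha : 0 < a) (ha1 : a ≤ 1 / 2)
    (hT : 1500 ≤ |T|) (hS : S ∈ Set.Icc (-3 : ℝ) 3) (hΥ : Υ ∈ Set.Icc (-3 : ℝ) 3)
    (hA : A ∈ Set.Icc (9 / 10 : ℝ) 6) :
    |T| / 5 ≤ |A * (-S - Υ + T * travelTimeDeriv a A)| ∧
      |A * (-S - Υ + T * travelTimeDeriv a A)| ≤ 7 * |T| := by
  have hA0 : 0 < A := by linarith [hA.1]
  have h1 := travelTimeDeriv_ge ha ha1 hA0 hA.2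
  have h2 := travelTimeDeriv_le_one ha (by linarith) hA0
  have h3 : |S + Υ| ≤ 6 := by
    rw [abs_le]
    constructor <;> linarith [hS.1, hS.2, hΥ.1, hΥ.2]
  have e : -S - Υ + T * travelTimeDeriv a A = T * travelTimeDeriv a A - (S + Υ) := by ring
  have h4 : |T * travelTimeDeriv a A| = |T| * travelTimeDeriv a A := by
    rw [abs_mul, abs_of_pos (show 0 < travelTimeDeriv a A by linarith)]
  have h5 := abs_sub_abs_le_abs_sub (T * travelTimeDeriv a A) (S + Υ)
  have h6 := abs_sub (T * travelTimeDeriv a A) (S + Υ)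
  rw [h4] at h5 h6
  rw [abs_mul, abs_of_pos hA0, e]
  generalize |T * travelTimeDeriv a A - (S + Υ)| = w at *
  have h7 : |T| / 4 - 6 ≤ w := by nlinarith [abs_nonneg T]
  have h8 : w ≤ |T| + 6 := by nlinarith [abs_nonneg T]
  constructor <;> nlinarith [hA.1, hA.2]

section Sum

variable {ℓ q q₁ q₂ : ℝ → ℝ} {γ c C : ℝ} (hℓ : IsAlmostLinearPhase ℓ q q₁ q₂ γ c C)
include hℓ

/-- Summing over the number of reflections after all the integrations by parts. -/
theorem exists_sum_integral_oscFactor_le {ζ : ℝ → ℝ} (hζ : IsFrequencyCutoff ζ) :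
    ∃ K > 0, ∃ m₀ ≥ 10, ∀ m ≥ m₀, ∀ a X Y T : ℝ, 0 < a → a ≤ 1 / 2 → m ^ 6 ≤ |T| → 0 ≤ X →
    ∀ M ≥ 0, ∀ y, IsScalingAmplitude m a X Y T M y → ∀ s : Finset ℤ,
    ∑ N ∈ s, ‖∫ z, oscFactor ℓ (m ^ 3) a X Y T N z * ((y z * ζ z.2.2.2 : ℝ) : ℂ)‖
      ≤ K * M / m ^ 8 := by
  obtain ⟨K, hK, κ₀, hκ₀, hsum⟩ := exists_sum_phaseIntegral_le hℓ hζ.smooth hζ.support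
    (δ := 1 / 10 ^ 6) (by norm_num) (by norm_num)
  refine ⟨2000 * K * 10 ^ 15, by positivity, max 10 (2 * κ₀), le_max_left _ _,
    fun m hm a X Y T ha ha1 hT hX M hM y hy s => ?_⟩
  have hm10 : 10 ≤ m := (le_max_left _ _).trans hm
  have hmκ : 2 * κ₀ ≤ m := (le_max_right _ _).trans hm
  have hm1 : 1 ≤ m := by linarith
  have hm0 : 0 < m := by linarith
  have hτ : 1500 ≤ |T| := by
    have : (10 : ℝ) ^ 6 ≤ m ^ 6 := pow_le_pow_left₀ (by norm_num) hm10 6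
    linarith
  have hpt : ∀ S ∈ Set.Icc (-3 : ℝ) 3, ∀ Υ ∈ Set.Icc (-3 : ℝ) 3, ∀ A ∈ Set.Icc (9 / 10 : ℝ) 6,
      |y (S, Υ, A, 1)| * ∑ N ∈ s, ‖phaseIntegral ℓ ζ (m ^ 3 * A ^ ((3 : ℝ) / 2))
        (cubicPhase a X Y T S Υ A / A ^ ((3 : ℝ) / 2)) N‖
      ≤ 2000 * K * M * (cuspWeight m S (A - 1) * cuspWeight m Υ (A - X)
        * defectWeight m a X Y T S Υ A) := fun S hS Υ hΥ A hA => by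
    obtain ⟨hr, hr'⟩ := rpow_three_halves_mem hA
    obtain ⟨hQ1, hQ2⟩ := abs_mul_travelTimeDeriv_mem ha ha1 hτ hS hΥ hA
    have hκ : κ₀ ≤ m ^ 3 * A ^ ((3 : ℝ) / 2) := by
      have : m ≤ m ^ 3 := le_self_pow₀ hm1 (by norm_num)
      nlinarith
    obtain ⟨hR1, hR2⟩ := hsum _ hκ (cubicPhase a X Y T S Υ A / A ^ ((3 : ℝ) / 2)) s
    have key := scaling_weight_mul_le hm1 hT hK hr hr' (H := scalingDefect a X Y T S Υ A)
      (P := cubicPhase a X Y T S Υ A) (by rw [scalingDefect_eq]; ring) hQ1 hQ2 hR1 hR2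
    have hb := hy.bound S hS Υ hΥ A hA
    have hW := mul_nonneg (cuspWeight_nonneg hm0 S (A - 1)) (cuspWeight_nonneg hm0 Υ (A - X))
    have hR0 := Finset.sum_nonneg fun N (_ : N ∈ s) => norm_nonneg
      (phaseIntegral ℓ ζ (m ^ 3 * A ^ ((3 : ℝ) / 2))
        (cubicPhase a X Y T S Υ A / A ^ ((3 : ℝ) / 2)) N)
    change scalingWeight m a X Y T S Υ A * _ ≤ 2000 * K * defectWeight m a X Y T S Υ A at key
    generalize ∑ N ∈ s, ‖phaseIntegral ℓ ζ (m ^ 3 * A ^ ((3 : ℝ) / 2))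
        (cubicPhase a X Y T S Υ A / A ^ ((3 : ℝ) / 2)) N‖ = R at *
    generalize cuspWeight m S (A - 1) * cuspWeight m Υ (A - X) = W at *
    generalize scalingWeight m a X Y T S Υ A = E at *
    generalize defectWeight m a X Y T S Υ A = E' at *
    calc |y (S, Υ, A, 1)| * R ≤ M * (W * E) * R := by gcongr
      _ = M * W * (E * R) := by ring
      _ ≤ M * W * (2000 * K * E') := by gcongr
      _ = _ := by ring
  have hzero : ∀ N : ℤ, ∀ z ∉ amplitudeBox,
      oscFactor ℓ (m ^ 3) a X Y T N z * ((y z * ζ z.2.2.2 : ℝ) : ℂ) = 0 := fun N z hz => by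
    obtain ⟨S, Υ, A, η⟩ := z
    have : y (S, Υ, A, η) * ζ η = 0 := by
      by_cases h1 : S ∈ Set.Icc (-3 : ℝ) 3 ∧ Υ ∈ Set.Icc (-3 : ℝ) 3 ∧ A ∈ Set.Icc (9 / 10 : ℝ) 6
      · rw [hζ.eq_zero fun h2 => hz ⟨h1.1, h1.2.1, h1.2.2, h2⟩, mul_zero]
      · rw [hy.const, hy.eq_zero S Υ A h1, zero_mul]
    simp only [this, Complex.ofReal_zero, mul_zero]
  have hcont : ∀ N : ℤ, ContinuousOn
      (fun z => oscFactor ℓ (m ^ 3) a X Y T N z * ((y z * ζ z.2.2.2 : ℝ) : ℂ)) amplitudeBox :=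
    fun N => (continuousOn_oscFactor hℓ (pow_pos hm0 3) ha X Y T N).mul
      (Complex.continuous_ofReal.comp_continuousOn (hy.cont.mul
        ((hζ.smooth.continuous.comp
            (by fun_prop : Continuous fun z : ℝ × ℝ × ℝ × ℝ => z.2.2.2)).continuousOn)))
  have hmain := sum_enorm_integral_le (isCompact_Icc (a := (-3 : ℝ)) (b := 3))
    (isCompact_Icc (a := (-3 : ℝ)) (b := 3)) (isCompact_Icc (a := (9 / 10 : ℝ)) (b := 6))
    (isCompact_Icc (a := (1 / 2 : ℝ)) (b := 3 / 2)) s hcont hzero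
    (B := fun S Υ A => ∑ N ∈ s, ‖∫ η, oscFactor ℓ (m ^ 3) a X Y T N (S, Υ, A, η)
      * ((y (S, Υ, A, η) * ζ η : ℝ) : ℂ)‖ₑ) fun _ _ _ => le_rfl
  have hB0 : ∀ S Υ A, ¬(S ∈ Set.Icc (-3 : ℝ) 3 ∧ Υ ∈ Set.Icc (-3 : ℝ) 3 ∧
      A ∈ Set.Icc (9 / 10 : ℝ) 6) → ∑ N ∈ s, ‖∫ η, oscFactor ℓ (m ^ 3) a X Y T N (S, Υ, A, η)
      * ((y (S, Υ, A, η) * ζ η : ℝ) : ℂ)‖ₑ = 0 := fun S Υ A h => by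
    refine Finset.sum_eq_zero fun N _ => ?_
    simp [hy.const, hy.eq_zero S Υ A h]
  have hB : ∀ S ∈ Set.Icc (-3 : ℝ) 3, ∀ Υ ∈ Set.Icc (-3 : ℝ) 3, ∀ A ∈ Set.Icc (9 / 10 : ℝ) 6,
      ∑ N ∈ s, ‖∫ η, oscFactor ℓ (m ^ 3) a X Y T N (S, Υ, A, η)
      * ((y (S, Υ, A, η) * ζ η : ℝ) : ℂ)‖ₑ ≤ ENNReal.ofReal (2000 * K * M)
        * ENNReal.ofReal (cuspWeight m S (A - 1) * cuspWeight m Υ (A - X)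
        * defectWeight m a X Y T S Υ A) := fun S hS Υ hΥ A hA => by
    rw [← ENNReal.ofReal_mul (by positivity)]
    refine le_trans (le_of_eq ?_) (ENNReal.ofReal_le_ofReal (hpt S hS Υ hΥ A hA))
    rw [Finset.mul_sum, ENNReal.ofReal_sum_of_nonneg fun N _ => by positivity]
    refine Finset.sum_congr rfl fun N _ => ?_
    simp only [hy.const S Υ A]
    rw [integral_oscFactor ℓ ζ (m ^ 3) a X Y T S Υ (by linarith [hA.1] : 0 < A), ← ofReal_norm,
      norm_mul, Complex.norm_real, Real.norm_eq_abs]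
  have htot : ∑ N ∈ s, ‖∫ z, oscFactor ℓ (m ^ 3) a X Y T N z * ((y z * ζ z.2.2.2 : ℝ) : ℂ)‖ₑ
      ≤ ENNReal.ofReal (2000 * K * M) * ENNReal.ofReal (10 ^ 15 / m ^ 8) := by
    refine hmain.trans ?_
    calc _ ≤ ∫⁻ S in Set.Icc (-3 : ℝ) 3, ∫⁻ Υ in Set.Icc (-3 : ℝ) 3,
          ∫⁻ A in Set.Icc (9 / 10 : ℝ) 6, ENNReal.ofReal (2000 * K * M)
          * ENNReal.ofReal (cuspWeight m S (A - 1) * cuspWeight m Υ (A - X)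
          * defectWeight m a X Y T S Υ A) := by
          refine lintegral_le_of_eq_zero_of_le measurableSet_Icc (fun S hS => ?_) fun S hS =>
            lintegral_le_of_eq_zero_of_le measurableSet_Icc (fun Υ hΥ => ?_) fun Υ hΥ =>
            lintegral_le_of_eq_zero_of_le measurableSet_Icc
                (fun A hA => hB0 S Υ A fun h => hA h.2.2)
            fun A hA => hB S hS Υ hΥ A hA
          · simp only [hB0 S _ _ fun h => hS h.1, lintegral_zero]
          · simp only [hB0 S Υ _ fun h => hΥ h.2.1, lintegral_zero]
      _ = ENNReal.ofReal (2000 * K * M) * ∫⁻ S in Set.Icc (-3 : ℝ) 3,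
          ∫⁻ Υ in Set.Icc (-3 : ℝ) 3, ∫⁻ A in Set.Icc (9 / 10 : ℝ) 6,
          ENNReal.ofReal (cuspWeight m S (A - 1) * cuspWeight m Υ (A - X)
          * defectWeight m a X Y T S Υ A) := by
          simp only [lintegral_const_mul' _ _ ENNReal.ofReal_ne_top]
      _ ≤ _ := mul_le_mul_right (lintegral_cuspWeight_mul_defectWeight_le hm1 ha ha1
          (by linarith) hT hX Y) _
  simp only [← ofReal_norm] at htot
  rw [← ENNReal.ofReal_sum_of_nonneg fun N _ => norm_nonneg _,
    ← ENNReal.ofReal_mul (by positivity), ENNReal.ofReal_le_ofReal_iff (by positivity)] at htot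
  exact htot.trans_eq (by ring)

end Sum

/-- The contributions `I m a X Y T N` of the reflections sum to `O(m⁻⁸)` at times beyond `m⁶`. -/
def HasReflectionBound (I : ℝ → ℝ → ℝ → ℝ → ℝ → ℤ → ℂ) : Prop :=
  ∃ K > 0, ∃ m₀ ≥ (10 : ℝ), ∀ m ≥ m₀, ∀ a X Y T : ℝ, 0 < a → a ≤ 1 / 2 → m ^ 6 ≤ |T| → 0 ≤ X →
    ∀ s : Finset ℤ, ∑ N ∈ s, ‖I m a X Y T N‖ ≤ K / m ^ 8

theorem HasReflectionBound.of_norm_le {I I₁ I₂ I₃ : ℝ → ℝ → ℝ → ℝ → ℝ → ℤ → ℂ}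
    (h₁ : HasReflectionBound I₁) (h₂ : HasReflectionBound I₂) (h₃ : HasReflectionBound I₃)
    (h : ∀ m a X Y T N, 1 ≤ m → 0 < a →
      ‖I m a X Y T N‖ ≤ ‖I₁ m a X Y T N‖ + ‖I₂ m a X Y T N‖ + ‖I₃ m a X Y T N‖) :
    HasReflectionBound I := by
  obtain ⟨K₁, hK₁, m₁, hm₁, hb₁⟩ := h₁
  obtain ⟨K₂, hK₂, m₂, hm₂, hb₂⟩ := h₂
  obtain ⟨K₃, hK₃, m₃, hm₃, hb₃⟩ := h₃
  refine ⟨K₁ + K₂ + K₃, by positivity, max m₁ (max m₂ m₃), hm₁.trans (le_max_left _ _),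
    fun m hm a X Y T ha ha1 hT hX s => ?_⟩
  obtain ⟨h1, h23⟩ := max_le_iff.1 hm
  obtain ⟨h2, h3⟩ := max_le_iff.1 h23
  calc ∑ N ∈ s, ‖I m a X Y T N‖
      ≤ ∑ N ∈ s, (‖I₁ m a X Y T N‖ + ‖I₂ m a X Y T N‖ + ‖I₃ m a X Y T N‖) :=
        Finset.sum_le_sum fun N _ => h m a X Y T N (by linarith) ha
    _ = ∑ N ∈ s, ‖I₁ m a X Y T N‖ + ∑ N ∈ s, ‖I₂ m a X Y T N‖ + ∑ N ∈ s, ‖I₃ m a X Y T N‖ := by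
        rw [Finset.sum_add_distrib, Finset.sum_add_distrib]
    _ ≤ K₁ / m ^ 8 + K₂ / m ^ 8 + K₃ / m ^ 8 :=
        add_le_add (add_le_add (hb₁ m h1 a X Y T ha ha1 hT hX s)
          (hb₂ m h2 a X Y T ha ha1 hT hX s)) (hb₃ m h3 a X Y T ha ha1 hT hX s)
    _ = _ := by ring

section Wave

variable {ℓ q q₁ q₂ : ℝ → ℝ} {γ c C : ℝ} (hℓ : IsAlmostLinearPhase ℓ q q₁ q₂ γ c C)
  {ψ₃ : ℝ → ℝ} (hψ₃c : ContDiff ℝ (⊤ : ℕ∞) ψ₃) (hψ₃ : tsupport ψ₃ ⊆ Set.Icc (9 / 10) 6)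
include hℓ hψ₃c hψ₃

theorem hasReflectionBound_of_isCuspAmplitude {χ : ℝ × ℝ → ℝ} (hχ : IsSpaceCutoff χ) {ζ : ℝ → ℝ}
    (hζ : IsFrequencyCutoff ζ) {f f' g g' : ℝ → ℝ → ℝ → ℝ}
    (hf : ∀ m, 1 ≤ m → IsCuspAmplitude m (f m) (f' m))
    (hg : ∀ m, 1 ≤ m → IsCuspAmplitude m (g m) (g' m)) :
    HasReflectionBound fun m a X Y T N => waveIntegral ℓ (m ^ 3) a X Y T (f m) (g m) χ ψ₃ ζ N := by
  obtain ⟨M, hM, hy⟩ := exists_isScalingAmplitude hℓ hχ hψ₃c hψ₃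
  obtain ⟨K₁, hK₁, m₁, hm₁, hb₁⟩ := exists_sum_integral_oscFactor_le hℓ hζ
  obtain ⟨K₂, hK₂, m₂, hm₂, hb₂⟩ := exists_sum_integral_oscFactor_le hℓ hζ.div_id
  obtain ⟨K₃, hK₃, m₃, hm₃, hb₃⟩ := exists_sum_integral_oscFactor_le hℓ hζ.deriv
  refine ⟨(K₁ + K₂ + K₃) * M, by positivity, max m₁ (max m₂ m₃), hm₁.trans (le_max_left _ _),
    fun m hm a X Y T ha ha1 hT hX s => ?_⟩
  obtain ⟨h1, h23⟩ := max_le_iff.1 hm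
  obtain ⟨h2, h3⟩ := max_le_iff.1 h23
  have hm1 : 1 ≤ m := by linarith
  obtain ⟨y₁, y₂, y₃, hy₁, hy₂, hy₃, hle⟩ := hy m a X Y T hm1 ha (by linarith)
    ((one_le_pow₀ hm1).trans hT) _ _ _ _ (hf m hm1) (hg m hm1)
  refine (Finset.sum_le_sum fun N _ => hle ζ hζ N).trans ?_
  rw [Finset.sum_add_distrib, Finset.sum_add_distrib]
  refine (add_le_add (add_le_add (hb₁ m h1 a X Y T ha ha1 hT hX M hM.le y₁ hy₁ s)
    (hb₂ m h2 a X Y T ha ha1 hT hX M hM.le y₂ hy₂ s))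
    (hb₃ m h3 a X Y T ha ha1 hT hX M hM.le y₃ hy₃ s)).trans_eq ?_
  ring

theorem hasReflectionBound_one_right {χ : ℝ × ℝ → ℝ} (hχ : IsSpaceCutoff χ) {ζ : ℝ → ℝ}
    (hζ : IsFrequencyCutoff ζ) {f f' : ℝ → ℝ → ℝ → ℝ}
    (hf : ∀ m, 1 ≤ m → IsCuspAmplitude m (f m) (f' m)) :
    HasReflectionBound fun m a X Y T N =>
      waveIntegral ℓ (m ^ 3) a X Y T (f m) (fun _ _ => 1) χ ψ₃ ζ N :=
  .of_norm_le
    (hasReflectionBound_of_isCuspAmplitude hℓ hψ₃c hψ₃ hχ hζ hf fun _ => isCuspAmplitude_one)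
    (hasReflectionBound_of_isCuspAmplitude hℓ hψ₃c hψ₃ (hχ.fderiv_apply (0, 1)) hζ.div_id hf
      fun _ => isCuspAmplitude_three)
    (hasReflectionBound_of_isCuspAmplitude hℓ hψ₃c hψ₃ hχ hζ.div_id hf fun _ => isCuspAmplitude_two)
    fun m _ X Y T N hm ha => norm_waveIntegral_le_second hℓ (by linarith) ha X Y T N hχ
      hψ₃c.continuous hψ₃ hζ (hf m hm).cont

theorem hasReflectionBound_one_one {χ : ℝ × ℝ → ℝ} (hχ : IsSpaceCutoff χ) {ζ : ℝ → ℝ}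
    (hζ : IsFrequencyCutoff ζ) :
    HasReflectionBound fun m a X Y T N =>
      waveIntegral ℓ (m ^ 3) a X Y T (fun _ _ => 1) (fun _ _ => 1) χ ψ₃ ζ N :=
  .of_norm_le
    (hasReflectionBound_one_right hℓ hψ₃c hψ₃ hχ hζ fun _ => isCuspAmplitude_one)
    (hasReflectionBound_one_right hℓ hψ₃c hψ₃ (hχ.fderiv_apply (1, 0)) hζ.div_id
      fun _ => isCuspAmplitude_three)
    (hasReflectionBound_one_right hℓ hψ₃c hψ₃ hχ hζ.div_id fun _ => isCuspAmplitude_two)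
    fun _ _ X Y T N hm ha => norm_waveIntegral_le_first hℓ (by linarith) ha X Y T N hχ
      hψ₃c.continuous hψ₃ hζ continuous_const

end Wave

theorem norm_Wtan_eq (L ψ : ℝ → ℝ) (χ₂ : ℝ × ℝ → ℝ) (ψ₃ : ℝ → ℝ) {h a : ℝ} (hh : 0 < h)
    (ha : 0 < a) (N : ℤ) (T X Y : ℝ) :
    ‖Wtan L ψ χ₂ ψ₃ h a N T X Y‖ = a ^ 2 / (2 * π * h) ^ 3 *
      ‖waveIntegral (fun u => L (u ^ ((2 : ℝ) / 3))) (a ^ ((3 : ℝ) / 2) / h) a X Y T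
        (fun _ _ => 1) (fun _ _ => 1) χ₂ ψ₃ (fun η => η ^ 2 * ψ η) N‖ := by
  have hlam : a ^ ((3 : ℝ) / 2) / h ≠ 0 := (div_pos (Real.rpow_pos_of_pos ha _) hh).ne'
  have hpi := Real.pi_pos
  have key : ∫ v : ℝ × ℝ × ℝ × ℝ, Complex.exp (Complex.I *
      (((a ^ ((3:ℝ)/2) / h) * PsiTan L h a N T X Y v.2.1 v.1 v.2.2.1 v.2.2.2 : ℝ) : ℂ)) *
      ((v.2.2.2 ^ 2 * ψ v.2.2.2 * χ₂ (v.1, v.2.1) * ψ₃ v.2.2.1 : ℝ) : ℂ)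
      = Complex.exp (((N * (π / 2) : ℝ) : ℂ) * Complex.I) *
        waveIntegral (fun u => L (u ^ ((2 : ℝ) / 3))) (a ^ ((3 : ℝ) / 2) / h) a X Y T
        (fun _ _ => 1) (fun _ _ => 1) χ₂ ψ₃ (fun η => η ^ 2 * ψ η) N := by
    rw [waveIntegral, ← integral_const_mul]
    refine integral_congr_ae (Eventually.of_forall fun v => ?_)
    obtain ⟨S, Υ, A, η⟩ := v
    simp only [PsiTan, Bfun, oscFactor, waveAmplitude, cubicPhase, travelTime]
    generalize a ^ ((3 : ℝ) / 2) / h = lam at *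
    rw [← mul_assoc (Complex.exp (((N * (π / 2) : ℝ) : ℂ) * Complex.I)), ← Complex.exp_add]
    congr 1
    · congr 1
      rw [mul_comm _ Complex.I, ← mul_add, ← Complex.ofReal_add, mul_comm η lam]
      congr 2
      generalize L _ = l
      field_simp
      ring
    · push_cast
      ring
  rw [Wtan, key, norm_mul, norm_mul, Complex.norm_exp_ofReal_mul_I, one_mul, Complex.norm_real,
    Real.norm_of_nonneg (by positivity)]

theorem finite_setOf_abs_intCast_le (r : ℝ) : {N : ℤ | |(N : ℝ)| ≤ r}.Finite := by
  refine (Set.finite_Icc (-⌈r⌉) ⌈r⌉).subset fun N hN => ?_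
  obtain ⟨h1, h2⟩ := abs_le.1 (show |(N : ℝ)| ≤ r from hN)
  have h3 := Int.le_ceil r
  constructor
  · exact_mod_cast (by push_cast; linarith : ((-⌈r⌉ : ℤ) : ℝ) ≤ N)
  · exact_mod_cast h2.trans h3

theorem norm_Gsharp_le (L ψ : ℝ → ℝ) (χ₂ : ℝ × ℝ → ℝ) (ψ₃ : ℝ → ℝ) (h a T X Y : ℝ) :
    ∃ s : Finset ℤ, ‖Gsharp L ψ χ₂ ψ₃ h a T X Y‖ ≤ ∑ N ∈ s, ‖Wtan L ψ χ₂ ψ₃ h a N T X Y‖ := by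
  have hf := finite_setOf_abs_intCast_le (2 / √a)
  refine ⟨hf.toFinset, ?_⟩
  rw [Gsharp, tsum_eq_sum (s := hf.toFinset) fun N hN =>
    Set.indicator_of_notMem (fun h' => hN (hf.mem_toFinset.2 h')) _]
  refine (norm_sum_le _ _).trans (Finset.sum_le_sum fun N hN => ?_)
  rw [Set.indicator_of_mem (hf.mem_toFinset.1 hN)]

theorem le_rpow_div_of_rpow_le {h a ε M : ℝ} (hh : 0 < h) (hε : 0 < ε) (hM : 1 ≤ M)
    (hhM : h ≤ M ^ (-(2 / (3 * ε)))) (ha : h ^ ((2 : ℝ) / 3 - ε) ≤ a) :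
    M ≤ a ^ ((3 : ℝ) / 2) / h := by
  have hM0 : 0 < M := by linarith
  have h1 : (h ^ ((2 : ℝ) / 3 - ε)) ^ ((3 : ℝ) / 2) ≤ a ^ ((3 : ℝ) / 2) :=
    Real.rpow_le_rpow (Real.rpow_nonneg hh.le _) ha (by norm_num)
  have h2 : (M ^ (-(2 / (3 * ε)))) ^ (-(3 * ε / 2)) ≤ h ^ (-(3 * ε / 2)) :=
    Real.rpow_le_rpow_of_nonpos hh hhM (by linarith)
  rw [← Real.rpow_mul hM0.le, show -(2 / (3 * ε)) * -(3 * ε / 2) = 1 by field_simp,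
    Real.rpow_one] at h2
  rw [← Real.rpow_mul hh.le] at h1
  rw [le_div_iff₀ hh]
  calc M * h ≤ h ^ (-(3 * ε / 2)) * h := by gcongr
    _ = h ^ (((2 : ℝ) / 3 - ε) * (3 / 2)) := by
      rw [← Real.rpow_add_one hh.ne']
      congr 1
      ring
    _ ≤ _ := h1

theorem sq_div_cube_eq {h a : ℝ} (hh : 0 < h) (ha : 0 < a) :
    a ^ 2 / h ^ 3 = h ^ ((1 : ℝ) / 3) / h ^ 2 * (a ^ ((3 : ℝ) / 2) / h) ^ ((4 : ℝ) / 3) := by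
  rw [Real.div_rpow (Real.rpow_nonneg ha.le _) hh.le, ← Real.rpow_mul ha.le,
    show (3 : ℝ) / 2 * (4 / 3) = (2 : ℕ) by norm_num, Real.rpow_natCast,
    show (4 : ℝ) / 3 = 1 / 3 + 1 by norm_num, Real.rpow_add_one hh.ne']
  have := Real.rpow_pos_of_pos hh (1 / 3)
  field_simp

/-- dispersive bound for `G^♯` at very large times `λ² ≤ |T| ≤ 2a^{−1/2}`. -/
theorem dispersion_Gsharp_largeT
    (Ai : ℂ → ℂ)
    (hAi_diff : Differentiable ℂ Ai)
    (hAi_diff' : Differentiable ℂ (deriv Ai))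
    (hAi_ode : ∀ z : ℂ, deriv (deriv Ai) z = z * Ai z)
    (hAi_zero : Ai 0 = (3 : ℂ) ^ (-(2 : ℂ)/3) / Complex.Gamma (2/3))
    (hAi_zero' : deriv Ai 0 = -((3 : ℂ) ^ (-(1 : ℂ)/3)) / Complex.Gamma (1/3))
    (hAi_real : ∀ x : ℝ, (Ai x).im = 0)
    (L : ℝ → ℝ)
    (hL_cont : Continuous L)
    (hL_zero : L 0 = Real.pi / 3)
    (hAp_ne : ∀ w : ℝ, Aplus Ai w ≠ 0)
    (hL_char : ∀ w : ℝ, Complex.exp (-(L w : ℂ) * Complex.I) = -(Aminus Ai w) / (Aplus Ai w))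
    (ψ : ℝ → ℝ) (hψ : ContDiff ℝ (⊤ : ℕ∞) ψ) (hψs : tsupport ψ ⊆ Set.Icc (1/2 : ℝ) (3/2))
    (χ₂ : ℝ × ℝ → ℝ) (hχ₂ : ContDiff ℝ (⊤ : ℕ∞) χ₂) (hχ₂c : HasCompactSupport χ₂)
    (hχ₂s : tsupport χ₂ ⊆ {p : ℝ × ℝ | |p.1| < 3 ∧ |p.2| < 3})
    (ψ₃ : ℝ → ℝ) (hψ₃ : ContDiff ℝ (⊤ : ℕ∞) ψ₃) (hψ₃s : tsupport ψ₃ ⊆ Set.Icc (9/10 : ℝ) 6)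
    (ε : ℝ) (hε : ε ∈ Set.Ioo (0:ℝ) (1/10)) :
    ∃ a₀ ∈ Set.Ioo (0:ℝ) 1, ∃ h₀ ∈ Set.Ioo (0:ℝ) 1, ∃ C : ℝ,
      ∀ h a : ℝ, 0 < h → h ≤ h₀ → h ^ ((2:ℝ)/3 - ε) ≤ a → a ≤ a₀ →
      ∀ X : ℝ, 0 ≤ X → ∀ Y T : ℝ,
        (a ^ ((3:ℝ)/2) / h) ^ 2 ≤ |T| → |T| ≤ 2 / Real.sqrt a →
        ‖Gsharp L ψ χ₂ ψ₃ h a T X Y‖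
          ≤ C * (h ^ ((1:ℝ)/3) / h ^ 2) * (a ^ ((3:ℝ)/2) / h) ^ (-(4:ℝ)/3) := by
  have hpi := Real.pi_pos
  have hk : 0 < √3 * sexticMoment 1 0 (1 / 12) := by
    rw [sexticMoment_zero_left]
    have : 0 < Real.Gamma (((2 * 1 : ℕ) + 1) / 6) := Real.Gamma_pos_of_pos (by norm_num)
    positivity
  obtain ⟨q, q₁, q₂, g, c, C, hℓ⟩ := exists_isAlmostLinearPhase hk fun w hw =>
    hasDerivAt_airyPhase hAi_diff hAi_diff' hAi_ode hAi_zero hAi_zero' hL_cont hAp_ne hL_char hw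
  have hζ : IsFrequencyCutoff fun η => η ^ 2 * ψ η :=
    ⟨by fun_prop, (tsupport_mul_subset_right (f := fun η : ℝ => η ^ 2) (g := ψ)).trans hψs⟩
  obtain ⟨K, hK, m₀, hm₀, hbd⟩ := hasReflectionBound_one_one hℓ hψ₃ hψ₃s ⟨hχ₂, hχ₂s⟩ hζ
  have hm₀1 : 1 ≤ m₀ ^ 3 := one_le_pow₀ (by linarith)
  refine ⟨1 / 2, by norm_num, min (1 / 2) ((m₀ ^ 3) ^ (-(2 / (3 * ε)))),
    ⟨by positivity, by linarith [min_le_left (1 / 2 : ℝ) ((m₀ ^ 3) ^ (-(2 / (3 * ε))))]⟩,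
    K / (2 * π) ^ 3, fun h a hh hh₀ hha ha₀ X hX Y T hT _ => ?_⟩
  have ha : 0 < a := (Real.rpow_pos_of_pos hh _).trans_le hha
  have hlam := le_rpow_div_of_rpow_le hh hε.1 hm₀1 (hh₀.trans (min_le_right _ _)) hha
  have hpow := sq_div_cube_eq hh ha
  obtain ⟨s, hs⟩ := norm_Gsharp_le L ψ χ₂ ψ₃ h a T X Y
  simp only [norm_Wtan_eq L ψ χ₂ ψ₃ hh ha, ← Finset.mul_sum] at hs
  set lam : ℝ := a ^ ((3 : ℝ) / 2) / h with hlam_def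
  have hlam0 : 0 < lam := by linarith
  obtain ⟨m, hm, hm3⟩ : ∃ m, m₀ ≤ m ∧ m ^ 3 = lam := by
    refine ⟨lam ^ ((1 : ℝ) / 3), ?_, ?_⟩
    · refine le_of_pow_le_pow_left₀ (n := 3) (by norm_num) (by positivity) ?_
      rwa [← Real.rpow_natCast (lam ^ ((1 : ℝ) / 3)), ← Real.rpow_mul hlam0.le,
        show (1 : ℝ) / 3 * (3 : ℕ) = 1 by norm_num, Real.rpow_one]
    · rw [← Real.rpow_natCast, ← Real.rpow_mul hlam0.le,
        show (1 : ℝ) / 3 * (3 : ℕ) = 1 by norm_num, Real.rpow_one]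
  have hm0 : 0 < m := by linarith
  have hm4 : lam ^ ((4 : ℝ) / 3) = m ^ 4 := by
    rw [← hm3, ← Real.rpow_natCast m 3, ← Real.rpow_mul hm0.le, ← Real.rpow_natCast m 4]
    norm_num
  have hm4' : lam ^ (-(4 : ℝ) / 3) = 1 / m ^ 4 := by
    rw [neg_div, Real.rpow_neg hlam0.le, hm4, one_div]
  have hsum := hbd m hm a X Y T ha ha₀
      (by rw [← hm3] at hT; linarith [show (m ^ 3) ^ 2 = m ^ 6 by ring])
      hX s
  beta_reduce at hsum
  rw [hm3] at hsum
  rw [hm4']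
  rw [hm4] at hpow
  calc ‖Gsharp L ψ χ₂ ψ₃ h a T X Y‖ ≤ a ^ 2 / (2 * π * h) ^ 3 * (K / m ^ 8) :=
        hs.trans (mul_le_mul_of_nonneg_left hsum (by positivity))
    _ = a ^ 2 / h ^ 3 * (K / (2 * π) ^ 3 / m ^ 8) := by
        field_simp
    _ = _ := by
        rw [hpow]
        field_simp
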